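/- Let 2 < p ≤ (1+√17)/2 and 1 < γ₀ < p−1, and let B > 0. There exists a constant C > 0, depending only on p, γ₀ and B, such that every smooth solution φ of the defocusing semilinear wave equation with E_{0,γ₀}[φ] ≤ B and E_{1,γ₀}[φ] < ∞ satisfies, for all t ≥ 0 and x ∈ ℝ³, |φ(t,x)| ≤ C √(E_{1,γ₀}[φ]) (1 + t + |x|)^{−α_p γ₀} (1 + | |x| − t |)^{−γ₀/(p+1)}, where α_p = (3+(p−2)²)/((p+1)(5−p)). -/

import Mathlib

open MeasureTheory Real
open scoped ENNReal InnerProductSpace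

noncomputable section

/-- Three-dimensional Euclidean space. -/
abbrev E3 : Type := EuclideanSpace ℝ (Fin 3)

/-- Second derivative of `f` at `x` in the direction `v`. -/
def der2 (f : E3 → ℝ) (x v : E3) : ℝ := fderiv ℝ (fun y => fderiv ℝ f y v) x v

/-- The (spatial) Laplacian on `ℝ³`. -/
def lap3 (f : E3 → ℝ) (x : E3) : ℝ :=
  ∑ i : Fin 3, der2 f x (EuclideanSpace.single i 1)

/-- First time derivative `∂_t φ`. -/
def dt1 (φ : ℝ → E3 → ℝ) (t : ℝ) (x : E3) : ℝ := deriv (fun s => φ s x) t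

/-- Second time derivative `∂_t² φ`. -/
def dtt (φ : ℝ → E3 → ℝ) (t : ℝ) (x : E3) : ℝ := deriv (fun s => dt1 φ s x) t

/-- `φ` is a smooth solution of the defocusing semilinear wave equation
`∂_t²φ − Δφ + |φ|^{p−1}φ = 0` on `[0,∞) × ℝ³`. -/
def IsNLWSolution (p : ℝ) (φ : ℝ → E3 → ℝ) : Prop :=
  ContDiff ℝ (⊤ : ℕ∞) (fun q : ℝ × E3 => φ q.1 q.2) ∧
    ∀ t : ℝ, 0 ≤ t → ∀ x : E3,
      dtt φ t x - lap3 (φ t) x + |φ t x| ^ (p - 1) * φ t x = 0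

/-- The weighted initial energy `E_{k,γ₀}[φ]`. -/
def wEnergy (p : ℝ) (k : ℕ) (γ₀ : ℝ) (φ : ℝ → E3 → ℝ) : ℝ≥0∞ :=
  (∑ l ∈ Finset.range (k + 1),
    ∫⁻ x : E3, ENNReal.ofReal ((1 + ‖x‖) ^ (γ₀ + 2 * (l : ℝ)) *
      (‖iteratedFDeriv ℝ (l + 1) (φ 0) x‖ ^ 2 + ‖iteratedFDeriv ℝ l (dt1 φ 0) x‖ ^ 2))) +
  ∫⁻ x : E3, ENNReal.ofReal ((1 + ‖x‖) ^ γ₀ * |φ 0 x| ^ (p + 1))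

/-- `u₊ = √(1+((t−r)/2)²)`. -/
def uplus (t r : ℝ) : ℝ := Real.sqrt (1 + ((t - r) / 2) ^ 2)

/-- `v₊ = √(1+((t+r)/2)²)`. -/
def vplus (t r : ℝ) : ℝ := Real.sqrt (1 + ((t + r) / 2) ^ 2)

/-- Surface measure on the unit sphere `S² ⊂ ℝ³` (total mass `4π`). -/
def sphereMeasure : Measure (Metric.sphere (0 : E3) 1) := (volume : Measure E3).toSphere

/-- The unit sphere in `ℝ³`. -/
abbrev S2 : Type := Metric.sphere (0 : E3) 1

instance : IsFiniteMeasure sphereMeasure := by unfold sphereMeasure; infer_instance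

lemma S2.norm_coe (ω : S2) : ‖(ω : E3)‖ = 1 := by simp

/-- Integration in polar coordinates around `x₀`. -/
lemma lintegral_polar (F : E3 → ℝ≥0∞) (hF : Measurable F) (x₀ : E3) :
    ∫⁻ x, F x = ∫⁻ ρ in Set.Ioi (0 : ℝ), ENNReal.ofReal (ρ ^ 2) *
      ∫⁻ ω : S2, F (x₀ + ρ • (ω : E3)) ∂sphereMeasure := by
  have h0 : ∫⁻ x, F x = ∫⁻ x, F (x₀ + x) := (lintegral_add_left_eq_self F x₀).symm
  rw [h0]
  have hd : Module.finrank ℝ E3 - 1 = 2 := by simp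
  have hmp := (volume : Measure E3).measurePreserving_homeomorphUnitSphereProd
  rw [hd] at hmp
  have hG : Measurable (fun q : S2 × Set.Ioi (0 : ℝ) => F (x₀ + (q.2 : ℝ) • (q.1 : E3))) :=
    hF.comp (by fun_prop)
  have h1 := hmp.lintegral_comp hG
  have hae : ∫⁻ x, F (x₀ + x) = ∫⁻ x in ({0}ᶜ : Set E3), F (x₀ + x) := by
    rw [restrict_compl_singleton]
  rw [hae, ← lintegral_subtype_comap (MeasurableSet.singleton (0 : E3)).compl
    (fun x => F (x₀ + x))]
  have h2 : ∀ a : ({0}ᶜ : Set E3), F (x₀ + (((homeomorphUnitSphereProd E3) a).2 : ℝ) •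
      (((homeomorphUnitSphereProd E3) a).1 : E3)) = F (x₀ + (a : E3)) := by
    intro a
    have : ‖(a : E3)‖ ≠ 0 := norm_ne_zero_iff.mpr a.2
    simp [homeomorphUnitSphereProd, smul_smul, this]
  simp only [h2] at h1
  rw [h1, lintegral_prod_symm _ hG.aemeasurable]
  unfold Measure.volumeIoiPow
  rw [lintegral_withDensity_eq_lintegral_mul]
  · rw [← lintegral_subtype_comap measurableSet_Ioi
      (fun ρ => ENNReal.ofReal (ρ ^ 2) *
      ∫⁻ ω : S2, F (x₀ + ρ • (ω : E3)) ∂sphereMeasure)]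
    rfl
  · fun_prop
  · exact hG.lintegral_prod_left'

lemma S2.continuous_integrable {X : Type*} [TopologicalSpace X] [CompactSpace X]
    [MeasurableSpace X] [BorelSpace X] (μ : Measure X) [IsFiniteMeasure μ] {f : X → ℝ}
    (hf : Continuous f) : Integrable f μ :=
  hf.integrable_of_hasCompactSupport (HasCompactSupport.of_compactSpace f)

/-- Differentiation under the integral sign over a compact space. -/
lemma hasDerivAt_integral_compact {X : Type*} [TopologicalSpace X] [CompactSpace X]
    [MeasurableSpace X] [BorelSpace X] (μ : Measure X) [IsFiniteMeasure μ]
    {F F' : ℝ → X → ℝ} (hF : ∀ t, Continuous (F t))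
    (hF' : Continuous (fun q : ℝ × X => F' q.1 q.2))
    (hd : ∀ t x, HasDerivAt (fun s => F s x) (F' t x) t) (t : ℝ) :
    HasDerivAt (fun s => ∫ x, F s x ∂μ) (∫ x, F' t x ∂μ) t := by
  have hcomp : IsCompact (Set.Icc (t - 1) (t + 1) ×ˢ (Set.univ : Set X)) :=
    isCompact_Icc.prod isCompact_univ
  obtain ⟨C, hC⟩ := hcomp.exists_bound_of_continuousOn hF'.continuousOn
  refine (hasDerivAt_integral_of_dominated_loc_of_deriv_le
    (s := Set.Icc (t - 1) (t + 1)) (bound := fun _ => C)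
    (Icc_mem_nhds (by linarith) (by linarith)) ?_ ?_ ?_ ?_ ?_ ?_).2
  · exact Filter.Eventually.of_forall fun s =>
      (S2.continuous_integrable μ (hF s)).aestronglyMeasurable
  · exact S2.continuous_integrable μ (hF t)
  · exact (S2.continuous_integrable μ (hF'.comp (by fun_prop : Continuous fun x : X => (t, x)))).aestronglyMeasurable
  · exact Filter.Eventually.of_forall fun x s hs => hC (s, x) ⟨hs, trivial⟩
  · exact integrable_const _
  · exact Filter.Eventually.of_forall fun x s _ => hd s x

lemma continuous_integral_compact {X Y : Type*} [TopologicalSpace X] [CompactSpace X]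
    [MeasurableSpace X] [BorelSpace X] (μ : Measure X) [IsFiniteMeasure μ]
    [TopologicalSpace Y] [FirstCountableTopology Y] [WeaklyLocallyCompactSpace Y]
    {F : Y → X → ℝ} (hF : Continuous (fun q : Y × X => F q.1 q.2)) :
    Continuous (fun y => ∫ x, F y x ∂μ) := by
  rw [continuous_iff_continuousAt]
  intro y
  obtain ⟨K, hK, hKy⟩ := exists_compact_mem_nhds y
  obtain ⟨C, hC⟩ := (hK.prod (isCompact_univ (X := X))).exists_bound_of_continuousOn
    hF.continuousOn
  refine continuousAt_of_dominated (bound := fun _ => C) ?_ ?_ (integrable_const _) ?_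
  · exact Filter.Eventually.of_forall fun s => (S2.continuous_integrable μ
      (hF.comp (by fun_prop : Continuous fun x : X => (s, x)))).aestronglyMeasurable
  · filter_upwards [hKy] with s hs
    exact Filter.Eventually.of_forall fun x => hC (s, x) ⟨hs, trivial⟩
  · exact Filter.Eventually.of_forall fun x =>
      (hF.comp (by fun_prop : Continuous fun y : Y => (y, x))).continuousAt

open scoped Pointwise in
/-- The sphere measure is invariant under linear isometries. -/
lemma sphereMeasure_map_isometry (R : E3 ≃ₗᵢ[ℝ] E3) (F : E3 → ℝ) :
    ∫ ω : S2, F (R ω) ∂sphereMeasure = ∫ ω : S2, F ω ∂sphereMeasure := by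
  let r : S2 → S2 := fun ω => ⟨R ω, by simp⟩
  let r' : S2 → S2 := fun ω => ⟨R.symm ω, by simp⟩
  have hr : Continuous r := by
    apply Continuous.subtype_mk; exact R.continuous.comp continuous_subtype_val
  have hr' : Continuous r' := by
    apply Continuous.subtype_mk; exact R.symm.continuous.comp continuous_subtype_val
  let rh : S2 ≃ₜ S2 :=
    { toFun := r, invFun := r', left_inv := fun ω => by ext1; simp [r, r'],
      right_inv := fun ω => by ext1; simp [r, r'], continuous_toFun := hr,
      continuous_invFun := hr' }
  have hmp : MeasurePreserving rh sphereMeasure sphereMeasure := by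
    refine ⟨rh.continuous.measurable, ?_⟩
    ext s hs
    rw [Measure.map_apply rh.continuous.measurable hs]
    unfold sphereMeasure
    rw [Measure.toSphere_apply' _ hs, Measure.toSphere_apply' _ (rh.continuous.measurable hs)]
    congr 1
    have h := R.measurePreserving.measure_preimage_emb R.toHomeomorph.measurableEmbedding
      (Set.Ioo (0 : ℝ) 1 • (Subtype.val '' s))
    rw [← h]
    congr 1
    ext x
    simp only [Set.mem_smul, Set.mem_image, Set.mem_preimage]
    constructor
    · rintro ⟨a, ha, y, ⟨ω, hω, rfl⟩, rfl⟩
      refine ⟨a, ha, R ω, ⟨rh ω, hω, rfl⟩, ?_⟩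
      simp
    · rintro ⟨a, ha, y, ⟨ω, hω, rfl⟩, h⟩
      refine ⟨a, ha, R.symm ω, ⟨rh.symm ω, ?_, rfl⟩, ?_⟩
      · simpa using hω
      · apply R.injective
        simpa using h
  exact hmp.integral_comp rh.measurableEmbedding (fun ω : S2 => F ω)

/-- The `i`-th standard basis vector of `ℝ³`. -/
abbrev bv (i : Fin 3) : E3 := EuclideanSpace.single i 1

/-- Rotation by the angle `θ` in the plane of the coordinates `i`, `j`. -/
def planeRot (i j : Fin 3) (θ : ℝ) (x : E3) : E3 :=
  x + ((cos θ - 1) * x i - sin θ * x j) • bv i + (sin θ * x i + (cos θ - 1) * x j) • bv j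

lemma planeRot_norm {i j : Fin 3} (hij : i ≠ j) (θ : ℝ) (x : E3) :
    ‖planeRot i j θ x‖ = ‖x‖ := by
  have h : sin θ ^ 2 = 1 - cos θ ^ 2 := by have := sin_sq_add_cos_sq θ; linarith
  rw [EuclideanSpace.norm_eq, EuclideanSpace.norm_eq]
  congr 1
  simp only [Real.norm_eq_abs, sq_abs, Fin.sum_univ_three, planeRot]
  fin_cases i <;> fin_cases j <;> simp at hij ⊢ <;> ring_nf <;> simp only [h] <;> ring

def planeRotIso {i j : Fin 3} (hij : i ≠ j) (θ : ℝ) : E3 ≃ₗᵢ[ℝ] E3 :=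
  LinearIsometry.toLinearIsometryEquiv
    { toFun := planeRot i j θ
      map_add' := fun x y => by
        ext k; simp [planeRot]; split_ifs <;> ring
      map_smul' := fun c x => by
        ext k; simp [planeRot]; try (split_ifs <;> ring)
      norm_map' := fun x => planeRot_norm hij θ x } rfl

/-- Angular derivatives of `C¹` functions integrate to zero over the sphere. -/
lemma integral_rotation_field {F : E3 → ℝ} (hF : ContDiff ℝ 1 F) {i j : Fin 3} (hij : i ≠ j) :
    ∫ ω : S2, ((ω : E3) i * fderiv ℝ F ω (bv j) - (ω : E3) j * fderiv ℝ F ω (bv i))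
      ∂sphereMeasure = 0 := by
  have hc : Continuous (fun q : ℝ × S2 => planeRot i j q.1 q.2) := by
    unfold planeRot; fun_prop
  have hd : ∀ (t : ℝ) (ω : S2), HasDerivAt (fun s => planeRot i j s ω)
      ((-sin t * (ω : E3) i - cos t * (ω : E3) j) • bv i +
        (cos t * (ω : E3) i - sin t * (ω : E3) j) • bv j) t := by
    intro t ω
    unfold planeRot
    have h1 : HasDerivAt (fun s => (cos s - 1) * (ω : E3) i - sin s * (ω : E3) j)
      (-sin t * (ω : E3) i - cos t * (ω : E3) j) t :=
      (((hasDerivAt_cos t).sub_const 1).mul_const _).sub ((hasDerivAt_sin t).mul_const _)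
    have h2 : HasDerivAt (fun s => sin s * (ω : E3) i + (cos s - 1) * (ω : E3) j)
      (cos t * (ω : E3) i - sin t * (ω : E3) j) t := by
      have h := ((hasDerivAt_sin t).mul_const ((ω : E3) i)).add
        (((hasDerivAt_cos t).sub_const 1).mul_const ((ω : E3) j))
      rwa [neg_mul, ← sub_eq_add_neg] at h
    exact ((h1.smul_const (bv i)).const_add (ω : E3)).add (h2.smul_const (bv j))
  have hfd : Continuous (fderiv ℝ F) := hF.continuous_fderiv (by norm_num)
  have key := hasDerivAt_integral_compact sphereMeasure
    (F := fun θ (ω : S2) => F (planeRot i j θ ω))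
    (F' := fun θ (ω : S2) => fderiv ℝ F (planeRot i j θ ω)
      ((-sin θ * (ω : E3) i - cos θ * (ω : E3) j) • bv i +
        (cos θ * (ω : E3) i - sin θ * (ω : E3) j) • bv j))
    (fun θ => hF.continuous.comp (hc.comp (by fun_prop : Continuous fun ω : S2 => (θ, ω))))
    ((hfd.comp hc).clm_apply (by fun_prop))
    (fun θ ω => ((hF.differentiable (by norm_num)).differentiableAt.hasFDerivAt).comp_hasDerivAt θ
      (hd θ ω)) 0
  have hconst : (fun θ => ∫ ω : S2, F (planeRot i j θ ω) ∂sphereMeasure) =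
      fun _ => ∫ ω : S2, F ω ∂sphereMeasure := by
    funext θ
    exact sphereMeasure_map_isometry (planeRotIso hij θ) F
  rw [hconst] at key
  have h0 := key.unique (hasDerivAt_const (0 : ℝ) _)
  have hz : ∀ x : E3, planeRot i j 0 x = x := fun x => by simp [planeRot]
  rw [← h0]
  congr 1
  funext ω
  simp [hz, map_add, map_smul]
  ring

lemma E3.eq_sum (x : E3) : x = ∑ i, x i • bv i := by
  ext k; fin_cases k <;> simp [Fin.sum_univ_three]

lemma S2.sum_sq (ω : S2) : (ω : E3) 0 ^ 2 + (ω : E3) 1 ^ 2 + (ω : E3) 2 ^ 2 = 1 := by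
  have h := S2.norm_coe ω
  rw [EuclideanSpace.norm_eq, Real.sqrt_eq_one] at h
  simpa [Fin.sum_univ_three] using h

lemma fderiv_E3_sum (F : E3 → ℝ) (x v : E3) :
    fderiv ℝ F x v = v 0 * fderiv ℝ F x (bv 0) + v 1 * fderiv ℝ F x (bv 1)
      + v 2 * fderiv ℝ F x (bv 2) := by
  conv_lhs => rw [E3.eq_sum v]
  simp [Fin.sum_univ_three, map_add, map_smul]

/-- Integration by parts on spheres: the tangential divergence theorem. -/
lemma integral_sphere_div {Y : Fin 3 → E3 → ℝ} (hY : ∀ i, ContDiff ℝ 1 (Y i)) (x₀ : E3)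
    (s : ℝ) :
    ∫ ω : S2, (s * ∑ i, fderiv ℝ (Y i) (x₀ + s • (ω : E3)) (bv i)
      - 2 * ∑ i, (ω : E3) i * Y i (x₀ + s • (ω : E3))
      - s * ∑ i, (ω : E3) i * fderiv ℝ (Y i) (x₀ + s • (ω : E3)) ω) ∂sphereMeasure = 0 := by
  let Z : Fin 3 → E3 → ℝ := fun i w => Y i (x₀ + s • w)
  have hZ : ∀ i, ContDiff ℝ 1 (Z i) := fun i => (hY i).comp (by fun_prop)
  have hZd : ∀ i w v, fderiv ℝ (Z i) w v = s * fderiv ℝ (Y i) (x₀ + s • w) v := by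
    intro i w v
    have h1 : HasFDerivAt (fun w : E3 => x₀ + s • w) (s • ContinuousLinearMap.id ℝ E3) w :=
      ((hasFDerivAt_id w).const_smul s).const_add x₀
    have h2 := (((hY i).differentiable (by norm_num)).differentiableAt (x := x₀ + s • w)).hasFDerivAt.comp w h1
    have h3 : HasFDerivAt (Z i) _ w := h2
    rw [h3.fderiv]
    simp
  let G : Fin 3 → Fin 3 → E3 → ℝ := fun i j w => w i * Z j w - w j * Z i w
  have hG : ∀ i j, ContDiff ℝ 1 (G i j) := by
    intro i j
    have := hZ i; have := hZ j
    have hi : ContDiff ℝ 1 (fun w : E3 => w i) := by fun_prop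
    have hj : ContDiff ℝ 1 (fun w : E3 => w j) := by fun_prop
    exact (hi.mul (hZ j)).sub (hj.mul (hZ i))
  have hGd : ∀ i j w v, fderiv ℝ (G i j) w v =
      v i * Z j w + w i * fderiv ℝ (Z j) w v - (v j * Z i w + w j * fderiv ℝ (Z i) w v) := by
    intro i j w v
    have hp : ∀ k, HasFDerivAt (fun w : E3 => w k) (EuclideanSpace.proj k : E3 →L[ℝ] ℝ) w :=
      fun k => (EuclideanSpace.proj k : E3 →L[ℝ] ℝ).hasFDerivAt
    have hz : ∀ k, HasFDerivAt (Z k) (fderiv ℝ (Z k) w) w := fun k =>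
      (((hZ k).differentiable (by norm_num)).differentiableAt).hasFDerivAt
    have h : HasFDerivAt (G i j) _ w := ((hp i).mul (hz j)).sub ((hp j).mul (hz i))
    rw [h.fderiv]
    simp
    ring
  have I : ∀ i j, i ≠ j → ∫ ω : S2, ((ω : E3) i * fderiv ℝ (G i j) ω (bv j)
      - (ω : E3) j * fderiv ℝ (G i j) ω (bv i)) ∂sphereMeasure = 0 :=
    fun i j hij => integral_rotation_field (hG i j) hij
  have Ii : ∀ i j, Integrable (fun ω : S2 => (ω : E3) i * fderiv ℝ (G i j) ω (bv j)
      - (ω : E3) j * fderiv ℝ (G i j) ω (bv i)) sphereMeasure := by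
    intro i j
    apply S2.continuous_integrable
    have := (hG i j).continuous_fderiv (by norm_num)
    fun_prop
  have h3 : ∫ ω : S2, ((((ω : E3) 0 * fderiv ℝ (G 0 1) ω (bv 1)
      - (ω : E3) 1 * fderiv ℝ (G 0 1) ω (bv 0)) + ((ω : E3) 0 * fderiv ℝ (G 0 2) ω (bv 2)
      - (ω : E3) 2 * fderiv ℝ (G 0 2) ω (bv 0))) + ((ω : E3) 1 * fderiv ℝ (G 1 2) ω (bv 2)
      - (ω : E3) 2 * fderiv ℝ (G 1 2) ω (bv 1))) ∂sphereMeasure = 0 := by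
    have e1 := integral_add ((Ii 0 1).add (Ii 0 2)) (Ii 1 2)
    have e2 := integral_add (Ii 0 1) (Ii 0 2)
    refine e1.trans ?_
    rw [I 1 2 (by decide), add_zero]
    refine e2.trans ?_
    rw [I 0 1 (by decide), I 0 2 (by decide), add_zero]
  rw [← h3]
  congr 1
  funext ω
  simp only [hGd, Fin.sum_univ_three]
  have hsq := S2.sum_sq ω
  have e0 := fderiv_E3_sum (Y 0) (x₀ + s • (ω : E3)) ω
  have e1 := fderiv_E3_sum (Y 1) (x₀ + s • (ω : E3)) ω
  have e2 := fderiv_E3_sum (Y 2) (x₀ + s • (ω : E3)) ω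
  rw [e0, e1, e2]
  simp [hZd, Z]
  linear_combination (-s * (fderiv ℝ (Y 0) (x₀ + s • (ω : E3)) (bv 0) + fderiv ℝ (Y 1) (x₀ + s • (ω : E3)) (bv 1) + fderiv ℝ (Y 2) (x₀ + s • (ω : E3)) (bv 2))) * hsq

/-- Finite measures supported in `[-1, 1]` are determined by their moments. -/
lemma measure_ext_of_moments (μ ν : Measure ℝ) [IsFiniteMeasure μ] [IsFiniteMeasure ν]
    (hμ : ∀ᵐ x ∂μ, x ∈ Set.Icc (-1 : ℝ) 1) (hν : ∀ᵐ x ∂ν, x ∈ Set.Icc (-1 : ℝ) 1)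
    (h : ∀ k : ℕ, ∫ x, x ^ k ∂μ = ∫ x, x ^ k ∂ν) : μ = ν := by
  have key : ∀ (m : Measure ℝ) [IsFiniteMeasure m], (∀ᵐ x ∂m, x ∈ Set.Icc (-1 : ℝ) 1) →
      ∀ g : ℝ → ℝ, Continuous g → Integrable g m := by
    intro m _ hm g hg
    obtain ⟨C, hC⟩ := (isCompact_Icc (a := (-1 : ℝ)) (b := 1)).exists_bound_of_continuousOn
      hg.continuousOn
    exact Integrable.of_bound hg.aestronglyMeasurable C (hm.mono fun x hx => hC x hx)
  have hpoly : ∀ q : Polynomial ℝ, ∫ x, q.eval x ∂μ = ∫ x, q.eval x ∂ν := by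
    intro q
    induction q using Polynomial.induction_on' with
    | add a b ha hb =>
      simp only [Polynomial.eval_add]
      rw [integral_add (key μ hμ _ a.continuous) (key μ hμ _ b.continuous),
        integral_add (key ν hν _ a.continuous) (key ν hν _ b.continuous), ha, hb]
    | monomial n c =>
      simp only [Polynomial.eval_monomial]
      rw [integral_const_mul, integral_const_mul, h]
  refine ext_of_forall_integral_eq_of_IsFiniteMeasure fun f => ?_
  refine eq_of_forall_dist_le fun ε hε => ?_
  set M := μ.real Set.univ + ν.real Set.univ + 1 with hM
  have hMp : 0 < M := by positivity
  obtain ⟨q, hq⟩ := exists_polynomial_near_of_continuousOn (-1) 1 f f.continuous.continuousOn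
    (ε / M) (by positivity)
  have est : ∀ (m : Measure ℝ) [IsFiniteMeasure m], (∀ᵐ x ∂m, x ∈ Set.Icc (-1 : ℝ) 1) →
      |∫ x, q.eval x ∂m - ∫ x, f x ∂m| ≤ ε / M * m.real Set.univ := by
    intro m _ hm
    rw [← integral_sub (key m hm _ q.continuous) (key m hm _ f.continuous)]
    exact norm_integral_le_of_norm_le_const (f := fun x => q.eval x - f x)
      (hm.mono fun x hx => (hq x hx).le)
  have e1 := est μ hμ
  have e2 := est ν hν
  rw [hpoly] at e1
  have h3 : ε / M * μ.real Set.univ + ε / M * ν.real Set.univ ≤ ε := by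
    rw [← mul_add, div_mul_eq_mul_div, div_le_iff₀ hMp]
    apply mul_le_mul_of_nonneg_left _ hε.le
    rw [hM]; linarith
  rw [Real.dist_eq]
  rw [abs_le] at *
  constructor <;> linarith [e1.1, e1.2, e2.1, e2.2]

lemma sphere_moment_rec (e : E3) (he : ‖e‖ = 1) (n : ℕ) :
    ((n : ℝ) + 2) * ∫ ω : S2, (inner ℝ e (ω : E3)) ^ (n + 1) ∂sphereMeasure =
      n * ∫ ω : S2, (inner ℝ e (ω : E3)) ^ (n - 1) ∂sphereMeasure := by
  have hY : ∀ i, ContDiff ℝ 1 (fun x : E3 => (inner ℝ e x) ^ n * e i) := by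
    intro i; exact ((contDiff_const.inner ℝ contDiff_id).pow n).mul contDiff_const
  have hd : ∀ (i : Fin 3) (x v : E3), fderiv ℝ (fun x : E3 => (inner ℝ e x) ^ n * e i) x v =
      n * (inner ℝ e x) ^ (n - 1) * inner ℝ e v * e i := by
    intro i x v
    have h1 : HasFDerivAt (fun x : E3 => inner ℝ e x) (innerSL ℝ e) x :=
      (innerSL ℝ e).hasFDerivAt
    have h2 := (h1.pow n).mul_const (e i)
    rw [h2.fderiv]
    simp
    ring
  have hes : e 0 ^ 2 + e 1 ^ 2 + e 2 ^ 2 = 1 := S2.sum_sq ⟨e, by simpa using he⟩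
  have R := integral_sphere_div hY 0 1
  have hI : ∀ k : ℕ, Integrable (fun ω : S2 => (inner ℝ e (ω : E3)) ^ k) sphereMeasure :=
    fun k => S2.continuous_integrable _ (by fun_prop)
  rw [← integral_const_mul, ← integral_const_mul, eq_comm, ← sub_eq_zero,
    ← integral_sub ((hI _).const_mul _) ((hI _).const_mul _), ← R]
  congr 1
  funext ω
  simp only [hd, zero_add, one_smul, one_mul]
  have hin : inner ℝ e (ω : E3) = e 0 * (ω : E3) 0 + e 1 * (ω : E3) 1 + e 2 * (ω : E3) 2 := by
    simp [PiLp.inner_apply, Fin.sum_univ_three]; ring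
  have hb : ∀ i, inner ℝ e (bv i) = e i := by
    intro i; simp [EuclideanSpace.inner_single_right]
  simp only [hb, Fin.sum_univ_three]
  set z := inner ℝ e (ω : E3) with hz
  have e1 : (ω : E3) 0 * (n * z ^ (n - 1) * z * e 0) + (ω : E3) 1 * (n * z ^ (n - 1) * z * e 1) +
      (ω : E3) 2 * (n * z ^ (n - 1) * z * e 2) = n * z ^ (n - 1) * z * z := by
    linear_combination -(n * z ^ (n - 1) * z) * hin
  have e2 : (ω : E3) 0 * (z ^ n * e 0) + (ω : E3) 1 * (z ^ n * e 1) +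
      (ω : E3) 2 * (z ^ n * e 2) = z ^ (n + 1) := by
    linear_combination -(z ^ n) * hin
  have e3 : (n : ℝ) * z ^ (n - 1) * z = n * z ^ n := by
    cases n with
    | zero => simp
    | succ m => simp [pow_succ]; ring
  rw [e1, e2, e3]
  linear_combination -(n * z ^ (n - 1)) * hes

/-- Archimedes' theorem: the height is uniformly distributed on the sphere. -/
lemma sphereMeasure_map_inner (e : E3) (he : ‖e‖ = 1) :
    sphereMeasure.map (fun ω : S2 => inner ℝ e (ω : E3)) =
      ENNReal.ofReal (sphereMeasure.real Set.univ / 2) •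
        (volume : Measure ℝ).restrict (Set.Icc (-1) 1) := by
  have hm : Measurable (fun ω : S2 => inner ℝ e (ω : E3)) := by fun_prop
  have : IsFiniteMeasure (ENNReal.ofReal (sphereMeasure.real Set.univ / 2) •
        (volume : Measure ℝ).restrict (Set.Icc (-1) 1)) :=
    Measure.smul_finite _ ENNReal.ofReal_ne_top
  apply measure_ext_of_moments
  · refine (ae_map_iff hm.aemeasurable (measurableSet_Icc (a := (-1 : ℝ)) (b := 1))).2 ?_
    refine Filter.Eventually.of_forall fun ω => ?_
    have := abs_real_inner_le_norm e (ω : E3)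
    rw [he, S2.norm_coe, one_mul, abs_le] at this
    exact this
  · apply Measure.ae_smul_measure
    exact ae_restrict_mem measurableSet_Icc
  · have hmap : ∀ k : ℕ, ∫ x, x ^ k ∂(sphereMeasure.map (fun ω : S2 => inner ℝ e (ω : E3))) =
        ∫ ω : S2, (inner ℝ e (ω : E3)) ^ k ∂sphereMeasure := fun k =>
      integral_map hm.aemeasurable (by fun_prop)
    have hvol : ∀ k : ℕ, ∫ x, x ^ k ∂(ENNReal.ofReal (sphereMeasure.real Set.univ / 2) •
        (volume : Measure ℝ).restrict (Set.Icc (-1) 1)) =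
        sphereMeasure.real Set.univ / 2 * ((1 - (-1) ^ (k + 1)) / (k + 1)) := by
      intro k
      rw [integral_smul_measure, integral_Icc_eq_integral_Ioc,
        ← intervalIntegral.integral_of_le (by norm_num), integral_pow,
        ENNReal.toReal_ofReal (by positivity)]
      simp
    intro k
    rw [hmap, hvol]
    induction k using Nat.strong_induction_on with
    | _ k ih =>
      rcases k with _ | k
      · simp; ring
      · have hr := sphere_moment_rec e he k
        rcases k with _ | k
        · simp at hr ⊢
          exact hr
        · simp only [Nat.add_sub_cancel] at hr
          rw [ih k (by omega)] at hr
          have hk : ((k : ℝ) + 1 + 2) ≠ 0 := by positivity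
          have hk' : ((k : ℝ) + 1) ≠ 0 := by positivity
          push_cast at hr ⊢
          have : ∫ ω : S2, (inner ℝ e (ω : E3)) ^ (k + 1 + 1) ∂sphereMeasure =
            (k + 1) * (sphereMeasure.real Set.univ / 2 * ((1 - (-1) ^ (k + 1)) / (k + 1))) /
              (k + 1 + 2) := by
            rw [eq_div_iff hk, mul_comm]; exact hr
          rw [this]
          field_simp
          ring

lemma lintegral_sphere_inner (e : E3) (he : ‖e‖ = 1) {h : ℝ → ℝ≥0∞} (hh : Measurable h) :
    ∫⁻ ω : S2, h (inner ℝ e (ω : E3)) ∂sphereMeasure =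
      ENNReal.ofReal (sphereMeasure.real Set.univ / 2) * ∫⁻ z in Set.Icc (-1) 1, h z := by
  rw [← lintegral_map hh (by fun_prop : Measurable fun ω : S2 => inner ℝ e (ω : E3)),
    sphereMeasure_map_inner e he, lintegral_smul_measure, smul_eq_mul]

/-- Time derivative of a function on spacetime. -/
def pT (F : ℝ × E3 → ℝ) (q : ℝ × E3) : ℝ := fderiv ℝ F q (1, 0)

/-- Spatial partial derivative of a function on spacetime. -/
def pX (i : Fin 3) (F : ℝ × E3 → ℝ) (q : ℝ × E3) : ℝ := fderiv ℝ F q (0, bv i)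

lemma fderiv_spacetime (F : ℝ × E3 → ℝ) (q : ℝ × E3) (a : ℝ) (v : E3) :
    fderiv ℝ F q (a, v) = a * pT F q + ∑ i, v i * pX i F q := by
  have h : ((a, v) : ℝ × E3) = a • ((1 : ℝ), (0 : E3)) + ∑ i, v i • ((0 : ℝ), bv i) := by
    simp only [Fin.sum_univ_three, Prod.smul_mk, Prod.mk_add_mk]
    conv_lhs => rw [E3.eq_sum v]
    simp [Fin.sum_univ_three]
  rw [h, map_add, map_sum]
  simp only [map_smul, smul_eq_mul, pT, pX]

section
variable {F : ℝ × E3 → ℝ}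

lemma contDiff_pT (hF : ContDiff ℝ (⊤ : ℕ∞) F) : ContDiff ℝ (⊤ : ℕ∞) (pT F) :=
  (hF.fderiv_right (m := (⊤ : ℕ∞)) (by simp)).clm_apply contDiff_const

lemma contDiff_pX (i : Fin 3) (hF : ContDiff ℝ (⊤ : ℕ∞) F) :
    ContDiff ℝ (⊤ : ℕ∞) (pX i F) :=
  (hF.fderiv_right (m := (⊤ : ℕ∞)) (by simp)).clm_apply contDiff_const

lemma fderiv_fderiv_comm (hF : ContDiff ℝ (⊤ : ℕ∞) F) (q v w : ℝ × E3) :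
    fderiv ℝ (fun q => fderiv ℝ F q v) q w = fderiv ℝ (fun q => fderiv ℝ F q w) q v := by
  have hd : DifferentiableAt ℝ (fderiv ℝ F) q :=
    ((hF.fderiv_right (m := (⊤ : ℕ∞)) (by simp)).differentiable (by simp)).differentiableAt
  have hs : IsSymmSndFDerivAt ℝ F q :=
    (hF.contDiffAt).isSymmSndFDerivAt (by simpa using WithTop.coe_le_coe.2 (le_top : (2 : ℕ∞) ≤ ⊤))
  rw [fderiv_clm_apply hd (by fun_prop), fderiv_clm_apply hd (by fun_prop)]
  simp
  exact hs.eq w v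

lemma pX_pT (hF : ContDiff ℝ (⊤ : ℕ∞) F) (i : Fin 3) (q : ℝ × E3) :
    pX i (pT F) q = pT (pX i F) q := fderiv_fderiv_comm hF q _ _

lemma pX_pX (hF : ContDiff ℝ (⊤ : ℕ∞) F) (i j : Fin 3) (q : ℝ × E3) :
    pX i (pX j F) q = pX j (pX i F) q := fderiv_fderiv_comm hF q _ _

lemma pX_eq_fderiv_slice (hF : Differentiable ℝ F) (t : ℝ) (x v : E3) :
    fderiv ℝ (fun y => F (t, y)) x v = fderiv ℝ F (t, x) (0, v) := by
  have h1 : HasFDerivAt (fun y : E3 => (t, y)) (ContinuousLinearMap.inr ℝ ℝ E3) x :=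
    hasFDerivAt_prodMk_right t x
  have h2 := hF.differentiableAt.hasFDerivAt.comp x h1
  have h3 : HasFDerivAt (fun y => F (t, y)) _ x := h2
  rw [h3.fderiv]
  simp

lemma pT_eq_deriv_slice (hF : Differentiable ℝ F) (t : ℝ) (x : E3) :
    deriv (fun s => F (s, x)) t = pT F (t, x) := by
  have h1 : HasDerivAt (fun s : ℝ => (s, x)) ((1 : ℝ), (0 : E3)) t :=
    (hasDerivAt_id t).prodMk (hasDerivAt_const t x)
  exact (hF.differentiableAt.hasFDerivAt.comp_hasDerivAt t h1).deriv

/-- Derivative along the backward light ray. -/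
lemma hasDerivAt_ray (hF : Differentiable ℝ F) (t₀ : ℝ) (x₀ ω : E3) (s : ℝ) :
    HasDerivAt (fun s => F (t₀ - s, x₀ + s • ω))
      (-pT F (t₀ - s, x₀ + s • ω) + ∑ i, ω i * pX i F (t₀ - s, x₀ + s • ω)) s := by
  have h1 : HasDerivAt (fun s : ℝ => (t₀ - s, x₀ + s • ω)) ((-1 : ℝ), ω) s := by
    refine HasDerivAt.prodMk ?_ ?_
    · simpa using (hasDerivAt_id s).const_sub t₀
    · simpa using ((hasDerivAt_id s).smul_const ω).const_add x₀
  have := hF.differentiableAt.hasFDerivAt.comp_hasDerivAt s h1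
  rw [fderiv_spacetime] at this
  have h2 : HasDerivAt (fun s => F (t₀ - s, x₀ + s • ω)) _ s := this
  simpa using h2

end

/-- The integrand of Kirchhoff's formula. -/
def kirchhoffInt (Φ : ℝ × E3 → ℝ) (t₀ : ℝ) (x₀ : E3) (s : ℝ) (ω : E3) : ℝ :=
  s * pT Φ (t₀ - s, x₀ + s • ω) + Φ (t₀ - s, x₀ + s • ω)
    + s * ∑ i, ω i * pX i Φ (t₀ - s, x₀ + s • ω)

lemma hasDerivAt_kirchhoff {Φ : ℝ × E3 → ℝ} (hΦ : ContDiff ℝ (⊤ : ℕ∞) Φ) (t₀ : ℝ) (x₀ : E3)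
    (s : ℝ) :
    HasDerivAt (fun s => ∫ ω : S2, kirchhoffInt Φ t₀ x₀ s ω ∂sphereMeasure)
      (∫ ω : S2, s * (∑ i, pX i (pX i Φ) (t₀ - s, x₀ + s • (ω : E3))
        - pT (pT Φ) (t₀ - s, x₀ + s • (ω : E3))) ∂sphereMeasure) s := by
  have hT := contDiff_pT hΦ
  have hX := fun i => contDiff_pX i hΦ
  have cΦ := hΦ.continuous
  have cT := hT.continuous
  have cX := fun i => (hX i).continuous
  have cTT := (contDiff_pT hT).continuous
  have cTX := fun i => (contDiff_pT (hX i)).continuous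
  have cXX := fun i j => (contDiff_pX i (hX j)).continuous
  have dΦ : Differentiable ℝ Φ := hΦ.differentiable (by simp)
  have dT : Differentiable ℝ (pT Φ) := hT.differentiable (by simp)
  have dX : ∀ i, Differentiable ℝ (pX i Φ) := fun i => (hX i).differentiable (by simp)
  let F' : ℝ → S2 → ℝ := fun s ω => -(s * pT (pT Φ) (t₀ - s, x₀ + s • (ω : E3)))
    + 2 * ∑ i, (ω : E3) i * pX i Φ (t₀ - s, x₀ + s • (ω : E3))
    + s * ∑ i, (ω : E3) i * ∑ j, (ω : E3) j * pX j (pX i Φ) (t₀ - s, x₀ + s • (ω : E3))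
  have hd : ∀ (s : ℝ) (ω : S2), HasDerivAt (fun s => kirchhoffInt Φ t₀ x₀ s ω) (F' s ω) s := by
    intro s ω
    have h1 := (hasDerivAt_id s).mul (hasDerivAt_ray dT t₀ x₀ ω s)
    have h2 := hasDerivAt_ray dΦ t₀ x₀ ω s
    have h3 := (hasDerivAt_id s).mul (HasDerivAt.fun_sum (u := Finset.univ) fun i _ =>
      (hasDerivAt_ray (dX i) t₀ x₀ ω s).const_mul ((ω : E3) i))
    have h4 := (h1.add h2).add h3
    have h5 : HasDerivAt (fun s => kirchhoffInt Φ t₀ x₀ s ω) _ s := h4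
    refine h5.congr_deriv ?_
    simp only [F', Fin.sum_univ_three, pX_pT hΦ, id]
    ring
  have key := hasDerivAt_integral_compact sphereMeasure (F := fun s (ω : S2) =>
    kirchhoffInt Φ t₀ x₀ s ω) (F' := F')
    (fun s => by unfold kirchhoffInt; fun_prop) (by fun_prop) hd s
  have R := integral_sphere_div (Y := fun i x => pX i Φ (t₀ - s, x))
    (fun i => ((hX i).of_le (by simp)).comp (by fun_prop)) x₀ s
  have I1 : Integrable (F' s) sphereMeasure := S2.continuous_integrable _ (by fun_prop)
  convert key using 1
  rw [← add_zero (∫ ω, F' s ω ∂sphereMeasure), ← R, ← integral_add I1]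
  · congr 1
    funext ω
    simp only [pX_eq_fderiv_slice (dX _), fderiv_spacetime, F', Fin.sum_univ_three]
    simp
    ring
  · apply S2.continuous_integrable
    simp only [pX_eq_fderiv_slice (dX _), fderiv_spacetime]
    fun_prop

/-- Integrated form of Kirchhoff's formula. -/
lemma kirchhoff_formula {Φ N : ℝ × E3 → ℝ} (hΦ : ContDiff ℝ (⊤ : ℕ∞) Φ) (hN : Continuous N)
    (hpde : ∀ q : ℝ × E3, 0 ≤ q.1 → pT (pT Φ) q - ∑ i, pX i (pX i Φ) q + N q = 0)
    {t₀ : ℝ} (ht₀ : 0 ≤ t₀) (x₀ : E3) :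
    sphereMeasure.real Set.univ * Φ (t₀, x₀) =
      ∫ ω : S2, kirchhoffInt Φ t₀ x₀ t₀ ω ∂sphereMeasure -
      ∫ s in (0 : ℝ)..t₀, s * ∫ ω : S2, N (t₀ - s, x₀ + s • (ω : E3)) ∂sphereMeasure := by
  have hc : Continuous (fun s : ℝ => s * ∫ ω : S2, N (t₀ - s, x₀ + s • (ω : E3))
      ∂sphereMeasure) := by
    refine continuous_id.mul (continuous_integral_compact _ ?_)
    fun_prop
  have h := intervalIntegral.integral_eq_sub_of_hasDerivAt (a := 0) (b := t₀)
    (f := fun s => ∫ ω : S2, kirchhoffInt Φ t₀ x₀ s ω ∂sphereMeasure)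
    (f' := fun s => s * ∫ ω : S2, N (t₀ - s, x₀ + s • (ω : E3)) ∂sphereMeasure)
    (fun s hs => by
      rw [Set.uIcc_of_le ht₀] at hs
      refine (hasDerivAt_kirchhoff hΦ t₀ x₀ s).congr_deriv ?_
      rw [← integral_const_mul]
      congr 1
      funext ω
      have := hpde (t₀ - s, x₀ + s • (ω : E3)) (by simpa using hs.2)
      linear_combination -s * this)
    (hc.intervalIntegrable _ _)
  rw [h]
  simp [kirchhoffInt]

/-- Leibniz rule for an integral with variable upper limit. -/
lemma hasDerivAt_integral_triangle {H H' : ℝ → ℝ → ℝ}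
    (hH : Continuous (fun q : ℝ × ℝ => H q.1 q.2)) (hH' : Continuous (fun q : ℝ × ℝ => H' q.1 q.2))
    (hd : ∀ b s, HasDerivAt (fun b => H b s) (H' b s) b) (t : ℝ) :
    HasDerivAt (fun t => ∫ s in (0 : ℝ)..t, H t s) (H t t + ∫ s in (0 : ℝ)..t, H' t s) t := by
  have cs : ∀ b, Continuous (H b) := fun b => hH.comp (by fun_prop : Continuous fun s : ℝ => (b, s))
  have cs' : ∀ b, Continuous (H' b) :=
    fun b => hH'.comp (by fun_prop : Continuous fun s : ℝ => (b, s))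
  have d2 : ∀ a b, HasDerivAt (fun b => ∫ s in (0 : ℝ)..a, H b s) (∫ s in (0 : ℝ)..a, H' b s) b := by
    intro a b
    obtain ⟨C, hC⟩ := ((isCompact_Icc (a := b - 1) (b := b + 1)).prod
      (isCompact_uIcc (a := (0 : ℝ)) (b := a))).exists_bound_of_continuousOn hH'.continuousOn
    refine (intervalIntegral.hasDerivAt_integral_of_dominated_loc_of_deriv_le
      (s := Set.Icc (b - 1) (b + 1)) (bound := fun _ => C)
      (Icc_mem_nhds (by linarith) (by linarith)) ?_ ?_ ?_ ?_ ?_ ?_).2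
    · exact Filter.Eventually.of_forall fun s => (cs s).aestronglyMeasurable
    · exact (cs b).intervalIntegrable _ _
    · exact (cs' b).aestronglyMeasurable
    · exact Filter.Eventually.of_forall fun s hs b' hb' =>
        hC (b', s) ⟨hb', Set.uIoc_subset_uIcc hs⟩
    · exact _root_.intervalIntegrable_const
    · exact Filter.Eventually.of_forall fun s _ b' _ => hd b' s
  have d1 : ∀ a b, HasDerivAt (fun a => ∫ s in (0 : ℝ)..a, H b s) (H b a) a := fun a b =>
    intervalIntegral.integral_hasDerivAt_right ((cs b).intervalIntegrable _ _)
      ((cs b).stronglyMeasurableAtFilter _ _) (cs b).continuousAt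
  have c2 : Continuous (fun q : ℝ × ℝ => ∫ s in (0 : ℝ)..q.1, H' q.2 s) := by
    apply intervalIntegral.continuous_parametric_intervalIntegral_of_continuous (X := ℝ × ℝ)
      (f := fun q s => H' q.2 s)
    · exact hH'.comp (by fun_prop : Continuous fun z : (ℝ × ℝ) × ℝ => (z.1.2, z.2))
    · exact continuous_fst
  have key := hasStrictFDerivAt_uncurry_coprod (𝕜 := ℝ) (u := (t, t))
    (f := fun a b => ∫ s in (0 : ℝ)..a, H b s)
    (f₁ := fun a b => ContinuousLinearMap.toSpanSingleton ℝ (H b a))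
    (f₂ := fun a b => ContinuousLinearMap.toSpanSingleton ℝ (∫ s in (0 : ℝ)..a, H' b s))
    (Filter.Eventually.of_forall fun v => (d1 v.1 v.2).hasFDerivAt)
    (Filter.Eventually.of_forall fun v => (d2 v.1 v.2).hasFDerivAt)
    (((ContinuousLinearMap.toSpanSingletonCLE (𝕜 := ℝ) (E := ℝ)).continuous.comp
      (hH.comp continuous_swap)).continuousAt)
    (((ContinuousLinearMap.toSpanSingletonCLE (𝕜 := ℝ) (E := ℝ)).continuous.comp c2).continuousAt)
  have h2 := HasFDerivAt.comp_hasDerivAt (f := fun t : ℝ => (t, t)) t key.hasFDerivAt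
    ((hasDerivAt_id' t).prodMk (hasDerivAt_id' t))
  have h3 : HasDerivAt (fun t => ∫ s in (0 : ℝ)..t, H t s) _ t := h2
  refine h3.congr_deriv ?_
  simp [Function.HasUncurry.uncurry]

/-- Divergence of a spacetime current. -/
def divJ (J0 : ℝ × E3 → ℝ) (J : Fin 3 → ℝ × E3 → ℝ) (q : ℝ × E3) : ℝ :=
  pT J0 q + ∑ i, pX i (J i) q

/-- Density of the flux of a current through the backward light cone from `(t, x₀)`. -/
def coneFlux (J0 : ℝ × E3 → ℝ) (J : Fin 3 → ℝ × E3 → ℝ) (x₀ : E3) (t s : ℝ) : ℝ :=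
  ∫ ω : S2, s ^ 2 * (J0 (t - s, x₀ + s • (ω : E3))
    + ∑ i, (ω : E3) i * J i (t - s, x₀ + s • (ω : E3))) ∂sphereMeasure

lemma continuous_pT {F : ℝ × E3 → ℝ} (hF : ContDiff ℝ 1 F) : Continuous (pT F) := by
  have := hF.continuous_fderiv (by norm_num)
  unfold pT; fun_prop

lemma continuous_pX (i : Fin 3) {F : ℝ × E3 → ℝ} (hF : ContDiff ℝ 1 F) :
    Continuous (pX i F) := by
  have := hF.continuous_fderiv (by norm_num)
  unfold pX; fun_prop

/-- The divergence theorem on the interior of a backward light cone, in differential form. -/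
lemma hasDerivAt_coneFlux {J0 : ℝ × E3 → ℝ} {J : Fin 3 → ℝ × E3 → ℝ} (h0 : ContDiff ℝ 1 J0)
    (hJ : ∀ i, ContDiff ℝ 1 (J i)) (x₀ : E3) (t : ℝ) :
    HasDerivAt (fun t => ∫ s in (0 : ℝ)..t, coneFlux J0 J x₀ t s)
      (t ^ 2 * ∫ ω : S2, J0 (0, x₀ + t • (ω : E3)) ∂sphereMeasure +
        ∫ s in (0 : ℝ)..t, s ^ 2 * ∫ ω : S2, divJ J0 J (t - s, x₀ + s • (ω : E3))
          ∂sphereMeasure) t := by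
  have c0 := h0.continuous
  have cJ := fun i => (hJ i).continuous
  have cT0 := continuous_pT h0
  have cTJ := fun i => continuous_pT (hJ i)
  have cXJ := fun i j => continuous_pX i (hJ j)
  have d0 : Differentiable ℝ J0 := h0.differentiable (by norm_num)
  have dJ := fun i => (hJ i).differentiable (by norm_num)
  -- time derivative of the flux density
  let K : ℝ → ℝ → ℝ := fun t s => ∫ ω : S2, s ^ 2 * (pT J0 (t - s, x₀ + s • (ω : E3))
    + ∑ i, (ω : E3) i * pT (J i) (t - s, x₀ + s • (ω : E3))) ∂sphereMeasure
  have ht : ∀ {F : ℝ × E3 → ℝ}, Differentiable ℝ F → ∀ (t s : ℝ) (x : E3),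
      HasDerivAt (fun t => F (t - s, x)) (pT F (t - s, x)) t := by
    intro F hF t s x
    have h1 : HasDerivAt (fun t : ℝ => (t - s, x)) ((1 : ℝ), (0 : E3)) t :=
      ((hasDerivAt_id t).sub_const s).prodMk (hasDerivAt_const t x)
    exact hF.differentiableAt.hasFDerivAt.comp_hasDerivAt t h1
  have hK : ∀ b s, HasDerivAt (fun b => coneFlux J0 J x₀ b s) (K b s) b := by
    intro b s
    refine hasDerivAt_integral_compact sphereMeasure (F := fun t (ω : S2) =>
      s ^ 2 * (J0 (t - s, x₀ + s • (ω : E3))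
      + ∑ i, (ω : E3) i * J i (t - s, x₀ + s • (ω : E3))))
      (F' := fun t (ω : S2) => s ^ 2 * (pT J0 (t - s, x₀ + s • (ω : E3))
      + ∑ i, (ω : E3) i * pT (J i) (t - s, x₀ + s • (ω : E3)))) (fun t => by fun_prop)
      (by fun_prop) (fun t ω => ?_) b
    exact (((ht d0 t s _)).add (HasDerivAt.fun_sum (u := Finset.univ) fun i _ =>
      (ht (dJ i) t s _).const_mul ((ω : E3) i))).const_mul (s ^ 2)
  have cF : Continuous (fun q : ℝ × ℝ => coneFlux J0 J x₀ q.1 q.2) := by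
    apply continuous_integral_compact sphereMeasure (Y := ℝ × ℝ) (X := S2)
    fun_prop
  have cK : Continuous (fun q : ℝ × ℝ => K q.1 q.2) := by
    apply continuous_integral_compact sphereMeasure (Y := ℝ × ℝ) (X := S2)
    fun_prop
  refine (hasDerivAt_integral_triangle cF cK hK t).congr_deriv ?_
  -- radial derivative of the normal component
  let M : ℝ → ℝ := fun s => ∫ ω : S2, s ^ 2 * ∑ i, (ω : E3) i * J i (t - s, x₀ + s • (ω : E3))
    ∂sphereMeasure
  let D : ℝ → ℝ := fun s => s ^ 2 * ∫ ω : S2, divJ J0 J (t - s, x₀ + s • (ω : E3))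
          ∂sphereMeasure
  have cD : Continuous D := by
    refine (continuous_pow 2).mul (continuous_integral_compact _ ?_)
    unfold divJ; fun_prop
  have cKt : Continuous (K t) := cK.comp (by fun_prop : Continuous fun s : ℝ => (t, s))
  have hM : ∀ s, HasDerivAt M (D s - K t s) s := by
    intro s
    let F' : ℝ → S2 → ℝ := fun s ω => 2 * s * ∑ i, (ω : E3) i * J i (t - s, x₀ + s • (ω : E3))
      + s ^ 2 * ∑ i, (ω : E3) i * (-pT (J i) (t - s, x₀ + s • (ω : E3))
        + ∑ j, (ω : E3) j * pX j (J i) (t - s, x₀ + s • (ω : E3)))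
    have key := hasDerivAt_integral_compact sphereMeasure (F := fun s (ω : S2) =>
      s ^ 2 * ∑ i, (ω : E3) i * J i (t - s, x₀ + s • (ω : E3))) (F' := F')
      (fun s => by fun_prop) (by fun_prop) (fun s ω => by
        have h1 := (hasDerivAt_pow 2 s).mul (HasDerivAt.fun_sum (u := Finset.univ) fun i _ =>
          (hasDerivAt_ray (dJ i) t x₀ ω s).const_mul ((ω : E3) i))
        refine HasDerivAt.congr_deriv h1 ?_
        simp [F']) s
    refine key.congr_deriv ?_
    have R := integral_sphere_div (Y := fun i x => J i (t - s, x))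
      (fun i => (hJ i).comp (by fun_prop)) x₀ s
    have I1 : Integrable (F' s) sphereMeasure := S2.continuous_integrable _ (by fun_prop)
    have I2 : Integrable (fun ω : S2 => s ^ 2 * (pT J0 (t - s, x₀ + s • (ω : E3))
      + ∑ i, (ω : E3) i * pT (J i) (t - s, x₀ + s • (ω : E3)))) sphereMeasure :=
      S2.continuous_integrable _ (by fun_prop)
    have I3 : Integrable (fun ω : S2 => s ^ 2 * divJ J0 J (t - s, x₀ + s • (ω : E3)))
      sphereMeasure := S2.continuous_integrable _ (by unfold divJ; fun_prop)
    have I4 : Integrable (fun ω : S2 => s ^ 2 * divJ J0 J (t - s, x₀ + s • (ω : E3)) -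
      s ^ 2 * (pT J0 (t - s, x₀ + s • (ω : E3))
      + ∑ i, (ω : E3) i * pT (J i) (t - s, x₀ + s • (ω : E3)))) sphereMeasure := I3.sub I2
    simp only [D, K]
    rw [← integral_const_mul, ← integral_sub I3 I2, ← sub_eq_zero, ← integral_sub I1 I4,
      ← neg_eq_zero, ← integral_neg]
    have R' := congrArg (fun y => s * y) R
    simp only [mul_zero] at R'
    rw [← R', ← integral_const_mul]
    congr 1
    funext ω
    simp only [pX_eq_fderiv_slice (dJ _), fderiv_spacetime, F', Fin.sum_univ_three, divJ]
    simp
    ring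
  have hFTC := intervalIntegral.integral_eq_sub_of_hasDerivAt (a := 0) (b := t)
    (fun s _ => hM s) ((cD.sub cKt).intervalIntegrable _ _)
  rw [intervalIntegral.integral_sub (cD.intervalIntegrable _ _) (cKt.intervalIntegrable _ _)] at hFTC
  have hM0 : M 0 = 0 := by simp [M]
  have hMt : coneFlux J0 J x₀ t t = t ^ 2 * ∫ ω : S2, J0 (0, x₀ + t • (ω : E3)) ∂sphereMeasure
      + M t := by
    simp only [coneFlux, M]
    rw [← integral_const_mul, ← integral_add]
    · congr 1; funext ω; simp; ring
    · exact S2.continuous_integrable _ (by fun_prop)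
    · exact S2.continuous_integrable _ (by fun_prop)
  rw [hMt]
  simp only [D] at hFTC
  linarith

/-- Energy density of the weighted current, as a function of the pointwise jet of the solution:
`a = ∂_tφ`, `b = ∇φ`, `κ = 1/r`, `w = x/r`, weights `F`, `G`, potential `V`. -/
def curE (a y κ : ℝ) (b w : Fin 3 → ℝ) (F G V : ℝ) : ℝ :=
  F * (a + (w 0 * b 0 + w 1 * b 1 + w 2 * b 2) + κ * y) ^ 2 / 2
  + G * (a - (w 0 * b 0 + w 1 * b 1 + w 2 * b 2) - κ * y) ^ 2 / 2
  + (F + G) * ((b 0 ^ 2 + b 1 ^ 2 + b 2 ^ 2) - (w 0 * b 0 + w 1 * b 1 + w 2 * b 2) ^ 2) / 2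
  + (F + G) * V

/-- Radial flux of the weighted current. -/
def curR (a y κ : ℝ) (b w : Fin 3 → ℝ) (F G V : ℝ) : ℝ :=
  G * (a - (w 0 * b 0 + w 1 * b 1 + w 2 * b 2) - κ * y) ^ 2 / 2
  - F * (a + (w 0 * b 0 + w 1 * b 1 + w 2 * b 2) + κ * y) ^ 2 / 2
  + (F - G) * ((b 0 ^ 2 + b 1 ^ 2 + b 2 ^ 2) - (w 0 * b 0 + w 1 * b 1 + w 2 * b 2) ^ 2) / 2
  + (F - G) * V

/-- The coefficient of the angular flux of the weighted current. -/
def curA (a y κ : ℝ) (b w : Fin 3 → ℝ) (F G : ℝ) : ℝ :=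
  F * (a + (w 0 * b 0 + w 1 * b 1 + w 2 * b 2) + κ * y)
  + G * (a - (w 0 * b 0 + w 1 * b 1 + w 2 * b 2) - κ * y)

/-- Spatial components of the weighted current. -/
def curX (i : Fin 3) (a y κ : ℝ) (b w : Fin 3 → ℝ) (F G V : ℝ) : ℝ :=
  w i * curR a y κ b w F G V
  - (b i - w i * (w 0 * b 0 + w 1 * b 1 + w 2 * b 2)) * curA a y κ b w F G

section
variable {a y κ : ℝ → ℝ} {b w : ℝ → Fin 3 → ℝ} {F G V : ℝ → ℝ} {da dy dκ : ℝ}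
  {db dw : Fin 3 → ℝ} {dF dG dV : ℝ} {τ : ℝ}

/-- The derivative of `w · b`. -/
def dRad (b w db dw : Fin 3 → ℝ) : ℝ :=
  dw 0 * b 0 + w 0 * db 0 + (dw 1 * b 1 + w 1 * db 1) + (dw 2 * b 2 + w 2 * db 2)

lemma hasDerivAt_rad (hb : ∀ i, HasDerivAt (fun τ => b τ i) (db i) τ)
    (hw : ∀ i, HasDerivAt (fun τ => w τ i) (dw i) τ) :
    HasDerivAt (fun τ => w τ 0 * b τ 0 + w τ 1 * b τ 1 + w τ 2 * b τ 2)
      (dRad (b τ) (w τ) db dw) τ :=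
  (((hw 0).mul (hb 0)).add ((hw 1).mul (hb 1))).add ((hw 2).mul (hb 2))

lemma hasDerivAt_curE (ha : HasDerivAt a da τ) (hy : HasDerivAt y dy τ) (hκ : HasDerivAt κ dκ τ)
    (hb : ∀ i, HasDerivAt (fun τ => b τ i) (db i) τ)
    (hw : ∀ i, HasDerivAt (fun τ => w τ i) (dw i) τ) (hF : HasDerivAt F dF τ)
    (hG : HasDerivAt G dG τ) (hV : HasDerivAt V dV τ) :
    HasDerivAt (fun τ => curE (a τ) (y τ) (κ τ) (b τ) (w τ) (F τ) (G τ) (V τ))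
      (dF * (a τ + (w τ 0 * b τ 0 + w τ 1 * b τ 1 + w τ 2 * b τ 2) + κ τ * y τ) ^ 2 / 2
        + F τ * (a τ + (w τ 0 * b τ 0 + w τ 1 * b τ 1 + w τ 2 * b τ 2) + κ τ * y τ)
          * (da + dRad (b τ) (w τ) db dw + (dκ * y τ + κ τ * dy))
        + dG * (a τ - (w τ 0 * b τ 0 + w τ 1 * b τ 1 + w τ 2 * b τ 2) - κ τ * y τ) ^ 2 / 2
        + G τ * (a τ - (w τ 0 * b τ 0 + w τ 1 * b τ 1 + w τ 2 * b τ 2) - κ τ * y τ)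
          * (da - dRad (b τ) (w τ) db dw - (dκ * y τ + κ τ * dy))
        + (dF + dG) * ((b τ 0 ^ 2 + b τ 1 ^ 2 + b τ 2 ^ 2)
          - (w τ 0 * b τ 0 + w τ 1 * b τ 1 + w τ 2 * b τ 2) ^ 2) / 2
        + (F τ + G τ) * ((b τ 0 * db 0 + b τ 1 * db 1 + b τ 2 * db 2)
          - (w τ 0 * b τ 0 + w τ 1 * b τ 1 + w τ 2 * b τ 2) * dRad (b τ) (w τ) db dw)
        + (dF + dG) * V τ + (F τ + G τ) * dV) τ := by
  have hr := hasDerivAt_rad hb hw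
  have h1 := (hF.mul (((ha.add hr).add (hκ.mul hy)).pow 2)).div_const 2
  have h2 := (hG.mul (((ha.sub hr).sub (hκ.mul hy)).pow 2)).div_const 2
  have h3 := ((hF.add hG).mul (((((hb 0).pow 2).add ((hb 1).pow 2)).add ((hb 2).pow 2)).sub
    (hr.pow 2))).div_const 2
  have h4 := (hF.add hG).mul hV
  have h5 : HasDerivAt (fun τ => curE (a τ) (y τ) (κ τ) (b τ) (w τ) (F τ) (G τ) (V τ)) _ τ :=
    ((h1.add h2).add h3).add h4
  refine h5.congr_deriv ?_
  simp
  ring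

lemma hasDerivAt_curR (ha : HasDerivAt a da τ) (hy : HasDerivAt y dy τ) (hκ : HasDerivAt κ dκ τ)
    (hb : ∀ i, HasDerivAt (fun τ => b τ i) (db i) τ)
    (hw : ∀ i, HasDerivAt (fun τ => w τ i) (dw i) τ) (hF : HasDerivAt F dF τ)
    (hG : HasDerivAt G dG τ) (hV : HasDerivAt V dV τ) :
    HasDerivAt (fun τ => curR (a τ) (y τ) (κ τ) (b τ) (w τ) (F τ) (G τ) (V τ))
      (dG * (a τ - (w τ 0 * b τ 0 + w τ 1 * b τ 1 + w τ 2 * b τ 2) - κ τ * y τ) ^ 2 / 2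
        + G τ * (a τ - (w τ 0 * b τ 0 + w τ 1 * b τ 1 + w τ 2 * b τ 2) - κ τ * y τ)
          * (da - dRad (b τ) (w τ) db dw - (dκ * y τ + κ τ * dy))
        - (dF * (a τ + (w τ 0 * b τ 0 + w τ 1 * b τ 1 + w τ 2 * b τ 2) + κ τ * y τ) ^ 2 / 2
        + F τ * (a τ + (w τ 0 * b τ 0 + w τ 1 * b τ 1 + w τ 2 * b τ 2) + κ τ * y τ)
          * (da + dRad (b τ) (w τ) db dw + (dκ * y τ + κ τ * dy)))
        + (dF - dG) * ((b τ 0 ^ 2 + b τ 1 ^ 2 + b τ 2 ^ 2)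
          - (w τ 0 * b τ 0 + w τ 1 * b τ 1 + w τ 2 * b τ 2) ^ 2) / 2
        + (F τ - G τ) * ((b τ 0 * db 0 + b τ 1 * db 1 + b τ 2 * db 2)
          - (w τ 0 * b τ 0 + w τ 1 * b τ 1 + w τ 2 * b τ 2) * dRad (b τ) (w τ) db dw)
        + (dF - dG) * V τ + (F τ - G τ) * dV) τ := by
  have hr := hasDerivAt_rad hb hw
  have h1 := (hF.mul (((ha.add hr).add (hκ.mul hy)).pow 2)).div_const 2
  have h2 := (hG.mul (((ha.sub hr).sub (hκ.mul hy)).pow 2)).div_const 2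
  have h3 := ((hF.sub hG).mul (((((hb 0).pow 2).add ((hb 1).pow 2)).add ((hb 2).pow 2)).sub
    (hr.pow 2))).div_const 2
  have h4 := (hF.sub hG).mul hV
  have h5 : HasDerivAt (fun τ => curR (a τ) (y τ) (κ τ) (b τ) (w τ) (F τ) (G τ) (V τ)) _ τ :=
    ((h2.sub h1).add h3).add h4
  refine h5.congr_deriv ?_
  simp
  ring

lemma hasDerivAt_curA (ha : HasDerivAt a da τ) (hy : HasDerivAt y dy τ) (hκ : HasDerivAt κ dκ τ)
    (hb : ∀ i, HasDerivAt (fun τ => b τ i) (db i) τ)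
    (hw : ∀ i, HasDerivAt (fun τ => w τ i) (dw i) τ) (hF : HasDerivAt F dF τ)
    (hG : HasDerivAt G dG τ) :
    HasDerivAt (fun τ => curA (a τ) (y τ) (κ τ) (b τ) (w τ) (F τ) (G τ))
      (dF * (a τ + (w τ 0 * b τ 0 + w τ 1 * b τ 1 + w τ 2 * b τ 2) + κ τ * y τ)
        + F τ * (da + dRad (b τ) (w τ) db dw + (dκ * y τ + κ τ * dy))
        + (dG * (a τ - (w τ 0 * b τ 0 + w τ 1 * b τ 1 + w τ 2 * b τ 2) - κ τ * y τ)
        + G τ * (da - dRad (b τ) (w τ) db dw - (dκ * y τ + κ τ * dy)))) τ := by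
  have hr := hasDerivAt_rad hb hw
  exact (hF.mul ((ha.add hr).add (hκ.mul hy))).add (hG.mul ((ha.sub hr).sub (hκ.mul hy)))

end

/-- The line through `q` with direction `d`: derivative of a differentiable function. -/
lemma hasDerivAt_line {A : ℝ × E3 → ℝ} {q : ℝ × E3} (hA : DifferentiableAt ℝ A q) (d : ℝ × E3) :
    HasDerivAt (fun τ : ℝ => A (q + τ • d)) (fderiv ℝ A q d) 0 := by
  have h1 : HasDerivAt (fun τ : ℝ => q + τ • d) d 0 := by
    simpa using ((hasDerivAt_id (0 : ℝ)).smul_const d).const_add q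
  have hA' : HasFDerivAt A (fderiv ℝ A q) (q + (0 : ℝ) • d) := by simpa using hA.hasFDerivAt
  exact hA'.comp_hasDerivAt 0 h1

lemma fderiv_eq_of_line {A : ℝ × E3 → ℝ} {q d : ℝ × E3} (hA : DifferentiableAt ℝ A q) {A' : ℝ}
    (h : HasDerivAt (fun τ : ℝ => A (q + τ • d)) A' 0) : fderiv ℝ A q d = A' :=
  (hasDerivAt_line hA d).unique h

/-- Energy density of the weighted current of `Φ`, with outgoing weight `f` and incoming
weight `g`. -/
def JE (Φ : ℝ × E3 → ℝ) (f g V : ℝ → ℝ) (q : ℝ × E3) : ℝ :=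
  curE (pT Φ q) (Φ q) (‖q.2‖⁻¹) (fun i => pX i Φ q) (fun i => q.2 i * ‖q.2‖⁻¹)
    (f (q.1 + ‖q.2‖)) (g (q.1 - ‖q.2‖)) (V (Φ q))

/-- Spatial part of the weighted current of `Φ`. -/
def JX (Φ : ℝ × E3 → ℝ) (f g V : ℝ → ℝ) (i : Fin 3) (q : ℝ × E3) : ℝ :=
  curX i (pT Φ q) (Φ q) (‖q.2‖⁻¹) (fun i => pX i Φ q) (fun i => q.2 i * ‖q.2‖⁻¹)
    (f (q.1 + ‖q.2‖)) (g (q.1 - ‖q.2‖)) (V (Φ q))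

lemma E3.norm_sq (x : E3) : ‖x‖ ^ 2 = x 0 ^ 2 + x 1 ^ 2 + x 2 ^ 2 := by
  rw [EuclideanSpace.norm_sq_eq]; simp [Fin.sum_univ_three]

lemma hasDerivAt_norm_line {x : E3} (hx : x ≠ 0) (e : E3) :
    HasDerivAt (fun τ : ℝ => ‖x + τ • e‖)
      (x 0 * ‖x‖⁻¹ * e 0 + x 1 * ‖x‖⁻¹ * e 1 + x 2 * ‖x‖⁻¹ * e 2) 0 := by
  have h1 : HasDerivAt (fun τ : ℝ => x + τ • e) e 0 := by
    simpa using ((hasDerivAt_id (0 : ℝ)).smul_const e).const_add x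
  have h2 := h1.norm_sq
  have hx' : ‖x‖ ≠ 0 := norm_ne_zero_iff.mpr hx
  have h3 := h2.sqrt (by simp [hx])
  have h5 : (fun τ : ℝ => ‖x + τ • e‖) = fun τ : ℝ => √(‖x + τ • e‖ ^ 2) := by
    funext τ; rw [Real.sqrt_sq (norm_nonneg _)]
  rw [h5]
  refine h3.congr_deriv ?_
  simp [PiLp.inner_apply, Fin.sum_univ_three, Real.sqrt_sq]
  field_simp

/-- Linearization of `curE`. -/
def dCurE (a y κ : ℝ) (b w : Fin 3 → ℝ) (F G V da dy dκ : ℝ) (db dw : Fin 3 → ℝ)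
    (dF dG dV : ℝ) : ℝ :=
  dF * (a + (w 0 * b 0 + w 1 * b 1 + w 2 * b 2) + κ * y) ^ 2 / 2
  + F * (a + (w 0 * b 0 + w 1 * b 1 + w 2 * b 2) + κ * y)
    * (da + dRad b w db dw + (dκ * y + κ * dy))
  + dG * (a - (w 0 * b 0 + w 1 * b 1 + w 2 * b 2) - κ * y) ^ 2 / 2
  + G * (a - (w 0 * b 0 + w 1 * b 1 + w 2 * b 2) - κ * y)
    * (da - dRad b w db dw - (dκ * y + κ * dy))
  + (dF + dG) * ((b 0 ^ 2 + b 1 ^ 2 + b 2 ^ 2) - (w 0 * b 0 + w 1 * b 1 + w 2 * b 2) ^ 2) / 2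
  + (F + G) * ((b 0 * db 0 + b 1 * db 1 + b 2 * db 2)
    - (w 0 * b 0 + w 1 * b 1 + w 2 * b 2) * dRad b w db dw)
  + (dF + dG) * V + (F + G) * dV

/-- Linearization of `curX i`. -/
def dCurX (i : Fin 3) (a y κ : ℝ) (b w : Fin 3 → ℝ) (F G V da dy dκ : ℝ) (db dw : Fin 3 → ℝ)
    (dF dG dV : ℝ) : ℝ :=
  dw i * curR a y κ b w F G V
  + w i * (dG * (a - (w 0 * b 0 + w 1 * b 1 + w 2 * b 2) - κ * y) ^ 2 / 2
    + G * (a - (w 0 * b 0 + w 1 * b 1 + w 2 * b 2) - κ * y)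
      * (da - dRad b w db dw - (dκ * y + κ * dy))
    - (dF * (a + (w 0 * b 0 + w 1 * b 1 + w 2 * b 2) + κ * y) ^ 2 / 2
      + F * (a + (w 0 * b 0 + w 1 * b 1 + w 2 * b 2) + κ * y)
        * (da + dRad b w db dw + (dκ * y + κ * dy)))
    + (dF - dG) * ((b 0 ^ 2 + b 1 ^ 2 + b 2 ^ 2) - (w 0 * b 0 + w 1 * b 1 + w 2 * b 2) ^ 2) / 2
    + (F - G) * ((b 0 * db 0 + b 1 * db 1 + b 2 * db 2)
      - (w 0 * b 0 + w 1 * b 1 + w 2 * b 2) * dRad b w db dw)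
    + (dF - dG) * V + (F - G) * dV)
  - ((db i - (dw i * (w 0 * b 0 + w 1 * b 1 + w 2 * b 2) + w i * dRad b w db dw))
      * curA a y κ b w F G
    + (b i - w i * (w 0 * b 0 + w 1 * b 1 + w 2 * b 2))
      * (dF * (a + (w 0 * b 0 + w 1 * b 1 + w 2 * b 2) + κ * y)
        + F * (da + dRad b w db dw + (dκ * y + κ * dy))
        + (dG * (a - (w 0 * b 0 + w 1 * b 1 + w 2 * b 2) - κ * y)
        + G * (da - dRad b w db dw - (dκ * y + κ * dy)))))

section
variable {a y κ : ℝ → ℝ} {b w : Fin 3 → ℝ → ℝ} {F G V : ℝ → ℝ} {da dy dκ : ℝ}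
  {db dw : Fin 3 → ℝ} {dF dG dV : ℝ} {τ : ℝ}

lemma hasDerivAt_curE' (ha : HasDerivAt a da τ) (hy : HasDerivAt y dy τ) (hκ : HasDerivAt κ dκ τ)
    (hb : ∀ i, HasDerivAt (b i) (db i) τ) (hw : ∀ i, HasDerivAt (w i) (dw i) τ)
    (hF : HasDerivAt F dF τ) (hG : HasDerivAt G dG τ) (hV : HasDerivAt V dV τ) :
    HasDerivAt (fun τ => curE (a τ) (y τ) (κ τ) (fun i => b i τ) (fun i => w i τ) (F τ) (G τ)
      (V τ)) (dCurE (a τ) (y τ) (κ τ) (fun i => b i τ) (fun i => w i τ) (F τ) (G τ) (V τ)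
        da dy dκ db dw dF dG dV) τ :=
  hasDerivAt_curE (b := fun τ i => b i τ) (w := fun τ i => w i τ) ha hy hκ hb hw hF hG hV

lemma hasDerivAt_curX (i : Fin 3)
    (ha : HasDerivAt a da τ) (hy : HasDerivAt y dy τ) (hκ : HasDerivAt κ dκ τ)
    (hb : ∀ i, HasDerivAt (b i) (db i) τ) (hw : ∀ i, HasDerivAt (w i) (dw i) τ)
    (hF : HasDerivAt F dF τ) (hG : HasDerivAt G dG τ) (hV : HasDerivAt V dV τ) :
    HasDerivAt (fun τ => curX i (a τ) (y τ) (κ τ) (fun i => b i τ) (fun i => w i τ) (F τ) (G τ)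
      (V τ)) (dCurX i (a τ) (y τ) (κ τ) (fun i => b i τ) (fun i => w i τ) (F τ) (G τ) (V τ)
        da dy dκ db dw dF dG dV) τ :=
  ((hw i).mul (hasDerivAt_curR (b := fun τ i => b i τ) (w := fun τ i => w i τ)
    ha hy hκ hb hw hF hG hV)).sub
  (((hb i).sub ((hw i).mul (hasDerivAt_rad (b := fun τ i => b i τ) (w := fun τ i => w i τ)
    hb hw))).mul (hasDerivAt_curA (b := fun τ i => b i τ) (w := fun τ i => w i τ)
    ha hy hκ hb hw hF hG))

end

lemma current_identity (a y κ F G V n F1 G1 : ℝ) (b w k : Fin 3 → ℝ) (h : Fin 3 → Fin 3 → ℝ)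
    (att : ℝ) (hatt : att - ∑ i, h i i + n = 0) (hs : ∀ i j, h i j = h j i)
    (hw : w 0 ^ 2 + w 1 ^ 2 + w 2 ^ 2 = 1) :
    dCurE a y κ b w F G V att a 0 k 0 F1 G1 (n * a)
      + ∑ m, dCurX m a y κ b w F G V (k m) (b m) (-(κ ^ 2 * w m)) (h m)
        (fun j => κ * ((if j = m then 1 else 0) - w j * w m)) (F1 * w m) (-(G1 * w m)) (n * b m)
    = ((b 0 ^ 2 + b 1 ^ 2 + b 2 ^ 2) - (w 0 * b 0 + w 1 * b 1 + w 2 * b 2) ^ 2) *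
        (F1 + G1 - κ * (F - G)) + 2 * V * (F1 + G1) - (n * y - 2 * V) * (κ * (F - G)) := by
  rw [Fin.sum_univ_three] at hatt
  obtain rfl : att = h 0 0 + h 1 1 + h 2 2 - n := by linarith
  simp only [dCurE, dCurX, dRad, curR, curA, Fin.sum_univ_three, Pi.zero_apply, hs 1 0, hs 2 0,
    hs 2 1, Fin.isValue, if_true, show ((0 : Fin 3) = 1) = False by simp,
    show ((0 : Fin 3) = 2) = False by simp, show ((1 : Fin 3) = 0) = False by simp,
    show ((1 : Fin 3) = 2) = False by simp, show ((2 : Fin 3) = 0) = False by simp,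
    show ((2 : Fin 3) = 1) = False by simp, if_false]
  generalize b 0 = b0 at *
  generalize b 1 = b1 at *
  generalize b 2 = b2 at *
  generalize k 0 = k0 at *
  generalize k 1 = k1 at *
  generalize k 2 = k2 at *
  generalize w 0 = w0 at *
  generalize w 1 = w1 at *
  generalize w 2 = w2 at *
  linear_combination ((G1 + F1) * V + (F1 + G1) * (b0 ^ 2 + b1 ^ 2 + b2 ^ 2 - a ^ 2) / 2
    + κ * (G - F) * (V + (b0 ^ 2 + b1 ^ 2 + b2 ^ 2) / 2 - a ^ 2 / 2) + κ * a * y * (G1 - F1)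
    - κ ^ 2 * y ^ 2 * (F1 + G1) / 2 + 2 * κ ^ 2 * a * y * (F + G)
    + 3 / 2 * κ ^ 3 * y ^ 2 * (F - G)) * hw

section
variable {Φ : ℝ × E3 → ℝ} {f f1 g g1 V n : ℝ → ℝ}

lemma hasDerivAt_jet (dΦ : Differentiable ℝ Φ)
    (hf : ∀ v, HasDerivAt f (f1 v) v) (hg : ∀ v, HasDerivAt g (g1 v) v)
    (hV : ∀ v, HasDerivAt V (n v) v) {q : ℝ × E3} (hq : q.2 ≠ 0) (d : ℝ × E3) {μ : ℝ}
    (hμ : μ = q.2 0 * ‖q.2‖⁻¹ * d.2 0 + q.2 1 * ‖q.2‖⁻¹ * d.2 1 + q.2 2 * ‖q.2‖⁻¹ * d.2 2) :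
    HasDerivAt (fun τ : ℝ => ‖(q + τ • d).2‖⁻¹) (-(‖q.2‖⁻¹ ^ 2 * μ)) 0 ∧
    (∀ i, HasDerivAt (fun τ : ℝ => (q + τ • d).2 i * ‖(q + τ • d).2‖⁻¹)
      (‖q.2‖⁻¹ * (d.2 i - q.2 i * ‖q.2‖⁻¹ * μ)) 0) ∧
    HasDerivAt (fun τ : ℝ => f ((q + τ • d).1 + ‖(q + τ • d).2‖))
      (f1 (q.1 + ‖q.2‖) * (d.1 + μ)) 0 ∧
    HasDerivAt (fun τ : ℝ => g ((q + τ • d).1 - ‖(q + τ • d).2‖))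
      (g1 (q.1 - ‖q.2‖) * (d.1 - μ)) 0 ∧
    HasDerivAt (fun τ : ℝ => V (Φ (q + τ • d))) (n (Φ q) * fderiv ℝ Φ q d) 0 := by
  have hr : ‖q.2‖ ≠ 0 := norm_ne_zero_iff.mpr hq
  have h0 : HasDerivAt (fun τ : ℝ => ‖(q + τ • d).2‖) μ 0 := by
    rw [hμ]; exact hasDerivAt_norm_line hq d.2
  have h1 : HasDerivAt (fun τ : ℝ => (q + τ • d).1) d.1 0 := by
    simpa using ((hasDerivAt_id (0 : ℝ)).mul_const d.1).const_add q.1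
  have hk : HasDerivAt (fun τ : ℝ => ‖(q + τ • d).2‖⁻¹) (-(‖q.2‖⁻¹ ^ 2 * μ)) 0 := by
    refine (h0.fun_inv (by simpa using hr)).congr_deriv ?_
    simp
    field_simp
  refine ⟨hk, fun i => ?_, ?_, ?_, ?_⟩
  · have hi : HasDerivAt (fun τ : ℝ => (q + τ • d).2 i) (d.2 i) 0 := by
      simpa using ((hasDerivAt_id (0 : ℝ)).mul_const (d.2 i)).const_add (q.2 i)
    refine (hi.mul hk).congr_deriv ?_
    simp
    ring
  · have := (hf (q.1 + ‖q.2‖))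
    exact HasDerivAt.comp (h₂ := f) 0 (by simpa using this) (h1.add h0)
  · have := (hg (q.1 - ‖q.2‖))
    exact HasDerivAt.comp (h₂ := g) 0 (by simpa using this) (h1.sub h0)
  · have := hV (Φ q)
    exact HasDerivAt.comp (h₂ := V) 0 (by simpa using this)
      (hasDerivAt_line dΦ.differentiableAt d)

lemma fderiv_JE (hΦ : ContDiff ℝ (⊤ : ℕ∞) Φ)
    (hf : ∀ v, HasDerivAt f (f1 v) v) (hg : ∀ v, HasDerivAt g (g1 v) v)
    (hV : ∀ v, HasDerivAt V (n v) v) {q : ℝ × E3} (hq : q.2 ≠ 0)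
    (dE : DifferentiableAt ℝ (JE Φ f g V) q) (d : ℝ × E3) {μ : ℝ}
    (hμ : μ = q.2 0 * ‖q.2‖⁻¹ * d.2 0 + q.2 1 * ‖q.2‖⁻¹ * d.2 1 + q.2 2 * ‖q.2‖⁻¹ * d.2 2) :
    fderiv ℝ (JE Φ f g V) q d =
      dCurE (pT Φ q) (Φ q) (‖q.2‖⁻¹) (fun i => pX i Φ q) (fun i => q.2 i * ‖q.2‖⁻¹)
        (f (q.1 + ‖q.2‖)) (g (q.1 - ‖q.2‖)) (V (Φ q)) (fderiv ℝ (pT Φ) q d) (fderiv ℝ Φ q d)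
        (-(‖q.2‖⁻¹ ^ 2 * μ)) (fun i => fderiv ℝ (pX i Φ) q d)
        (fun i => ‖q.2‖⁻¹ * (d.2 i - q.2 i * ‖q.2‖⁻¹ * μ)) (f1 (q.1 + ‖q.2‖) * (d.1 + μ))
        (g1 (q.1 - ‖q.2‖) * (d.1 - μ)) (n (Φ q) * fderiv ℝ Φ q d) := by
  have dΦ : Differentiable ℝ Φ := hΦ.differentiable (by simp)
  have dT : Differentiable ℝ (pT Φ) := (contDiff_pT hΦ).differentiable (by simp)
  have dXΦ : ∀ i, Differentiable ℝ (pX i Φ) := fun i => (contDiff_pX i hΦ).differentiable (by simp)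
  obtain ⟨t1, t2, t3, t4, t5⟩ := hasDerivAt_jet dΦ hf hg hV hq d hμ
  refine (hasDerivAt_line dE d).unique ?_
  have := hasDerivAt_curE' (hasDerivAt_line (q := q) dT.differentiableAt d)
    (hasDerivAt_line (q := q) dΦ.differentiableAt d) t1
    (fun i => hasDerivAt_line (q := q) (dXΦ i).differentiableAt d) t2 t3 t4 t5
  simp only [zero_smul, add_zero] at this
  exact this

lemma fderiv_JX (i : Fin 3) (hΦ : ContDiff ℝ (⊤ : ℕ∞) Φ)
    (hf : ∀ v, HasDerivAt f (f1 v) v) (hg : ∀ v, HasDerivAt g (g1 v) v)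
    (hV : ∀ v, HasDerivAt V (n v) v) {q : ℝ × E3} (hq : q.2 ≠ 0)
    (dE : DifferentiableAt ℝ (JX Φ f g V i) q) (d : ℝ × E3) {μ : ℝ}
    (hμ : μ = q.2 0 * ‖q.2‖⁻¹ * d.2 0 + q.2 1 * ‖q.2‖⁻¹ * d.2 1 + q.2 2 * ‖q.2‖⁻¹ * d.2 2) :
    fderiv ℝ (JX Φ f g V i) q d =
      dCurX i (pT Φ q) (Φ q) (‖q.2‖⁻¹) (fun i => pX i Φ q) (fun i => q.2 i * ‖q.2‖⁻¹)
        (f (q.1 + ‖q.2‖)) (g (q.1 - ‖q.2‖)) (V (Φ q)) (fderiv ℝ (pT Φ) q d) (fderiv ℝ Φ q d)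
        (-(‖q.2‖⁻¹ ^ 2 * μ)) (fun i => fderiv ℝ (pX i Φ) q d)
        (fun i => ‖q.2‖⁻¹ * (d.2 i - q.2 i * ‖q.2‖⁻¹ * μ)) (f1 (q.1 + ‖q.2‖) * (d.1 + μ))
        (g1 (q.1 - ‖q.2‖) * (d.1 - μ)) (n (Φ q) * fderiv ℝ Φ q d) := by
  have dΦ : Differentiable ℝ Φ := hΦ.differentiable (by simp)
  have dT : Differentiable ℝ (pT Φ) := (contDiff_pT hΦ).differentiable (by simp)
  have dXΦ : ∀ i, Differentiable ℝ (pX i Φ) := fun i => (contDiff_pX i hΦ).differentiable (by simp)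
  obtain ⟨t1, t2, t3, t4, t5⟩ := hasDerivAt_jet dΦ hf hg hV hq d hμ
  refine (hasDerivAt_line dE d).unique ?_
  have := hasDerivAt_curX i (hasDerivAt_line (q := q) dT.differentiableAt d)
    (hasDerivAt_line (q := q) dΦ.differentiableAt d) t1
    (fun i => hasDerivAt_line (q := q) (dXΦ i).differentiableAt d) t2 t3 t4 t5
  simp only [zero_smul, add_zero] at this
  exact this

lemma E3.sum_sq_unit {x : E3} (hx : x ≠ 0) :
    (x 0 * ‖x‖⁻¹) ^ 2 + (x 1 * ‖x‖⁻¹) ^ 2 + (x 2 * ‖x‖⁻¹) ^ 2 = 1 := by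
  have hr : ‖x‖ ≠ 0 := norm_ne_zero_iff.mpr hx
  have := E3.norm_sq x
  field_simp
  linarith

/-- The divergence of the weighted current. -/
lemma div_weighted_current (hΦ : ContDiff ℝ (⊤ : ℕ∞) Φ)
    (hf : ∀ v, HasDerivAt f (f1 v) v) (hg : ∀ v, HasDerivAt g (g1 v) v)
    (hV : ∀ v, HasDerivAt V (n v) v) {q : ℝ × E3} (hq : q.2 ≠ 0)
    (hpde : pT (pT Φ) q - ∑ i, pX i (pX i Φ) q + n (Φ q) = 0)
    (dE : DifferentiableAt ℝ (JE Φ f g V) q) (dX : ∀ i, DifferentiableAt ℝ (JX Φ f g V i) q) :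
    divJ (JE Φ f g V) (JX Φ f g V) q =
      ((pX 0 Φ q ^ 2 + pX 1 Φ q ^ 2 + pX 2 Φ q ^ 2) - (q.2 0 * ‖q.2‖⁻¹ * pX 0 Φ q
        + q.2 1 * ‖q.2‖⁻¹ * pX 1 Φ q + q.2 2 * ‖q.2‖⁻¹ * pX 2 Φ q) ^ 2) *
        (f1 (q.1 + ‖q.2‖) + g1 (q.1 - ‖q.2‖)
          - ‖q.2‖⁻¹ * (f (q.1 + ‖q.2‖) - g (q.1 - ‖q.2‖)))
      + 2 * V (Φ q) * (f1 (q.1 + ‖q.2‖) + g1 (q.1 - ‖q.2‖))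
      - (n (Φ q) * Φ q - 2 * V (Φ q)) *
        (‖q.2‖⁻¹ * (f (q.1 + ‖q.2‖) - g (q.1 - ‖q.2‖))) := by
  have key := current_identity (pT Φ q) (Φ q) (‖q.2‖⁻¹) (f (q.1 + ‖q.2‖)) (g (q.1 - ‖q.2‖))
    (V (Φ q)) (n (Φ q)) (f1 (q.1 + ‖q.2‖)) (g1 (q.1 - ‖q.2‖)) (fun i => pX i Φ q)
    (fun i => q.2 i * ‖q.2‖⁻¹) (fun i => pT (pX i Φ) q) (fun i j => pX i (pX j Φ) q)
    (pT (pT Φ) q) hpde (fun i j => pX_pX hΦ i j q) (E3.sum_sq_unit hq)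
  rw [← key]
  unfold divJ
  congr 1
  · rw [pT, fderiv_JE hΦ hf hg hV hq dE (1, 0) (μ := 0) (by simp)]
    simp [pT, pX]
    rfl
  · refine Finset.sum_congr rfl fun m _ => ?_
    rw [pX, fderiv_JX m hΦ hf hg hV hq (dX m) (0, bv m) (μ := q.2 m * ‖q.2‖⁻¹)
      (by fin_cases m <;> simp)]
    have e1 : ∀ j, (bv m : E3) j = if j = m then 1 else 0 := fun j => by
      simp
    have e2 : fderiv ℝ (pT Φ) q (0, bv m) = pT (pX m Φ) q := by
      rw [← pX_pT hΦ]; rfl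
    simp only [e1, e2, zero_add, zero_sub, mul_neg]
    rfl

end

lemma cauchy_three (x y : Fin 3 → ℝ) : (x 0 * y 0 + x 1 * y 1 + x 2 * y 2) ^ 2 ≤
    (x 0 ^ 2 + x 1 ^ 2 + x 2 ^ 2) * (y 0 ^ 2 + y 1 ^ 2 + y 2 ^ 2) := by
  nlinarith [sq_nonneg (x 0 * y 1 - x 1 * y 0), sq_nonneg (x 0 * y 2 - x 2 * y 0),
    sq_nonneg (x 1 * y 2 - x 2 * y 1)]

lemma two_mul_le_of_sq_le {S A B P : ℝ} (h : S ^ 2 ≤ A * B) (hA : 0 ≤ A) (hB : 0 ≤ B) :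
    2 * P * S ≤ A * P ^ 2 + B := by
  have h1 : (2 * P * S) ^ 2 ≤ (A * P ^ 2 + B) ^ 2 := by
    have : P ^ 2 * S ^ 2 ≤ P ^ 2 * (A * B) := mul_le_mul_of_nonneg_left h (sq_nonneg P)
    nlinarith [sq_nonneg (A * P ^ 2 - B)]
  exact (abs_le.1 (abs_le_of_sq_le_sq h1 (by positivity))).2

lemma current_positivity (a y κ F G V : ℝ) (b w e : Fin 3 → ℝ)
    (hw : w 0 ^ 2 + w 1 ^ 2 + w 2 ^ 2 = 1) (he : e 0 ^ 2 + e 1 ^ 2 + e 2 ^ 2 = 1)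
    (hF : 0 ≤ F) (hG : 0 ≤ G) :
    V * (F * (1 + (w 0 * e 0 + w 1 * e 1 + w 2 * e 2))
      + G * (1 - (w 0 * e 0 + w 1 * e 1 + w 2 * e 2))) ≤
    curE a y κ b w F G V + ∑ i, e i * curX i a y κ b w F G V := by
  set τ := w 0 * e 0 + w 1 * e 1 + w 2 * e 2 with hτ
  set ρ := w 0 * b 0 + w 1 * b 1 + w 2 * b 2 with hρ
  set P := a + ρ + κ * y with hP
  set Q := a - ρ - κ * y with hQ
  set N := b 0 ^ 2 + b 1 ^ 2 + b 2 ^ 2 - ρ ^ 2 with hN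
  set S := e 0 * b 0 + e 1 * b 1 + e 2 * b 2 - τ * ρ with hS
  have hτ2 : τ ^ 2 ≤ 1 := by
    have := cauchy_three w e; rw [hw, he] at this; simpa using this
  have hτ1 := abs_le.1 ((sq_le_one_iff_abs_le_one τ).1 hτ2)
  have hN0 : 0 ≤ N := by
    have := cauchy_three w b; rw [hw] at this; rw [hN, hρ]; linarith
  have hSN : S ^ 2 ≤ (1 - τ ^ 2) * N := by
    have := cauchy_three (fun i => e i - τ * w i) (fun i => b i - ρ * w i)
    have e1 : (e 0 - τ * w 0) * (b 0 - ρ * w 0) + (e 1 - τ * w 1) * (b 1 - ρ * w 1)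
      + (e 2 - τ * w 2) * (b 2 - ρ * w 2) = S := by
      rw [hS]; linear_combination (τ * ρ) * hw - ρ * hτ.symm - τ * hρ.symm
    have e2 : (e 0 - τ * w 0) ^ 2 + (e 1 - τ * w 1) ^ 2 + (e 2 - τ * w 2) ^ 2 = 1 - τ ^ 2 := by
      linear_combination τ ^ 2 * hw + he - 2 * τ * hτ.symm
    have e3 : (b 0 - ρ * w 0) ^ 2 + (b 1 - ρ * w 1) ^ 2 + (b 2 - ρ * w 2) ^ 2 = N := by
      rw [hN]; linear_combination ρ ^ 2 * hw - 2 * ρ * hρ.symm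
    simp only [e1, e2, e3] at this
    exact this
  have i1 := two_mul_le_of_sq_le (P := P) (S := S) (A := 1 - τ) (B := (1 + τ) * N)
    (by linarith [hSN]) (by linarith [hτ1.2]) (mul_nonneg (by linarith [hτ1.1]) hN0)
  have i2 := two_mul_le_of_sq_le (P := Q) (S := S) (A := 1 + τ) (B := (1 - τ) * N)
    (by linarith [hSN]) (by linarith [hτ1.1]) (mul_nonneg (by linarith [hτ1.2]) hN0)
  have j1 := mul_le_mul_of_nonneg_left i1 hF
  have j2 := mul_le_mul_of_nonneg_left i2 hG
  have key : curE a y κ b w F G V + ∑ i, e i * curX i a y κ b w F G V =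
      V * (F * (1 + τ) + G * (1 - τ)) + F * ((1 - τ) * P ^ 2 + (1 + τ) * N - 2 * P * S) / 2
        + G * ((1 + τ) * Q ^ 2 + (1 - τ) * N - 2 * Q * S) / 2 := by
    simp only [curE, curX, curR, curA, Fin.sum_univ_three, ← hρ, ← hP, ← hQ, ← hN]
    rw [hS]
    linear_combination
      (G * Q ^ 2 / 2 - F * P ^ 2 / 2 + (F - G) * N / 2 + (F - G) * V + ρ * (F * P + G * Q)) *
        hτ.symm
  rw [key]
  linarith

lemma current_radial (a y κ F G V : ℝ) (b w : Fin 3 → ℝ)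
    (hw : w 0 ^ 2 + w 1 ^ 2 + w 2 ^ 2 = 1) :
    ∑ i, w i * curX i a y κ b w F G V = curR a y κ b w F G V := by
  simp only [curX, Fin.sum_univ_three]
  linear_combination (curR a y κ b w F G V +
    (w 0 * b 0 + w 1 * b 1 + w 2 * b 2) * curA a y κ b w F G) * hw

lemma curR_le (a y κ F G V : ℝ) (b w : Fin 3 → ℝ) (hw : w 0 ^ 2 + w 1 ^ 2 + w 2 ^ 2 = 1)
    (hG : 0 ≤ G) (hFG : G ≤ F) (hV : 0 ≤ V) (hκ : 0 < κ) :
    κ⁻¹ * curR a y κ b w F G V ≤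
      G * (2 * |a| * (κ⁻¹ * √(b 0 ^ 2 + b 1 ^ 2 + b 2 ^ 2) + |y|))
      + κ⁻¹ * F * ((b 0 ^ 2 + b 1 ^ 2 + b 2 ^ 2) / 2 + V) := by
  set ρ := w 0 * b 0 + w 1 * b 1 + w 2 * b 2 with hρ
  set B := b 0 ^ 2 + b 1 ^ 2 + b 2 ^ 2 with hB
  have hB0 : 0 ≤ B := by positivity
  have hρB : ρ ^ 2 ≤ B := by have := cauchy_three w b; rw [hw] at this; rw [hρ]; linarith
  have hρa : |ρ| ≤ √B := Real.abs_le_sqrt hρB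
  have h1 : curR a y κ b w F G V ≤ G * (-(2 * a * (ρ + κ * y))) + F * (B / 2 + V) := by
    simp only [curR, ← hρ, ← hB]
    nlinarith [mul_nonneg (sub_nonneg.2 hFG) (sq_nonneg (a + ρ + κ * y)),
      mul_nonneg hG hV, mul_nonneg hG hB0, mul_nonneg (sub_nonneg.2 hFG) (sq_nonneg ρ),
      mul_nonneg hG (sub_nonneg.2 hρB)]
  have h2 : -(2 * a * (ρ + κ * y)) ≤ 2 * |a| * (√B + κ * |y|) := by
    calc -(2 * a * (ρ + κ * y)) ≤ |2 * a * (ρ + κ * y)| := neg_le_abs _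
      _ = 2 * |a| * |ρ + κ * y| := by rw [abs_mul, abs_mul]; norm_num
      _ ≤ _ := by
        gcongr
        refine (abs_add_le _ _).trans ?_
        rw [abs_mul, abs_of_pos hκ]
        gcongr
  have hκ' : 0 < κ⁻¹ := inv_pos.2 hκ
  calc κ⁻¹ * curR a y κ b w F G V
      ≤ κ⁻¹ * (G * (2 * |a| * (√B + κ * |y|)) + F * (B / 2 + V)) := by
        refine mul_le_mul_of_nonneg_left (h1.trans ?_) hκ'.le
        gcongr
    _ = _ := by field_simp

lemma current_bulk_nonpos {N V A D ny p : ℝ} (hN : 0 ≤ N) (hV : 0 ≤ V) (hD : 0 ≤ D)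
    (hny : ny = (p + 1) * V) (hp : p ≤ 3) (hA : 2 * A ≤ (p - 1) * D) :
    N * (A - D) + 2 * V * A - (ny - 2 * V) * D ≤ 0 := by
  subst hny
  have h1 : A - D ≤ 0 := by nlinarith
  nlinarith [mul_nonneg hN (neg_nonneg.2 h1), mul_nonneg hV (sub_nonneg.2 hA)]

lemma contDiffAt_jet_fn {E : Type*} [NormedAddCommGroup E] [NormedSpace ℝ E] {q : E}
    {a y κ : E → ℝ} {b w : Fin 3 → E → ℝ} {F G V : E → ℝ}
    (ha : ContDiffAt ℝ 1 a q) (hy : ContDiffAt ℝ 1 y q) (hκ : ContDiffAt ℝ 1 κ q)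
    (hb : ∀ i, ContDiffAt ℝ 1 (b i) q) (hw : ∀ i, ContDiffAt ℝ 1 (w i) q)
    (hF : ContDiffAt ℝ 1 F q) (hG : ContDiffAt ℝ 1 G q) (hV : ContDiffAt ℝ 1 V q) :
    ContDiffAt ℝ 1 (fun q => curE (a q) (y q) (κ q) (fun i => b i q) (fun i => w i q)
      (F q) (G q) (V q)) q ∧
    ∀ i, ContDiffAt ℝ 1 (fun q => curX i (a q) (y q) (κ q) (fun i => b i q) (fun i => w i q)
      (F q) (G q) (V q)) q := by
  unfold curE curX curR curA
  have b0 := hb 0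
  have b1 := hb 1
  have b2 := hb 2
  have w0 := hw 0
  have w1 := hw 1
  have w2 := hw 2
  refine ⟨by fun_prop, fun i => ?_⟩
  have bi := hb i
  have wi := hw i
  fun_prop

lemma contDiffAt_J {Φ : ℝ × E3 → ℝ} {f g V : ℝ → ℝ} (hΦ : ContDiff ℝ (⊤ : ℕ∞) Φ)
    (hf : ContDiff ℝ 1 f) (hg : ContDiff ℝ 1 g) (hV : ContDiff ℝ 1 V) {q : ℝ × E3}
    (hq : q.2 ≠ 0) :
    ContDiffAt ℝ 1 (JE Φ f g V) q ∧ ∀ i, ContDiffAt ℝ 1 (JX Φ f g V i) q := by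
  have hn : ContDiffAt ℝ 1 (fun q : ℝ × E3 => ‖q.2‖) q := contDiffAt_snd.norm ℝ hq
  have hk : ContDiffAt ℝ 1 (fun q : ℝ × E3 => ‖q.2‖⁻¹) q := hn.inv (norm_ne_zero_iff.2 hq)
  have h1 : ContDiff ℝ 1 Φ := hΦ.of_le (by simp)
  have hT : ContDiff ℝ 1 (pT Φ) := (contDiff_pT hΦ).of_le (by simp)
  have hX : ∀ i, ContDiff ℝ 1 (pX i Φ) := fun i => (contDiff_pX i hΦ).of_le (by simp)
  have hc : ∀ i, ContDiff ℝ 1 (fun q : ℝ × E3 => q.2 i) := fun i => by fun_prop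
  exact contDiffAt_jet_fn hT.contDiffAt h1.contDiffAt hk (fun i => (hX i).contDiffAt)
    (fun i => (hc i).contDiffAt.mul hk) (hf.contDiffAt.comp q (contDiffAt_fst.add hn))
    (hg.contDiffAt.comp q (contDiffAt_fst.sub hn)) (hV.contDiffAt.comp q h1.contDiffAt)

/-- Spatial cutoff vanishing near the time axis. -/
def cut (ε : ℝ) (q : ℝ × E3) : ℝ := smoothTransition (‖q.2‖ ^ 2 / ε ^ 2 - 1)

lemma cut_nonneg (ε : ℝ) (q : ℝ × E3) : 0 ≤ cut ε q := smoothTransition.nonneg _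
lemma cut_le_one (ε : ℝ) (q : ℝ × E3) : cut ε q ≤ 1 := smoothTransition.le_one _

lemma contDiff_cut (ε : ℝ) : ContDiff ℝ 1 (cut ε) := by
  have h : ContDiff ℝ 1 (fun q : ℝ × E3 => ‖q.2‖ ^ 2 / ε ^ 2 - 1) :=
    ((contDiff_snd.norm_sq ℝ).div_const _).sub contDiff_const
  exact (smoothTransition.contDiff (n := 1)).comp h

lemma cut_eq_zero {ε : ℝ} (hε : 0 < ε) {q : ℝ × E3} (h : ‖q.2‖ ≤ ε) : cut ε q = 0 := by
  refine smoothTransition.zero_of_nonpos ?_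
  rw [sub_nonpos, div_le_one (by positivity)]
  gcongr

lemma cut_eq_one {ε : ℝ} (hε : 0 < ε) {q : ℝ × E3} (h : 2 * ε ≤ ‖q.2‖) : cut ε q = 1 := by
  refine smoothTransition.one_of_one_le ?_
  rw [le_sub_iff_add_le, le_div_iff₀ (by positivity)]
  nlinarith

lemma fderiv_cut (ε : ℝ) (q d : ℝ × E3) : fderiv ℝ (cut ε) q d =
    deriv smoothTransition (‖q.2‖ ^ 2 / ε ^ 2 - 1) * (2 * inner ℝ q.2 d.2 / ε ^ 2) := by
  refine fderiv_eq_of_line ((contDiff_cut ε).differentiable (by norm_num) q) ?_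
  have h1 : HasDerivAt (fun τ : ℝ => (q + τ • d).2) d.2 0 := by
    simpa using ((hasDerivAt_id (0 : ℝ)).smul_const d.2).const_add q.2
  have h2 := (h1.norm_sq.div_const (ε ^ 2)).sub_const 1
  have h3 : DifferentiableAt ℝ smoothTransition (‖(q + (0 : ℝ) • d).2‖ ^ 2 / ε ^ 2 - 1) :=
    (smoothTransition.contDiff (n := 1)).differentiable (by norm_num) _
  have := HasDerivAt.comp (h₂ := smoothTransition) 0 h3.hasDerivAt h2
  refine this.congr_deriv ?_
  simp

lemma contDiff_cut_mul {ε : ℝ} (hε : 0 < ε) {A : ℝ × E3 → ℝ}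
    (hA : ∀ q : ℝ × E3, q.2 ≠ 0 → ContDiffAt ℝ 1 A q) :
    ContDiff ℝ 1 (fun q => cut ε q * A q) := by
  rw [contDiff_iff_contDiffAt]
  intro q
  by_cases hq : q.2 = 0
  · have : (fun q => cut ε q * A q) =ᶠ[nhds q] fun _ => 0 := by
      have hU : IsOpen {q : ℝ × E3 | ‖q.2‖ < ε} := isOpen_lt (by fun_prop) continuous_const
      filter_upwards [hU.mem_nhds (by simpa [hq] using hε)] with q' hq'
      rw [cut_eq_zero hε (le_of_lt hq'), zero_mul]
    exact contDiffAt_const.congr_of_eventuallyEq this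
  · exact (contDiff_cut ε).contDiffAt.mul (hA q hq)

/-- Admissible weights for the conformal-type current. -/
structure Weights (p : ℝ) (f f1 g g1 : ℝ → ℝ) : Prop where
  hf : ∀ v, HasDerivAt f (f1 v) v
  hg : ∀ v, HasDerivAt g (g1 v) v
  hf1 : Continuous f1
  hg1 : Continuous g1
  g0 : ∀ u, 0 ≤ g u
  le : ∀ t r, 0 ≤ t → 0 < r → g (t - r) ≤ f (t + r)
  bulk : ∀ t r, 0 ≤ t → 0 < r →
    2 * (f1 (t + r) + g1 (t - r)) ≤ (p - 1) * (r⁻¹ * (f (t + r) - g (t - r)))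

/-- Admissible potentials. -/
structure Pot (p : ℝ) (V n : ℝ → ℝ) : Prop where
  hV : ∀ v, HasDerivAt V (n v) v
  hn : Continuous n
  V0 : ∀ v, 0 ≤ V v
  hom : ∀ v, n v * v = (p + 1) * V v

lemma contDiff_one_of_hasDerivAt {f f1 : ℝ → ℝ} (hf : ∀ v, HasDerivAt f (f1 v) v)
    (hf1 : Continuous f1) : ContDiff ℝ 1 f := by
  have : deriv f = f1 := funext fun v => (hf v).deriv
  rw [contDiff_one_iff_deriv, this]
  exact ⟨fun v => (hf v).differentiableAt, hf1⟩

section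
variable {p : ℝ} {Φ : ℝ × E3 → ℝ} {f f1 g g1 V n : ℝ → ℝ}

lemma contDiffAt_current (hW : Weights p f f1 g g1) (hP : Pot p V n)
    (hΦ : ContDiff ℝ (⊤ : ℕ∞) Φ) {q : ℝ × E3} (hq : q.2 ≠ 0) :
    ContDiffAt ℝ 1 (JE Φ f g V) q ∧ ∀ i, ContDiffAt ℝ 1 (JX Φ f g V i) q :=
  contDiffAt_J hΦ (contDiff_one_of_hasDerivAt hW.hf hW.hf1)
    (contDiff_one_of_hasDerivAt hW.hg hW.hg1) (contDiff_one_of_hasDerivAt hP.hV hP.hn) hq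

lemma div_current_nonpos (hp : p ≤ 3) (hW : Weights p f f1 g g1) (hP : Pot p V n)
    (hΦ : ContDiff ℝ (⊤ : ℕ∞) Φ) {q : ℝ × E3} (hq : q.2 ≠ 0) (ht : 0 ≤ q.1)
    (hpde : pT (pT Φ) q - ∑ i, pX i (pX i Φ) q + n (Φ q) = 0) :
    divJ (JE Φ f g V) (JX Φ f g V) q ≤ 0 := by
  obtain ⟨h0, hJ⟩ := contDiffAt_current hW hP hΦ hq
  rw [div_weighted_current hΦ hW.hf hW.hg hP.hV hq hpde (h0.differentiableAt (by norm_num))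
    (fun i => (hJ i).differentiableAt (by norm_num))]
  have hr : 0 < ‖q.2‖ := norm_pos_iff.2 hq
  have hle := hW.le q.1 ‖q.2‖ ht hr
  refine current_bulk_nonpos ?_ (hP.V0 _) ?_ (hP.hom _) hp (hW.bulk q.1 ‖q.2‖ ht hr)
  · have := cauchy_three (fun i => q.2 i * ‖q.2‖⁻¹) (fun i => pX i Φ q)
    simp only [E3.sum_sq_unit hq] at this
    linarith
  · exact mul_nonneg (inv_nonneg.2 hr.le) (sub_nonneg.2 hle)

lemma div_cut_current (hW : Weights p f f1 g g1) (hP : Pot p V n)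
    (hΦ : ContDiff ℝ (⊤ : ℕ∞) Φ) {q : ℝ × E3} (hq : q.2 ≠ 0) (ε : ℝ) :
    divJ (fun q => cut ε q * JE Φ f g V q) (fun i q => cut ε q * JX Φ f g V i q) q =
      cut ε q * divJ (JE Φ f g V) (JX Φ f g V) q
      + deriv smoothTransition (‖q.2‖ ^ 2 / ε ^ 2 - 1) * (2 / ε ^ 2) *
        (‖q.2‖ * curR (pT Φ q) (Φ q) (‖q.2‖⁻¹) (fun i => pX i Φ q) (fun i => q.2 i * ‖q.2‖⁻¹)
          (f (q.1 + ‖q.2‖)) (g (q.1 - ‖q.2‖)) (V (Φ q))) := by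
  obtain ⟨h0, hJ⟩ := contDiffAt_current hW hP hΦ hq
  have dc : DifferentiableAt ℝ (cut ε) q := (contDiff_cut ε).differentiable (by norm_num) q
  have d0 := h0.differentiableAt (by norm_num)
  have dJ := fun i => (hJ i).differentiableAt (by norm_num)
  have hr : ‖q.2‖ ≠ 0 := norm_ne_zero_iff.2 hq
  rw [← current_radial _ _ _ _ _ _ _ _ (E3.sum_sq_unit hq)]
  simp only [divJ, pT, pX]
  rw [fderiv_fun_mul dc d0]
  have e1 : ∀ i, fderiv ℝ (fun q => cut ε q * JX Φ f g V i q) q =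
      cut ε q • fderiv ℝ (JX Φ f g V i) q + JX Φ f g V i q • fderiv ℝ (cut ε) q :=
    fun i => fderiv_fun_mul dc (dJ i)
  have e2 : ∀ i : Fin 3, inner ℝ q.2 (bv i) = q.2 i := fun i => by
    simp [EuclideanSpace.inner_single_right]
  simp only [e1, add_apply, smul_apply, fderiv_cut,
    smul_eq_mul, inner_zero_right, e2, Finset.sum_add_distrib, mul_add, Finset.mul_sum]
  have e3 : ∀ i, JX Φ f g V i q * (deriv smoothTransition (‖q.2‖ ^ 2 / ε ^ 2 - 1) *
      (2 * q.2 i / ε ^ 2)) = deriv smoothTransition (‖q.2‖ ^ 2 / ε ^ 2 - 1) * (2 / ε ^ 2) *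
      (‖q.2‖ * (q.2 i * ‖q.2‖⁻¹ * JX Φ f g V i q)) := fun i => by
    field_simp
  simp only [e3]
  simp only [JX, pT, pX]
  ring

lemma div_cut_le (hp : p ≤ 3) (hW : Weights p f f1 g g1) (hP : Pot p V n)
    (hΦ : ContDiff ℝ (⊤ : ℕ∞) Φ)
    (hpde : ∀ q : ℝ × E3, 0 ≤ q.1 → pT (pT Φ) q - ∑ i, pX i (pX i Φ) q + n (Φ q) = 0) (T : ℝ) :
    ∃ M, 0 ≤ M ∧ ∀ ε, 0 < ε → ε ≤ 1 → ∀ q : ℝ × E3, 0 ≤ q.1 → q.1 ≤ T →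
      divJ (fun q => cut ε q * JE Φ f g V q) (fun i q => cut ε q * JX Φ f g V i q) q ≤
        M / ε ^ 2 * (Metric.ball (0 : E3) (2 * ε)).indicator 1 q.2 := by
  have cf := (contDiff_one_of_hasDerivAt hW.hf hW.hf1).continuous
  have cg := (contDiff_one_of_hasDerivAt hW.hg hW.hg1).continuous
  have cV := (contDiff_one_of_hasDerivAt hP.hV hP.hn).continuous
  have cΦ := hΦ.continuous
  have cT := (contDiff_pT hΦ).continuous
  have cX : ∀ i, Continuous (pX i Φ) := fun i => (contDiff_pX i hΦ).continuous
  have cX0 := cX 0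
  have cX1 := cX 1
  have cX2 := cX 2
  let Bd : ℝ × E3 → ℝ := fun q => g (q.1 - ‖q.2‖) * (2 * |pT Φ q| *
      (‖q.2‖ * √(pX 0 Φ q ^ 2 + pX 1 Φ q ^ 2 + pX 2 Φ q ^ 2) + |Φ q|))
      + ‖q.2‖ * f (q.1 + ‖q.2‖) * ((pX 0 Φ q ^ 2 + pX 1 Φ q ^ 2 + pX 2 Φ q ^ 2) / 2 + V (Φ q))
  have cB : Continuous Bd := by fun_prop
  obtain ⟨M0, hM0⟩ := (isCompact_Icc (a := (0 : ℝ)) (b := T)).prod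
    (isCompact_closedBall (0 : E3) 2) |>.exists_bound_of_continuousOn cB.continuousOn
  have cψ : Continuous (deriv smoothTransition) :=
    (smoothTransition.contDiff (n := 1)).continuous_deriv (by norm_num)
  obtain ⟨K, hK⟩ := (isCompact_Icc (a := (-1 : ℝ)) (b := 3)).exists_bound_of_continuousOn
    cψ.continuousOn
  have hK0 : 0 ≤ K := (norm_nonneg _).trans (hK 0 (by norm_num))
  refine ⟨K * 2 * |M0|, by positivity, fun ε hε hε1 q ht hT => ?_⟩
  have hR : 0 ≤ K * 2 * |M0| / ε ^ 2 * (Metric.ball (0 : E3) (2 * ε)).indicator (1 : E3 → ℝ) q.2 :=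
    mul_nonneg (by positivity) (Set.indicator_nonneg (fun _ _ => by simp) _)
  have hψ0 : 0 ≤ deriv smoothTransition (‖q.2‖ ^ 2 / ε ^ 2 - 1) :=
    smoothTransition.monotone.deriv_nonneg
  by_cases hq : q.2 = 0
  · refine le_trans (le_of_eq ?_) hR
    have key : ∀ A : ℝ × E3 → ℝ, fderiv ℝ (fun q => cut ε q * A q) q = 0 := fun A => by
      have : (fun q => cut ε q * A q) =ᶠ[nhds q] fun _ => 0 := by
        have hU : IsOpen {q : ℝ × E3 | ‖q.2‖ < ε} := isOpen_lt (by fun_prop) continuous_const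
        filter_upwards [hU.mem_nhds (by simpa [hq] using hε)] with q' hq'
        rw [cut_eq_zero hε (le_of_lt hq'), zero_mul]
      rw [this.fderiv_eq]; simp
    simp only [divJ, pT, pX, key]
    simp
  rw [div_cut_current hW hP hΦ hq]
  have h1 := mul_nonpos_of_nonneg_of_nonpos (cut_nonneg ε q)
    (div_current_nonpos hp hW hP hΦ hq ht (hpde q ht))
  have hr : 0 < ‖q.2‖ := norm_pos_iff.2 hq
  by_cases hb : ‖q.2‖ < 2 * ε
  · have hmem : q.2 ∈ Metric.ball (0 : E3) (2 * ε) := by simpa using hb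
    rw [Set.indicator_of_mem hmem]
    have h2 := curR_le (pT Φ q) (Φ q) (‖q.2‖⁻¹) (f (q.1 + ‖q.2‖)) (g (q.1 - ‖q.2‖)) (V (Φ q))
      (fun i => pX i Φ q) (fun i => q.2 i * ‖q.2‖⁻¹) (E3.sum_sq_unit hq) (hW.g0 _)
      (hW.le _ _ ht hr) (hP.V0 _) (inv_pos.2 hr)
    rw [inv_inv] at h2
    have h3 : Bd q ≤ |M0| := (le_abs_self _).trans ((hM0 q ⟨⟨ht, hT⟩, by
      simp; linarith⟩).trans (le_abs_self _))
    have h4 := (le_abs_self _).trans (hK (‖q.2‖ ^ 2 / ε ^ 2 - 1) (by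
      have : ‖q.2‖ ^ 2 / ε ^ 2 ≤ 4 := by
        rw [div_le_iff₀ (by positivity)]; nlinarith
      exact ⟨by linarith [show 0 ≤ ‖q.2‖ ^ 2 / ε ^ 2 by positivity], by linarith⟩))
    have h5 := h2.trans h3
    calc _ ≤ 0 + K * (2 / ε ^ 2) * |M0| := by
          refine add_le_add h1 ?_
          refine (mul_le_mul_of_nonneg_left h5 (by positivity)).trans ?_
          gcongr
      _ = _ := by simp; ring
  · have : deriv smoothTransition (‖q.2‖ ^ 2 / ε ^ 2 - 1) = 0 := by
      have h4 : 1 < ‖q.2‖ ^ 2 / ε ^ 2 - 1 := by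
        rw [lt_sub_iff_add_lt, lt_div_iff₀ (by positivity)]
        push Not at hb
        nlinarith
      have : smoothTransition =ᶠ[nhds (‖q.2‖ ^ 2 / ε ^ 2 - 1)] fun _ => 1 := by
        filter_upwards [Ioi_mem_nhds h4] with z hz
        exact smoothTransition.one_of_one_le (le_of_lt hz)
      rw [this.deriv_eq]; simp
    rw [this]
    simp only [zero_mul, add_zero]
    exact h1.trans hR

end

lemma ofReal_integral_le_lintegral {α : Type*} [MeasurableSpace α] (μ : Measure α) (f : α → ℝ) :
    ENNReal.ofReal (∫ x, f x ∂μ) ≤ ∫⁻ x, ENNReal.ofReal (f x) ∂μ := by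
  by_cases hf : Integrable f μ
  · rw [integral_eq_lintegral_pos_part_sub_lintegral_neg_part hf]
    refine (ENNReal.ofReal_le_ofReal (sub_le_self _ ENNReal.toReal_nonneg)).trans ?_
    exact ENNReal.ofReal_toReal_le
  · rw [integral_undef hf]; simp

lemma measurable_sphere_lintegral {F : E3 → ℝ≥0∞} (hF : Measurable F) (x₀ : E3) :
    Measurable fun s : ℝ => ∫⁻ ω : S2, F (x₀ + s • (ω : E3)) ∂sphereMeasure := by
  have : Measurable fun q : ℝ × S2 => F (x₀ + q.1 • (q.2 : E3)) :=
    hF.comp (by fun_prop : Continuous fun q : ℝ × S2 => x₀ + q.1 • (q.2 : E3)).measurable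
  exact this.lintegral_prod_right'

lemma lintegral_polar_Ioc_le {F : E3 → ℝ≥0∞} (hF : Measurable F) (x₀ : E3) (T : ℝ) :
    ∫⁻ s in Set.Ioc 0 T, ENNReal.ofReal (s ^ 2) *
      ∫⁻ ω : S2, F (x₀ + s • (ω : E3)) ∂sphereMeasure ≤ ∫⁻ x, F x := by
  rw [lintegral_polar F hF x₀]
  exact lintegral_mono_set Set.Ioc_subset_Ioi_self

lemma cone_energy_ineq {J0 : ℝ × E3 → ℝ} {J : Fin 3 → ℝ × E3 → ℝ} (h0 : ContDiff ℝ 1 J0)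
    (hJ : ∀ i, ContDiff ℝ 1 (J i)) (x₀ : E3) {T c : ℝ} (hT : 0 ≤ T) (hc : 0 ≤ c)
    (hdiv : ∀ l, 0 ≤ l → l ≤ T → ∫⁻ s in Set.Ioc 0 l, ENNReal.ofReal (s ^ 2) *
      ∫⁻ ω : S2, ENNReal.ofReal (divJ J0 J (l - s, x₀ + s • (ω : E3))) ∂sphereMeasure
        ≤ ENNReal.ofReal c)
    (hpos : ∀ s, 0 < s → s ≤ T → ∀ ω : S2, 0 ≤ J0 (T - s, x₀ + s • (ω : E3))
      + ∑ i, (ω : E3) i * J i (T - s, x₀ + s • (ω : E3))) :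
    ∫⁻ s in Set.Ioc 0 T, ∫⁻ ω : S2, ENNReal.ofReal (s ^ 2 * (J0 (T - s, x₀ + s • (ω : E3))
      + ∑ i, (ω : E3) i * J i (T - s, x₀ + s • (ω : E3)))) ∂sphereMeasure ≤
    (∫⁻ x, ENNReal.ofReal (J0 (0, x))) + ENNReal.ofReal (c * T) := by
  have cJ0 := h0.continuous
  have cJ := fun i => (hJ i).continuous
  have cint : Continuous fun q : ℝ × S2 => q.1 ^ 2 * (J0 (T - q.1, x₀ + q.1 • (q.2 : E3))
      + ∑ i, (q.2 : E3) i * J i (T - q.1, x₀ + q.1 • (q.2 : E3))) := by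
    have h1 : Continuous fun q : ℝ × S2 => (T - q.1, x₀ + q.1 • (q.2 : E3)) := by fun_prop
    have h2 := cJ0.comp h1
    have h3 := fun i => (cJ i).comp h1
    refine (continuous_fst.pow 2).mul (h2.add (continuous_finsetSum _ fun i _ => ?_))
    exact Continuous.mul (by fun_prop) (h3 i)
  have cflux : Continuous (coneFlux J0 J x₀ T) := continuous_integral_compact sphereMeasure cint
  -- the left-hand side is a real integral
  have hL : ∫⁻ s in Set.Ioc 0 T, ∫⁻ ω : S2, ENNReal.ofReal (s ^ 2 *
      (J0 (T - s, x₀ + s • (ω : E3)) + ∑ i, (ω : E3) i * J i (T - s, x₀ + s • (ω : E3))))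
        ∂sphereMeasure = ENNReal.ofReal (∫ s in (0 : ℝ)..T, coneFlux J0 J x₀ T s) := by
    rw [intervalIntegral.integral_of_le hT, ofReal_integral_eq_lintegral_ofReal]
    · refine setLIntegral_congr_fun measurableSet_Ioc fun s hs => ?_
      simp only
      rw [coneFlux, ofReal_integral_eq_lintegral_ofReal]
      · exact S2.continuous_integrable _ (cint.comp (by fun_prop : Continuous fun ω : S2 => (s, ω)))
      · exact Filter.Eventually.of_forall fun ω => mul_nonneg (sq_nonneg s) (hpos s hs.1 hs.2 ω)
    · exact (cflux.integrableOn_Icc).mono_set Set.Ioc_subset_Icc_self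
    · filter_upwards [ae_restrict_mem measurableSet_Ioc] with s hs
      exact integral_nonneg fun ω => mul_nonneg (sq_nonneg s) (hpos s hs.1 hs.2 ω)
  rw [hL]
  let A : ℝ → ℝ := fun l => l ^ 2 * ∫ ω : S2, J0 (0, x₀ + l • (ω : E3)) ∂sphereMeasure
  have cA : Continuous A := by
    have : Continuous fun q : ℝ × S2 => J0 (0, x₀ + q.1 • (q.2 : E3)) := by fun_prop
    exact (continuous_pow 2).mul (continuous_integral_compact sphereMeasure this)
  -- the bulk term
  have hD : ∀ l, 0 ≤ l → l ≤ T → ∫ s in (0 : ℝ)..l, s ^ 2 * ∫ ω : S2,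
      divJ J0 J (l - s, x₀ + s • (ω : E3)) ∂sphereMeasure ≤ c := by
    intro l hl hlT
    rw [← ENNReal.ofReal_le_ofReal_iff hc, intervalIntegral.integral_of_le hl]
    refine (ofReal_integral_le_lintegral _ _).trans (le_trans ?_ (hdiv l hl hlT))
    refine lintegral_mono fun s => ?_
    rw [ENNReal.ofReal_mul (sq_nonneg s)]
    gcongr
    exact ofReal_integral_le_lintegral _ _
  have hmono : MonotoneOn (fun l => (∫ s in (0 : ℝ)..l, A s) + c * l
      - ∫ s in (0 : ℝ)..l, coneFlux J0 J x₀ l s) (Set.Icc 0 T) := by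
    have hd : ∀ l, HasDerivAt (fun l => (∫ s in (0 : ℝ)..l, A s) + c * l
      - ∫ s in (0 : ℝ)..l, coneFlux J0 J x₀ l s) (A l + c * 1 - (A l + ∫ s in (0 : ℝ)..l, s ^ 2 *
        ∫ ω : S2, divJ J0 J (l - s, x₀ + s • (ω : E3)) ∂sphereMeasure)) l := fun l =>
      ((cA.integral_hasStrictDerivAt 0 l).hasDerivAt.add ((hasDerivAt_id l).const_mul c)).sub
        (hasDerivAt_coneFlux h0 hJ x₀ l)
    refine monotoneOn_of_deriv_nonneg (convex_Icc _ _)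
      (fun l _ => (hd l).continuousAt.continuousWithinAt)
      (fun l _ => (hd l).differentiableAt.differentiableWithinAt) fun l hl => ?_
    rw [interior_Icc] at hl
    rw [(hd l).deriv]
    linarith [hD l hl.1.le hl.2.le]
  have hfin := hmono (Set.left_mem_Icc.2 hT) (Set.right_mem_Icc.2 hT) hT
  simp only [intervalIntegral.integral_same, mul_zero, add_zero, sub_zero] at hfin
  calc ENNReal.ofReal (∫ s in (0 : ℝ)..T, coneFlux J0 J x₀ T s)
      ≤ ENNReal.ofReal ((∫ s in (0 : ℝ)..T, A s) + c * T) := by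
        apply ENNReal.ofReal_le_ofReal; linarith
    _ ≤ ENNReal.ofReal (∫ s in (0 : ℝ)..T, A s) + ENNReal.ofReal (c * T) :=
        ENNReal.ofReal_add_le
    _ ≤ _ := by
        gcongr
        have hm : Measurable fun x : E3 => ENNReal.ofReal (J0 (0, x)) := by
          have : Continuous fun x : E3 => J0 (0, x) := by fun_prop
          exact this.measurable.ennreal_ofReal
        refine le_trans ?_ (lintegral_polar_Ioc_le hm x₀ T)
        rw [intervalIntegral.integral_of_le hT]
        refine (ofReal_integral_le_lintegral _ _).trans (lintegral_mono fun s => ?_)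
        simp only [A]
        rw [ENNReal.ofReal_mul (sq_nonneg s)]
        gcongr
        exact ofReal_integral_le_lintegral _ _

/-- The weight controlled by the flux of the weighted current. -/
def fluxW (f g : ℝ → ℝ) (t : ℝ) (x ω : E3) : ℝ :=
  f (t + ‖x‖) * (1 + inner ℝ x ω * ‖x‖⁻¹) + g (t - ‖x‖) * (1 - inner ℝ x ω * ‖x‖⁻¹)

lemma E3.inner_eq (x y : E3) : inner ℝ x y = x 0 * y 0 + x 1 * y 1 + x 2 * y 2 := by
  simp [PiLp.inner_apply, Fin.sum_univ_three]; ring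

section
variable {p : ℝ} {Φ : ℝ × E3 → ℝ} {f f1 g g1 V n : ℝ → ℝ}

lemma Weights.f_nonneg (hW : Weights p f f1 g g1) {t r : ℝ} (ht : 0 ≤ t) (hr : 0 < r) :
    0 ≤ f (t + r) := (hW.g0 _).trans (hW.le t r ht hr)

lemma fluxW_nonneg (hW : Weights p f f1 g g1) {t : ℝ} {x : E3} (ht : 0 ≤ t) (hx : x ≠ 0)
    (ω : S2) : 0 ≤ fluxW f g t x ω := by
  have hr : 0 < ‖x‖ := norm_pos_iff.2 hx
  have h1 : |inner ℝ x (ω : E3) * ‖x‖⁻¹| ≤ 1 := by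
    rw [abs_mul, abs_of_pos (inv_pos.2 hr), ← div_eq_mul_inv, div_le_one hr]
    simpa using abs_real_inner_le_norm x (ω : E3)
  have h2 := abs_le.1 h1
  exact add_nonneg (mul_nonneg (hW.f_nonneg ht hr) (by linarith))
    (mul_nonneg (hW.g0 _) (by linarith))

lemma flux_lower (hW : Weights p f f1 g g1) {q : ℝ × E3} (ht : 0 ≤ q.1)
    (hq : q.2 ≠ 0) (ω : S2) :
    V (Φ q) * fluxW f g q.1 q.2 ω ≤ JE Φ f g V q + ∑ i, (ω : E3) i * JX Φ f g V i q := by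
  have hr : 0 < ‖q.2‖ := norm_pos_iff.2 hq
  refine le_trans (le_of_eq ?_) (current_positivity (pT Φ q) (Φ q) (‖q.2‖⁻¹) (f (q.1 + ‖q.2‖))
    (g (q.1 - ‖q.2‖)) (V (Φ q)) (fun i => pX i Φ q) (fun i => q.2 i * ‖q.2‖⁻¹) (fun i => (ω : E3) i)
    (E3.sum_sq_unit hq) (S2.sum_sq ω) (hW.f_nonneg ht hr) (hW.g0 _))
  simp only [fluxW, E3.inner_eq]
  ring

/-- Regularized form of the weighted flux estimate. -/
lemma weighted_flux_cut (hp : p ≤ 3) (hW : Weights p f f1 g g1) (hP : Pot p V n)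
    (hΦ : ContDiff ℝ (⊤ : ℕ∞) Φ)
    (hpde : ∀ q : ℝ × E3, 0 ≤ q.1 → pT (pT Φ) q - ∑ i, pX i (pX i Φ) q + n (Φ q) = 0)
    {T : ℝ} (hT : 0 ≤ T) (x₀ : E3) :
    ∃ C : ℝ, ∀ ε, 0 < ε → ε ≤ 1 →
      ∫⁻ s in Set.Ioc 0 T, ∫⁻ ω : S2, ENNReal.ofReal (cut ε (T - s, x₀ + s • (ω : E3)) *
        (s ^ 2 * (V (Φ (T - s, x₀ + s • (ω : E3)))
          * fluxW f g (T - s) (x₀ + s • (ω : E3)) ω))) ∂sphereMeasure ≤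
      (∫⁻ x, ENNReal.ofReal (JE Φ f g V (0, x))) + ENNReal.ofReal (C * ε) := by
  obtain ⟨M, hM0, hM⟩ := div_cut_le hp hW hP hΦ hpde T
  obtain ⟨c, hc0, hcv⟩ : ∃ c : ℝ, 0 ≤ c ∧
      (volume : Measure E3) (Metric.ball 0 1) = ENNReal.ofReal c :=
    ⟨_, ENNReal.toReal_nonneg, (ENNReal.ofReal_toReal measure_ball_lt_top.ne).symm⟩
  refine ⟨8 * M * c * T, ?_⟩
  intro ε hε hε1
  have hlow : ∀ s, 0 < s → s ≤ T → ∀ ω : S2, cut ε (T - s, x₀ + s • (ω : E3)) *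
      (V (Φ (T - s, x₀ + s • (ω : E3))) * fluxW f g (T - s) (x₀ + s • (ω : E3)) ω) ≤
      cut ε (T - s, x₀ + s • (ω : E3)) * JE Φ f g V (T - s, x₀ + s • (ω : E3))
      + ∑ i, (ω : E3) i * (cut ε (T - s, x₀ + s • (ω : E3)) *
        JX Φ f g V i (T - s, x₀ + s • (ω : E3))) := by
    intro s hs hsT ω
    have e : ∀ i, (ω : E3) i * (cut ε (T - s, x₀ + s • (ω : E3)) *
        JX Φ f g V i (T - s, x₀ + s • (ω : E3))) = cut ε (T - s, x₀ + s • (ω : E3)) *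
        ((ω : E3) i * JX Φ f g V i (T - s, x₀ + s • (ω : E3))) := fun i => by ring
    simp only [e, ← Finset.mul_sum, ← mul_add]
    by_cases hx : x₀ + s • (ω : E3) = 0
    · rw [cut_eq_zero hε (by simp [hx, hε.le])]; simp
    · exact mul_le_mul_of_nonneg_left (flux_lower hW (q := (T - s, x₀ + s • (ω : E3)))
        (by simpa using hsT) hx ω) (cut_nonneg _ _)
  have main := cone_energy_ineq (J0 := fun q => cut ε q * JE Φ f g V q)
    (J := fun i q => cut ε q * JX Φ f g V i q)
    (contDiff_cut_mul hε fun q hq => (contDiffAt_current hW hP hΦ hq).1)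
    (fun i => contDiff_cut_mul hε fun q hq => (contDiffAt_current hW hP hΦ hq).2 i) x₀ hT
    (c := 8 * M * c * ε) (by positivity) ?_ ?_
  · refine le_trans ?_ (main.trans ?_)
    · refine setLIntegral_mono' measurableSet_Ioc fun s hs => lintegral_mono fun ω => ?_
      refine ENNReal.ofReal_le_ofReal ?_
      have := mul_le_mul_of_nonneg_left (hlow s hs.1 hs.2 ω) (sq_nonneg s)
      linarith
    · refine add_le_add (lintegral_mono fun x => ?_) (le_of_eq (by ring_nf))
      simp only
      rw [ENNReal.ofReal_mul (cut_nonneg _ _)]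
      exact mul_le_of_le_one_left' (by simpa using cut_le_one ε (0, x))
  · intro l hl hlT
    have hm : Measurable ((Metric.ball (0 : E3) (2 * ε)).indicator (1 : E3 → ℝ≥0∞)) :=
      measurable_one.indicator measurableSet_ball
    calc _ ≤ ∫⁻ s in Set.Ioc 0 l, ENNReal.ofReal (M / ε ^ 2) * (ENNReal.ofReal (s ^ 2) *
          ∫⁻ ω : S2, (Metric.ball (0 : E3) (2 * ε)).indicator (1 : E3 → ℝ≥0∞)
            (x₀ + s • (ω : E3)) ∂sphereMeasure) := by
          refine setLIntegral_mono' measurableSet_Ioc fun s hs => ?_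
          rw [mul_left_comm]
          refine mul_le_mul_right ?_ _
          rw [← lintegral_const_mul' _ _ ENNReal.ofReal_ne_top]
          refine lintegral_mono fun ω => ?_
          refine (ENNReal.ofReal_le_ofReal (hM ε hε hε1 (l - s, x₀ + s • (ω : E3))
            (by simpa using hs.2) (by simp; linarith [hs.1]))).trans ?_
          rw [ENNReal.ofReal_mul (by positivity)]
          gcongr
          by_cases h : x₀ + s • (ω : E3) ∈ Metric.ball (0 : E3) (2 * ε)
          · rw [Set.indicator_of_mem h, Set.indicator_of_mem h]; simp
          · rw [Set.indicator_of_notMem h]; simp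
      _ ≤ ENNReal.ofReal (M / ε ^ 2) * (volume : Measure E3) (Metric.ball 0 (2 * ε)) := by
          rw [lintegral_const_mul' _ _ ENNReal.ofReal_ne_top]
          gcongr
          refine (lintegral_polar_Ioc_le hm x₀ l).trans (le_of_eq ?_)
          rw [lintegral_indicator_one measurableSet_ball]
      _ = ENNReal.ofReal (8 * M * c * ε) := by
          rw [Measure.addHaar_ball _ _ (by positivity), hcv, ← ENNReal.ofReal_mul (by positivity),
            ← ENNReal.ofReal_mul (by positivity)]
          congr 1
          simp
          field_simp
          ring
  · intro s hs hsT ω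
    refine le_trans ?_ (hlow s hs hsT ω)
    by_cases hx : x₀ + s • (ω : E3) = 0
    · rw [cut_eq_zero hε (by simp [hx, hε.le])]; simp
    · exact mul_nonneg (cut_nonneg _ _) (mul_nonneg (hP.V0 _)
        (fluxW_nonneg hW (by linarith) hx ω))

/-- Weighted flux estimate for the potential energy through a backward light cone. -/
theorem weighted_flux (hp : p ≤ 3) (hW : Weights p f f1 g g1) (hP : Pot p V n)
    (hΦ : ContDiff ℝ (⊤ : ℕ∞) Φ)
    (hpde : ∀ q : ℝ × E3, 0 ≤ q.1 → pT (pT Φ) q - ∑ i, pX i (pX i Φ) q + n (Φ q) = 0)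
    {T : ℝ} (hT : 0 ≤ T) (x₀ : E3) :
    ∫⁻ s in Set.Ioc 0 T, ∫⁻ ω : S2, ENNReal.ofReal (s ^ 2 * (V (Φ (T - s, x₀ + s • (ω : E3)))
      * fluxW f g (T - s) (x₀ + s • (ω : E3)) ω)) ∂sphereMeasure ≤
    ∫⁻ x, ENNReal.ofReal (JE Φ f g V (0, x)) := by
  have cf := (contDiff_one_of_hasDerivAt hW.hf hW.hf1).continuous
  have cg := (contDiff_one_of_hasDerivAt hW.hg hW.hg1).continuous
  have cV := (contDiff_one_of_hasDerivAt hP.hV hP.hn).continuous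
  have cΦ := hΦ.continuous
  obtain ⟨C, step⟩ := weighted_flux_cut hp hW hP hΦ hpde hT x₀
  -- passage to the limit
  let e : ℕ → ℝ := fun k => 1 / ((k : ℝ) + 1)
  have he0 : ∀ k, 0 < e k := fun k => by positivity
  have he1 : ∀ k, e k ≤ 1 := fun k => by
    rw [div_le_one (by positivity)]; linarith [show (0 : ℝ) ≤ k from Nat.cast_nonneg k]
  have hlim : Filter.Tendsto e Filter.atTop (nhds 0) := tendsto_one_div_add_atTop_nhds_zero_nat
  let F : ℕ → ℝ → S2 → ℝ≥0∞ := fun k s ω => ENNReal.ofReal (cut (e k) (T - s, x₀ + s • (ω : E3)) *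
        (s ^ 2 * (V (Φ (T - s, x₀ + s • (ω : E3)))
          * fluxW f g (T - s) (x₀ + s • (ω : E3)) ω)))
  have hFm : ∀ k, Measurable fun q : ℝ × S2 => F k q.1 q.2 := by
    intro k
    have h1 : Continuous fun q : ℝ × S2 => cut (e k) (T - q.1, x₀ + q.1 • (q.2 : E3)) :=
      (contDiff_cut _).continuous.comp (by fun_prop)
    have h2 : Continuous fun q : ℝ × S2 => V (Φ (T - q.1, x₀ + q.1 • (q.2 : E3))) := by fun_prop
    have h3 : Continuous fun q : ℝ × S2 => ‖x₀ + q.1 • (q.2 : E3)‖ := by fun_prop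
    have h4 : Continuous fun q : ℝ × S2 => inner ℝ (x₀ + q.1 • (q.2 : E3)) (q.2 : E3) := by
      fun_prop
    have h5 : Continuous fun q : ℝ × S2 => f (T - q.1 + ‖x₀ + q.1 • (q.2 : E3)‖) := by fun_prop
    have h6 : Continuous fun q : ℝ × S2 => g (T - q.1 - ‖x₀ + q.1 • (q.2 : E3)‖) := by fun_prop
    have h7 := h4.measurable.mul h3.measurable.inv
    exact (h1.measurable.mul ((measurable_fst.pow_const 2).mul (h2.measurable.mul
      ((h5.measurable.mul (measurable_const.add h7)).add
        (h6.measurable.mul (measurable_const.sub h7)))))).ennreal_ofReal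
  have h1 : ∀ᵐ s : ℝ ∂(volume.restrict (Set.Ioc 0 T)), ∀ ω : S2,
      ENNReal.ofReal (s ^ 2 * (V (Φ (T - s, x₀ + s • (ω : E3)))
        * fluxW f g (T - s) (x₀ + s • (ω : E3)) ω)) ≤
      Filter.liminf (fun k => F k s ω) Filter.atTop := by
    have hne : ∀ᵐ s : ℝ ∂(volume.restrict (Set.Ioc 0 T)), s ≠ ‖x₀‖ :=
      ae_restrict_of_ae (Measure.ae_ne volume ‖x₀‖)
    filter_upwards [hne, ae_restrict_mem measurableSet_Ioc] with s hs hsI ω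
    have hx : x₀ + s • (ω : E3) ≠ 0 := by
      intro h
      have : x₀ = -(s • (ω : E3)) := eq_neg_of_add_eq_zero_left h
      apply hs
      rw [this, norm_neg, norm_smul, S2.norm_coe, mul_one, Real.norm_eq_abs, abs_of_pos hsI.1]
    refine Filter.le_liminf_of_le (by isBoundedDefault) ?_
    have hpos : 0 < ‖x₀ + s • (ω : E3)‖ / 2 := by
      have := norm_pos_iff.2 hx; positivity
    filter_upwards [hlim.eventually (gt_mem_nhds hpos)] with k hk
    have : cut (e k) (T - s, x₀ + s • (ω : E3)) = 1 := cut_eq_one (he0 k) (by simp; linarith)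
    simp only [F, this, one_mul]
    exact le_rfl
  have hstep : ∀ k, ∫⁻ s in Set.Ioc 0 T, ∫⁻ ω, F k s ω ∂sphereMeasure ≤
      (∫⁻ x, ENNReal.ofReal (JE Φ f g V (0, x))) + ENNReal.ofReal (C * e k) :=
    fun k => step (e k) (he0 k) (he1 k)
  clear_value F
  refine le_trans (lintegral_mono_ae (h1.mono fun s hs => lintegral_mono hs)) ?_
  refine le_trans (lintegral_mono fun s => lintegral_liminf_le fun k =>
    (hFm k).comp (measurable_const.prodMk measurable_id)) ?_
  refine le_trans (lintegral_liminf_le fun k => (hFm k).lintegral_prod_right') ?_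
  refine le_trans (Filter.liminf_le_liminf (v := fun k => (∫⁻ x, ENNReal.ofReal (JE Φ f g V (0, x)))
        + ENNReal.ofReal (C * e k)) (Filter.Eventually.of_forall fun k => hstep k)) ?_
  refine le_of_eq (Filter.Tendsto.liminf_eq ?_)
  have : Filter.Tendsto (fun k => ENNReal.ofReal (C * e k)) Filter.atTop
      (nhds 0) := by
    have := (ENNReal.continuous_ofReal.tendsto 0).comp
      (by simpa using hlim.const_mul C)
    simpa [Function.comp_def] using this
  simpa using tendsto_const_nhds.add this
end

/-- Outgoing multiplier weight. -/
def wtF (γ v : ℝ) : ℝ := 1 + |v| ^ γ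

/-- Incoming multiplier weight. -/
def wtG (p γ u : ℝ) : ℝ :=
  1 + (p - 1) / (p - 1 + γ) * |u| ^ γ - γ / (p - 1 + γ) * (u * |u| ^ (γ - 1))

lemma hasDerivAt_mul_abs_rpow {γ : ℝ} (hγ : 1 < γ) (u : ℝ) :
    HasDerivAt (fun u : ℝ => u * |u| ^ (γ - 1)) (γ * |u| ^ (γ - 1)) u := by
  have main : ∀ u : ℝ, u ≠ 0 →
      HasDerivAt (fun u : ℝ => u * |u| ^ (γ - 1)) (γ * |u| ^ (γ - 1)) u := by
    intro u hu
    have e : ∀ w : ℝ, w ≠ 0 → |w| * |w| ^ (γ - 1) = |w| ^ γ := fun w hw => by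
      rw [← rpow_one_add' (abs_nonneg _) (by linarith)]; congr 1; ring
    have e2 : |u| * |u| ^ (γ - 2) = |u| ^ (γ - 1) := by
      rw [← rpow_one_add' (abs_nonneg _) (by linarith)]; congr 1; ring
    have h := hasDerivAt_abs_rpow u hγ
    rcases lt_or_gt_of_ne hu with hu | hu
    · have h' := h.neg
      refine HasDerivAt.congr_of_eventuallyEq (h'.congr_deriv ?_) ?_
      · rw [← e2, abs_of_neg hu]; ring
      · filter_upwards [gt_mem_nhds hu] with w hw
        simp only [Pi.neg_apply]
        rw [← e w hw.ne, abs_of_neg hw]; ring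
    · refine HasDerivAt.congr_of_eventuallyEq (h.congr_deriv ?_) ?_
      · rw [← e2, abs_of_pos hu]; ring
      · filter_upwards [lt_mem_nhds hu] with w hw
        rw [← e w hw.ne', abs_of_pos hw]
  by_cases hu : u = 0
  · subst hu
    have hc : Continuous fun u : ℝ => |u| ^ (γ - 1) :=
      continuous_abs.rpow_const fun _ => Or.inr (by linarith)
    exact hasDerivAt_of_hasDerivAt_of_ne (g := fun u => γ * |u| ^ (γ - 1)) main
      (continuous_id.mul hc).continuousAt (hc.const_mul γ).continuousAt
  · exact main u hu

lemma continuous_abs_rpow_mul {γ : ℝ} (hγ : 1 < γ) :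
    Continuous fun u : ℝ => γ * |u| ^ (γ - 2) * u := by
  have h : ContDiff ℝ 1 fun u : ℝ => ‖u‖ ^ γ := contDiff_norm_rpow hγ
  have h2 := h.continuous_deriv le_rfl
  convert h2 using 2 with u
  exact (hasDerivAt_abs_rpow u hγ).deriv.symm

lemma wtG_of_nonneg {p γ u : ℝ} (hγ : 1 < γ) (hu : 0 ≤ u) :
    wtG p γ u = 1 + (p - 1 - γ) / (p - 1 + γ) * u ^ γ := by
  have : u * u ^ (γ - 1) = u ^ γ := by
    rw [← rpow_one_add' hu (by linarith)]; congr 1; ring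
  rw [wtG, abs_of_nonneg hu, this]; ring

lemma wtG_of_nonpos {p γ u : ℝ} (hγ : 1 < γ) (hγp : γ < p - 1) (hu : u ≤ 0) :
    wtG p γ u = 1 + (-u) ^ γ := by
  have : (-u) * (-u) ^ (γ - 1) = (-u) ^ γ := by
    rw [← rpow_one_add' (by linarith) (by linarith)]; congr 1; ring
  rw [wtG, abs_of_nonpos hu, ← this]
  have : p - 1 + γ ≠ 0 := by linarith
  field_simp
  ring

lemma wtG_le {p γ : ℝ} (hγ : 1 < γ) (hγp : γ < p - 1) (u : ℝ) : wtG p γ u ≤ 1 + |u| ^ γ := by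
  rcases le_total 0 u with hu | hu
  · rw [wtG_of_nonneg hγ hu, abs_of_nonneg hu]
    have : (p - 1 - γ) / (p - 1 + γ) ≤ 1 := by rw [div_le_one (by linarith)]; linarith
    have := mul_le_of_le_one_left (rpow_nonneg hu γ) this
    linarith
  · rw [wtG_of_nonpos hγ hγp hu, abs_of_nonpos hu]

lemma le_wtG {p γ : ℝ} (hγ : 1 < γ) (hγp : γ < p - 1) (u : ℝ) :
    (p - 1 - γ) / (p - 1 + γ) * (1 + |u| ^ γ) ≤ wtG p γ u := by
  have h1 : (p - 1 - γ) / (p - 1 + γ) ≤ 1 := by rw [div_le_one (by linarith)]; linarith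
  rcases le_total 0 u with hu | hu
  · rw [wtG_of_nonneg hγ hu, abs_of_nonneg hu]; linarith
  · rw [wtG_of_nonpos hγ hγp hu, abs_of_nonpos hu]
    exact mul_le_of_le_one_left (by have := rpow_nonneg (show 0 ≤ -u by linarith) γ; linarith) h1

lemma rpow_sub_one_mul_le {γ v w : ℝ} (hγ2 : γ ≤ 2) (hw : 0 < w) (hwv : w ≤ v) :
    v ^ (γ - 1) * w ≤ w ^ (γ - 1) * v := by
  have hv : 0 < v := hw.trans_le hwv
  have e : ∀ y : ℝ, 0 < y → y = y ^ (γ - 1) * y ^ (2 - γ) := fun y hy => by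
    rw [← rpow_add hy, show γ - 1 + (2 - γ) = 1 by ring, rpow_one]
  have h := rpow_le_rpow hw.le hwv (show 0 ≤ 2 - γ by linarith)
  calc v ^ (γ - 1) * w = v ^ (γ - 1) * (w ^ (γ - 1) * w ^ (2 - γ)) := by rw [← e w hw]
    _ ≤ v ^ (γ - 1) * (w ^ (γ - 1) * v ^ (2 - γ)) := by gcongr
    _ = w ^ (γ - 1) * (v ^ (γ - 1) * v ^ (2 - γ)) := by ring
    _ = _ := by rw [← e v hv]

lemma weights_concrete {p γ : ℝ} (hp : p ≤ 3) (hγ : 1 < γ) (hγp : γ < p - 1) :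
    Weights p (wtF γ) (fun v => γ * |v| ^ (γ - 2) * v) (wtG p γ)
      (fun u => (p - 1) / (p - 1 + γ) * (γ * |u| ^ (γ - 2) * u)
        - γ / (p - 1 + γ) * (γ * |u| ^ (γ - 1))) where
  hf v := (hasDerivAt_abs_rpow v hγ).const_add 1
  hg u := (((hasDerivAt_abs_rpow u hγ).const_mul _).const_add 1).sub
    ((hasDerivAt_mul_abs_rpow hγ u).const_mul _)
  hf1 := continuous_abs_rpow_mul hγ
  hg1 := by
    have h1 := continuous_abs_rpow_mul hγ
    have h2 : Continuous fun u : ℝ => |u| ^ (γ - 1) :=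
      continuous_abs.rpow_const fun _ => Or.inr (by linarith)
    fun_prop
  g0 u := le_trans (mul_nonneg (div_nonneg (by linarith) (by linarith))
    (by have := rpow_nonneg (abs_nonneg u) γ; linarith)) (le_wtG hγ hγp u)
  le t r ht hr := by
    refine (wtG_le hγ hγp _).trans ?_
    rw [wtF]
    gcongr 1 + ?_ ^ γ
    rw [abs_of_nonneg (by linarith : 0 ≤ t + r)]
    exact abs_le.2 ⟨by linarith, by linarith⟩
  bulk t r ht hr := by
    have hv : 0 < t + r := by linarith
    have ev : ∀ y : ℝ, 0 < y → |y| ^ (γ - 2) * y = y ^ (γ - 1) := fun y hy => by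
      rw [abs_of_pos hy, ← rpow_add_one hy.ne']; congr 1; ring
    have ev1 : ∀ y : ℝ, 0 < y → y ^ (γ - 1) * y = y ^ γ := fun y hy => by
      rw [← rpow_add_one hy.ne']; congr 1; ring
    have hD : 0 < p - 1 + γ := by linarith
    rw [← div_eq_inv_mul, ← mul_div_assoc, le_div_iff₀ hr]
    simp only [wtF]
    rw [mul_assoc γ (|t + r| ^ _), ev _ hv, abs_of_pos hv]
    rcases lt_trichotomy (t - r) 0 with hu | hu | hu
    · rw [wtG_of_nonpos hγ hγp hu.le]
      obtain ⟨w, hw⟩ : ∃ w, w = -(t - r) := ⟨_, rfl⟩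
      have hw0 : 0 < w := by linarith
      have e1 : |t - r| = w := by rw [abs_of_neg hu, hw]
      have e2 : t - r = -w := by linarith
      rw [e1, ← hw, e2]
      have e3 : w ^ (γ - 2) * w = w ^ (γ - 1) := by have := ev w hw0; rwa [abs_of_pos hw0] at this
      have e4 := ev1 w hw0
      have e5 := ev1 (t + r) hv
      have e6 := rpow_sub_one_mul_le (show γ ≤ 2 by linarith) hw0 (show w ≤ t + r by linarith)
      have e7 := rpow_le_rpow hw0.le (show w ≤ t + r by linarith) (show 0 ≤ γ by linarith)
      have e8 : (p - 1) / (p - 1 + γ) * (γ * w ^ (γ - 2) * -w)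
          - γ / (p - 1 + γ) * (γ * w ^ (γ - 1)) = -(γ * w ^ (γ - 1)) := by
        rw [← e3]; field_simp; ring
      rw [e8]
      have hr2 : r = ((t + r) + w) / 2 := by linarith
      generalize t + r = v at *
      rw [hr2]
      have : 2 * (γ * v ^ (γ - 1) + -(γ * w ^ (γ - 1))) * ((v + w) / 2) =
        γ * (v ^ (γ - 1) * v - w ^ (γ - 1) * w + (v ^ (γ - 1) * w - w ^ (γ - 1) * v)) := by ring
      rw [this, e4, e5]
      have h1 : γ * (v ^ γ - w ^ γ + (v ^ (γ - 1) * w - w ^ (γ - 1) * v)) ≤ γ * (v ^ γ - w ^ γ) :=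
        mul_le_mul_of_nonneg_left (by linarith) (by linarith)
      have h2 : γ * (v ^ γ - w ^ γ) ≤ (p - 1) * (v ^ γ - w ^ γ) :=
        mul_le_mul_of_nonneg_right (by linarith) (by linarith)
      linarith
    · rw [hu]
      have e5 := ev1 (t + r) hv
      have hr2 : r = (t + r) / 2 := by linarith
      have hz : (0 : ℝ) ^ (γ - 1) = 0 := zero_rpow (by linarith)
      have hz2 : (0 : ℝ) ^ γ = 0 := zero_rpow (by linarith)
      rw [wtG_of_nonneg hγ le_rfl, abs_zero, hz, hz2]
      generalize t + r = v at *
      rw [hr2]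
      have : 0 ≤ v ^ γ := rpow_nonneg hv.le _
      nlinarith
    · rw [wtG_of_nonneg hγ hu.le]
      have e3 := ev (t - r) hu
      rw [mul_assoc γ (|t - r| ^ _), e3, abs_of_pos hu]
      have e5 := ev1 (t + r) hv
      have e6 := rpow_le_rpow hu.le (show t - r ≤ t + r by linarith) (show 0 ≤ γ by linarith)
      have e7 := rpow_le_rpow hu.le (show t - r ≤ t + r by linarith) (show 0 ≤ γ - 1 by linarith)
      have e8 : 0 ≤ (t + r) ^ (γ - 1) := rpow_nonneg hv.le _
      obtain ⟨c, hc⟩ : ∃ c, c = (p - 1 - γ) / (p - 1 + γ) := ⟨_, rfl⟩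
      have hc0 : 0 ≤ c := by rw [hc]; exact div_nonneg (by linarith) hD.le
      have hc1 : γ * (1 + c) = (p - 1) * (1 - c) := by rw [hc]; field_simp; ring
      have e9 : (p - 1) / (p - 1 + γ) * (γ * (t - r) ^ (γ - 1))
          - γ / (p - 1 + γ) * (γ * (t - r) ^ (γ - 1)) = γ * c * (t - r) ^ (γ - 1) := by
        rw [hc]; ring
      rw [e9, ← hc]
      have hr3 : 2 * r ≤ t + r := by linarith
      generalize t + r = v at *
      generalize t - r = u at *
      have a1 : γ * c * u ^ (γ - 1) ≤ γ * c * v ^ (γ - 1) :=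
        mul_le_mul_of_nonneg_left e7 (mul_nonneg (by linarith) hc0)
      have a2 : (p - 1) * (c * u ^ γ) ≤ (p - 1) * (c * v ^ γ) :=
        mul_le_mul_of_nonneg_left (mul_le_mul_of_nonneg_left e6 hc0) (by linarith)
      have a3 : 0 ≤ γ * (1 + c) * v ^ (γ - 1) := by
        have : 0 < γ := by linarith
        positivity
      calc 2 * (γ * v ^ (γ - 1) + γ * c * u ^ (γ - 1)) * r
          = (γ * v ^ (γ - 1) + γ * c * u ^ (γ - 1)) * (2 * r) := by ring
        _ ≤ (γ * (1 + c) * v ^ (γ - 1)) * (2 * r) := by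
            apply mul_le_mul_of_nonneg_right _ (by linarith); linarith
        _ ≤ (γ * (1 + c) * v ^ (γ - 1)) * v := mul_le_mul_of_nonneg_left hr3 a3
        _ = (p - 1) * (1 - c) * v ^ γ := by rw [mul_assoc, e5, hc1]
        _ ≤ _ := by linarith

lemma pot_concrete {p : ℝ} (hp : 1 < p) :
    Pot p (fun y => |y| ^ (p + 1) / (p + 1)) (fun y => |y| ^ (p - 1) * y) where
  hV v := by
    have h := (hasDerivAt_abs_rpow v (show 1 < p + 1 by linarith)).div_const (p + 1)
    refine h.congr_deriv ?_
    have : p + 1 ≠ 0 := by linarith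
    rw [show p + 1 - 2 = p - 1 by ring]; field_simp
  hn := (continuous_abs.rpow_const fun _ => Or.inr (by linarith)).mul continuous_id
  V0 v := div_nonneg (rpow_nonneg (abs_nonneg _) _) (by linarith)
  hom v := by
    have : p + 1 ≠ 0 := by linarith
    have h : |v| ^ (p + 1) = |v| ^ (p - 1) * |v| ^ 2 := by
      rw [← rpow_add_natCast' (abs_nonneg v) (by push_cast; linarith)]
      congr 1; push_cast; ring
    rw [h, sq_abs]; field_simp

section
variable {g : E3 → ℝ} {w w1 : ℝ → ℝ}

lemma hasDerivAt_sphere_sq (hg : ContDiff ℝ 1 g) (x₀ : E3) (ρ : ℝ) :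
    HasDerivAt (fun ρ => ∫ ω : S2, g (x₀ + ρ • (ω : E3)) ^ 2 ∂sphereMeasure)
      (∫ ω : S2, 2 * g (x₀ + ρ • (ω : E3)) * fderiv ℝ g (x₀ + ρ • (ω : E3)) ω ∂sphereMeasure) ρ := by
  have hc : Continuous fun q : ℝ × S2 => g (x₀ + q.1 • (q.2 : E3)) :=
    hg.continuous.comp (by fun_prop)
  have hd : Continuous fun q : ℝ × S2 => fderiv ℝ g (x₀ + q.1 • (q.2 : E3)) (q.2 : E3) :=
    ((hg.continuous_fderiv one_ne_zero).comp (by fun_prop)).clm_apply (by fun_prop)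
  refine hasDerivAt_integral_compact sphereMeasure
    (F := fun ρ (ω : S2) => g (x₀ + ρ • (ω : E3)) ^ 2)
    (F' := fun ρ (ω : S2) => 2 * g (x₀ + ρ • (ω : E3)) * fderiv ℝ g (x₀ + ρ • (ω : E3)) ω)
    (by fun_prop) (by fun_prop) (fun s ω => ?_) ρ
  have h1 : HasDerivAt (fun τ : ℝ => x₀ + τ • (ω : E3)) (ω : E3) s := by
    simpa using ((hasDerivAt_id s).smul_const (ω : E3)).const_add x₀
  have h2 := ((hg.differentiable (by norm_num)) (x₀ + s • (ω : E3))).hasFDerivAt.comp_hasDerivAt s h1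
  refine (h2.pow 2).congr_deriv ?_
  simp

lemma hardy_interval (hg : ContDiff ℝ 1 g) (hw : ∀ ρ, HasDerivAt w (w1 ρ) ρ) (hw1 : Continuous w1)
    (w0 : ∀ ρ, 0 ≤ w ρ) (w1n : ∀ ρ, 0 ≤ ρ → 0 ≤ w1 ρ) (x₀ : E3) {R : ℝ} (hR : 0 ≤ R) :
    ∫ ρ in (0 : ℝ)..R, w ρ * ∫ ω : S2, g (x₀ + ρ • (ω : E3)) ^ 2 ∂sphereMeasure ≤
      2 * (R * (w R * ∫ ω : S2, g (x₀ + R • (ω : E3)) ^ 2 ∂sphereMeasure)) +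
      4 * ∫ ρ in (0 : ℝ)..R, ρ ^ 2 * (w ρ *
        ∫ ω : S2, (fderiv ℝ g (x₀ + ρ • (ω : E3)) ω) ^ 2 ∂sphereMeasure) := by
  have hc : Continuous fun q : ℝ × S2 => g (x₀ + q.1 • (q.2 : E3)) :=
    hg.continuous.comp (by fun_prop)
  have hd : Continuous fun q : ℝ × S2 => fderiv ℝ g (x₀ + q.1 • (q.2 : E3)) (q.2 : E3) :=
    ((hg.continuous_fderiv one_ne_zero).comp (by fun_prop)).clm_apply (by fun_prop)
  have hcs : ∀ ρ : ℝ, Continuous fun ω : S2 => g (x₀ + ρ • (ω : E3)) := fun ρ =>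
    hc.comp (by fun_prop : Continuous fun ω : S2 => (ρ, ω))
  have hds : ∀ ρ : ℝ, Continuous fun ω : S2 => fderiv ℝ g (x₀ + ρ • (ω : E3)) (ω : E3) := fun ρ =>
    hd.comp (by fun_prop : Continuous fun ω : S2 => (ρ, ω))
  have cw : Continuous w := (contDiff_one_of_hasDerivAt hw hw1).continuous
  let A : ℝ → ℝ := fun ρ => ∫ ω : S2, g (x₀ + ρ • (ω : E3)) ^ 2 ∂sphereMeasure
  let B : ℝ → ℝ := fun ρ =>
    ∫ ω : S2, 2 * g (x₀ + ρ • (ω : E3)) * fderiv ℝ g (x₀ + ρ • (ω : E3)) ω ∂sphereMeasure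
  let D : ℝ → ℝ := fun ρ => ∫ ω : S2, (fderiv ℝ g (x₀ + ρ • (ω : E3)) ω) ^ 2 ∂sphereMeasure
  have cA : Continuous A := continuous_integral_compact sphereMeasure (Y := ℝ)
    (F := fun ρ (ω : S2) => g (x₀ + ρ • (ω : E3)) ^ 2) (by fun_prop)
  have cB : Continuous B := continuous_integral_compact sphereMeasure (Y := ℝ)
    (F := fun ρ (ω : S2) => 2 * g (x₀ + ρ • (ω : E3)) * fderiv ℝ g (x₀ + ρ • (ω : E3)) ω)
    (by fun_prop)
  have cD : Continuous D := continuous_integral_compact sphereMeasure (Y := ℝ)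
    (F := fun ρ (ω : S2) => (fderiv ℝ g (x₀ + ρ • (ω : E3)) ω) ^ 2) (by fun_prop)
  have hK : ∀ ρ, HasDerivAt (fun ρ => ρ * (w ρ * A ρ))
      (1 * (w ρ * A ρ) + ρ * (w1 ρ * A ρ + w ρ * B ρ)) ρ := fun ρ =>
    (hasDerivAt_id ρ).mul ((hw ρ).mul (hasDerivAt_sphere_sq hg x₀ ρ))
  have hint := intervalIntegral.integral_eq_sub_of_hasDerivAt (a := 0) (b := R)
    (fun ρ _ => hK ρ) (Continuous.intervalIntegrable (by fun_prop) _ _)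
  have hpt : ∀ ρ ∈ Set.Icc 0 R, 2⁻¹ * (w ρ * A ρ) - 2 * (ρ ^ 2 * (w ρ * D ρ)) ≤
      1 * (w ρ * A ρ) + ρ * (w1 ρ * A ρ + w ρ * B ρ) := by
    intro ρ hρ
    have hA0 : 0 ≤ A ρ := integral_nonneg fun ω => sq_nonneg _
    have h1 : 0 ≤ 2⁻¹ * A ρ + ρ * B ρ + 2 * ρ ^ 2 * D ρ := by
      have i1 : Integrable (fun ω : S2 => 2⁻¹ * g (x₀ + ρ • (ω : E3)) ^ 2) sphereMeasure :=
        S2.continuous_integrable sphereMeasure (((hcs ρ).pow 2).const_mul _)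
      have i2 : Integrable (fun ω : S2 => ρ * (2 * g (x₀ + ρ • (ω : E3)) *
          fderiv ℝ g (x₀ + ρ • (ω : E3)) ω)) sphereMeasure :=
        S2.continuous_integrable sphereMeasure ((((hcs ρ).const_mul 2).mul (hds ρ)).const_mul _)
      have i3 : Integrable (fun ω : S2 => 2 * ρ ^ 2 * (fderiv ℝ g (x₀ + ρ • (ω : E3)) ω) ^ 2)
          sphereMeasure :=
        S2.continuous_integrable sphereMeasure (((hds ρ).pow 2).const_mul _)
      have : 2⁻¹ * A ρ + ρ * B ρ + 2 * ρ ^ 2 * D ρ = ∫ ω : S2,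
          (2⁻¹ * g (x₀ + ρ • (ω : E3)) ^ 2 +
          ρ * (2 * g (x₀ + ρ • (ω : E3)) * fderiv ℝ g (x₀ + ρ • (ω : E3)) ω)
          + 2 * ρ ^ 2 * (fderiv ℝ g (x₀ + ρ • (ω : E3)) ω) ^ 2) ∂sphereMeasure := by
        have i12 : Integrable (fun ω : S2 => 2⁻¹ * g (x₀ + ρ • (ω : E3)) ^ 2 +
            ρ * (2 * g (x₀ + ρ • (ω : E3)) * fderiv ℝ g (x₀ + ρ • (ω : E3)) ω)) sphereMeasure :=
          i1.add i2
        rw [integral_add i12 i3, integral_add i1 i2]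
        simp only [integral_const_mul, A, B, D]
      rw [this]
      refine integral_nonneg fun ω => ?_
      have := sq_nonneg (g (x₀ + ρ • (ω : E3)) + 2 * ρ * fderiv ℝ g (x₀ + ρ • (ω : E3)) ω)
      simp only [Pi.zero_apply]
      nlinarith
    have h2 := mul_nonneg (w0 ρ) h1
    have h3 := mul_nonneg (mul_nonneg hρ.1 (w1n ρ hρ.1)) hA0
    nlinarith
  have j1 : IntervalIntegrable (fun ρ => 2⁻¹ * (w ρ * A ρ)) volume 0 R :=
    Continuous.intervalIntegrable (by fun_prop) _ _
  have j2 : IntervalIntegrable (fun ρ => 2 * (ρ ^ 2 * (w ρ * D ρ))) volume 0 R :=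
    Continuous.intervalIntegrable (by fun_prop) _ _
  have j3 : IntervalIntegrable (fun ρ => 2⁻¹ * (w ρ * A ρ) - 2 * (ρ ^ 2 * (w ρ * D ρ)))
    volume 0 R := j1.sub j2
  have j4 : IntervalIntegrable (fun ρ => 1 * (w ρ * A ρ) + ρ * (w1 ρ * A ρ + w ρ * B ρ))
    volume 0 R := Continuous.intervalIntegrable (by fun_prop) _ _
  have hmono := intervalIntegral.integral_mono_on hR j3 j4 hpt
  rw [hint, intervalIntegral.integral_sub j1 j2, intervalIntegral.integral_const_mul,
    intervalIntegral.integral_const_mul] at hmono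
  simp only [A, D] at hmono ⊢
  linarith

/-- Weighted Hardy inequality about an arbitrary centre. -/
theorem hardy (hg : ContDiff ℝ 1 g) (hw : ∀ ρ, HasDerivAt w (w1 ρ) ρ) (hw1 : Continuous w1)
    (w0 : ∀ ρ, 0 ≤ w ρ) (w1n : ∀ ρ, 0 ≤ ρ → 0 ≤ w1 ρ) (x₀ : E3)
    (hinf : ∀ ε > 0, ∀ N₀ : ℝ, ∃ R ≥ N₀,
      R * (w R * ∫ ω : S2, g (x₀ + R • (ω : E3)) ^ 2 ∂sphereMeasure) ≤ ε) :
    ∫⁻ x, ENNReal.ofReal (w ‖x - x₀‖ * (g x ^ 2 / ‖x - x₀‖ ^ 2)) ≤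
      4 * ∫⁻ x, ENNReal.ofReal (w ‖x - x₀‖ * ‖fderiv ℝ g x‖ ^ 2) := by
  have hc : Continuous fun q : ℝ × S2 => g (x₀ + q.1 • (q.2 : E3)) :=
    hg.continuous.comp (by fun_prop)
  have hd : Continuous fun q : ℝ × S2 => fderiv ℝ g (x₀ + q.1 • (q.2 : E3)) (q.2 : E3) :=
    ((hg.continuous_fderiv one_ne_zero).comp (by fun_prop)).clm_apply (by fun_prop)
  have hcs : ∀ ρ : ℝ, Continuous fun ω : S2 => g (x₀ + ρ • (ω : E3)) := fun ρ =>
    hc.comp (by fun_prop : Continuous fun ω : S2 => (ρ, ω))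
  have hds : ∀ ρ : ℝ, Continuous fun ω : S2 => fderiv ℝ g (x₀ + ρ • (ω : E3)) (ω : E3) := fun ρ =>
    hd.comp (by fun_prop : Continuous fun ω : S2 => (ρ, ω))
  have cw : Continuous w := (contDiff_one_of_hasDerivAt hw hw1).continuous
  have cg := hg.continuous
  have cdg := hg.continuous_fderiv one_ne_zero
  have nrm : ∀ (ρ : ℝ) (ω : S2), 0 < ρ → ‖x₀ + ρ • (ω : E3) - x₀‖ = ρ := fun ρ ω h => by
    rw [add_sub_cancel_left, norm_smul, S2.norm_coe, mul_one, Real.norm_eq_abs, abs_of_pos h]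
  let A : ℝ → ℝ := fun ρ => ∫ ω : S2, g (x₀ + ρ • (ω : E3)) ^ 2 ∂sphereMeasure
  let D : ℝ → ℝ := fun ρ => ∫ ω : S2, (fderiv ℝ g (x₀ + ρ • (ω : E3)) ω) ^ 2 ∂sphereMeasure
  have cA : Continuous A := continuous_integral_compact sphereMeasure (Y := ℝ)
    (F := fun ρ (ω : S2) => g (x₀ + ρ • (ω : E3)) ^ 2) (by fun_prop)
  have cD : Continuous D := continuous_integral_compact sphereMeasure (Y := ℝ)
    (F := fun ρ (ω : S2) => (fderiv ℝ g (x₀ + ρ • (ω : E3)) ω) ^ 2) (by fun_prop)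
  have A0 : ∀ ρ, 0 ≤ A ρ := fun ρ => integral_nonneg fun ω => sq_nonneg _
  have D0 : ∀ ρ, 0 ≤ D ρ := fun ρ => integral_nonneg fun ω => sq_nonneg _
  have hL : ∫⁻ x, ENNReal.ofReal (w ‖x - x₀‖ * (g x ^ 2 / ‖x - x₀‖ ^ 2)) =
      ∫⁻ ρ in Set.Ioi 0, ENNReal.ofReal (w ρ * A ρ) := by
    rw [lintegral_polar (x₀ := x₀)]
    · refine setLIntegral_congr_fun measurableSet_Ioi fun ρ hρ => ?_
      have hρ' : (0 : ℝ) < ρ := hρ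
      simp only [nrm ρ _ hρ']
      have i1 : Integrable (fun ω : S2 => w ρ * g (x₀ + ρ • (ω : E3)) ^ 2) sphereMeasure :=
        S2.continuous_integrable sphereMeasure (((hcs ρ).pow 2).const_mul _)
      rw [← lintegral_const_mul' _ _ ENNReal.ofReal_ne_top, ← integral_const_mul,
        ofReal_integral_eq_lintegral_ofReal i1
          (Filter.Eventually.of_forall fun ω => mul_nonneg (w0 ρ) (sq_nonneg _))]
      refine lintegral_congr fun ω => ?_
      rw [← ENNReal.ofReal_mul (sq_nonneg _)]
      congr 1
      field_simp
    · have h1 : Continuous fun x : E3 => w ‖x - x₀‖ := by fun_prop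
      have h2 : Continuous fun x : E3 => ‖x - x₀‖ ^ 2 := by fun_prop
      exact (h1.measurable.mul ((cg.pow 2).measurable.div h2.measurable)).ennreal_ofReal
  have hRt : ∫⁻ ρ in Set.Ioi 0, ENNReal.ofReal (ρ ^ 2 * (w ρ * D ρ)) ≤
      ∫⁻ x, ENNReal.ofReal (w ‖x - x₀‖ * ‖fderiv ℝ g x‖ ^ 2) := by
    rw [lintegral_polar (x₀ := x₀)]
    · refine setLIntegral_mono' measurableSet_Ioi fun ρ hρ => ?_
      have hρ' : (0 : ℝ) < ρ := hρ
      simp only [nrm ρ _ hρ']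
      rw [ENNReal.ofReal_mul (sq_nonneg _), ← integral_const_mul]
      gcongr
      refine (ofReal_integral_le_lintegral _ _).trans (lintegral_mono fun ω =>
        ENNReal.ofReal_le_ofReal ?_)
      refine mul_le_mul_of_nonneg_left ?_ (w0 ρ)
      rw [← sq_abs]
      gcongr
      simpa using (fderiv ℝ g (x₀ + ρ • (ω : E3))).le_opNorm (ω : E3)
    · have h1 : Continuous fun x : E3 => w ‖x - x₀‖ * ‖fderiv ℝ g x‖ ^ 2 := by fun_prop
      exact h1.measurable.ennreal_ofReal
  rw [hL]
  refine le_trans ?_ (mul_le_mul_right hRt 4)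
  have hM : ∀ M : ℝ, 0 ≤ M → ∫⁻ ρ in Set.Ioc 0 M, ENNReal.ofReal (w ρ * A ρ) ≤
      4 * ∫⁻ ρ in Set.Ioi 0, ENNReal.ofReal (ρ ^ 2 * (w ρ * D ρ)) := by
    intro M hM
    refine ENNReal.le_of_forall_pos_le_add fun ε hε _ => ?_
    obtain ⟨R, hRM, hR⟩ := hinf (ε / 2) (by positivity) M
    have hR0 : 0 ≤ R := hM.trans hRM
    have conv : ∀ F : ℝ → ℝ, Continuous F → (∀ ρ, 0 ≤ F ρ) →
        ENNReal.ofReal (∫ ρ in (0 : ℝ)..R, F ρ) = ∫⁻ ρ in Set.Ioc 0 R, ENNReal.ofReal (F ρ) := by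
      intro F hF hF0
      rw [intervalIntegral.integral_of_le hR0, ofReal_integral_eq_lintegral_ofReal
        (hF.integrableOn_Ioc) (Filter.Eventually.of_forall hF0)]
    calc _ ≤ ∫⁻ ρ in Set.Ioc 0 R, ENNReal.ofReal (w ρ * A ρ) :=
          lintegral_mono_set (Set.Ioc_subset_Ioc_right hRM)
      _ = ENNReal.ofReal (∫ ρ in (0 : ℝ)..R, w ρ * A ρ) :=
          (conv _ (by fun_prop) fun ρ => mul_nonneg (w0 ρ) (A0 ρ)).symm
      _ ≤ ENNReal.ofReal (ε + 4 * ∫ ρ in (0 : ℝ)..R, ρ ^ 2 * (w ρ * D ρ)) := by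
          refine ENNReal.ofReal_le_ofReal ?_
          have := hardy_interval hg hw hw1 w0 w1n x₀ hR0
          simp only [A, D]
          linarith
      _ ≤ ENNReal.ofReal ε + ENNReal.ofReal 4 *
            ENNReal.ofReal (∫ ρ in (0 : ℝ)..R, ρ ^ 2 * (w ρ * D ρ)) := by
          rw [← ENNReal.ofReal_mul (by norm_num)]; exact ENNReal.ofReal_add_le
      _ ≤ _ := by
          rw [conv _ (by fun_prop) fun ρ => mul_nonneg (sq_nonneg _) (mul_nonneg (w0 ρ) (D0 ρ)),
            add_comm, ENNReal.ofReal_coe_nnreal]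
          gcongr
          · norm_num
          · exact Set.Ioc_subset_Ioi_self
  have hU : (⋃ n : ℕ, Set.Ioc (0 : ℝ) n) = Set.Ioi 0 := by
    ext x
    simp only [Set.mem_iUnion, Set.mem_Ioc, Set.mem_Ioi]
    exact ⟨fun ⟨_, h, _⟩ => h, fun h => ⟨⌈x⌉₊, h, Nat.le_ceil x⟩⟩
  have hmono : Monotone fun n : ℕ => Set.Ioc (0 : ℝ) n := fun a b hab =>
    Set.Ioc_subset_Ioc_right (by exact_mod_cast hab)
  rw [← hU, setLIntegral_iUnion_of_directed _ hmono.directed_le, hU]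
  exact iSup_le fun n => hM n (Nat.cast_nonneg n)

end

section
variable {p γ : ℝ} {f : E3 → ℝ}

lemma sq_le_rpow_add {p N : ℝ} (hp : 1 < p) (hN : 0 < N) (y : ℝ) :
    y ^ 2 ≤ N ^ 2 * |y| ^ (p + 1) + N ^ (-(4 / (p - 1))) := by
  have h0 : 0 ≤ |y| ^ (p + 1) := rpow_nonneg (abs_nonneg _) _
  have h1 : 0 ≤ N ^ (-(4 / (p - 1))) := rpow_nonneg hN.le _
  have e : |y| ^ (p + 1) = |y| ^ (p - 1) * y ^ 2 := by
    rw [← sq_abs y, ← rpow_add_natCast' (abs_nonneg y) (by push_cast; linarith)]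
    congr 1; push_cast; ring
  by_cases h : 1 ≤ N ^ 2 * |y| ^ (p - 1)
  · have := mul_le_mul_of_nonneg_right h (sq_nonneg y)
    rw [e]; nlinarith
  · push Not at h
    have hy : |y| ^ (p - 1) ≤ N ^ (-2 : ℝ) := by
      rw [rpow_neg hN.le, rpow_two, ← one_div, le_div_iff₀ (by positivity), mul_comm]; exact h.le
    have h2 := rpow_le_rpow (rpow_nonneg (abs_nonneg y) _) hy
      (show 0 ≤ 2 / (p - 1) from div_nonneg (by norm_num) (by linarith))
    rw [← rpow_mul (abs_nonneg _), ← rpow_mul hN.le,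
      show (p - 1) * (2 / (p - 1)) = 2 from mul_div_cancel₀ _ (by linarith),
      show (-2 : ℝ) * (2 / (p - 1)) = -(4 / (p - 1)) by ring, rpow_two, sq_abs] at h2
    nlinarith [mul_nonneg (sq_nonneg N) h0]

lemma exists_radius_small (hp : 1 < p) (hγ : 0 < γ) (hγp : γ * (p - 1) < 5 - p)
    (hf : Continuous f)
    (hF : ∫⁻ x, ENNReal.ofReal ((1 + ‖x‖) ^ γ * |f x| ^ (p + 1)) < ⊤) (x₀ : E3)
    {ε : ℝ} (hε : 0 < ε) (N₀ : ℝ) :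
    ∃ R ≥ N₀, R * ∫ ω : S2, (1 + ‖x₀ + R • (ω : E3)‖) ^ γ * f (x₀ + R • (ω : E3)) ^ 2
      ∂sphereMeasure ≤ ε := by
  by_contra! hcon
  let c : ℝ := sphereMeasure.real (Set.univ : Set S2)
  have hcont : Continuous fun x : E3 => (1 + ‖x‖) ^ γ * |f x| ^ (p + 1) :=
    ((continuous_const.add continuous_norm).rpow_const fun _ => Or.inr hγ.le).mul
      (hf.abs.rpow_const fun _ => Or.inr (by linarith))
  have hm : Measurable fun x : E3 => ENNReal.ofReal ((1 + ‖x‖) ^ γ * |f x| ^ (p + 1)) :=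
    hcont.measurable.ennreal_ofReal
  let h : ℝ → ℝ≥0∞ := fun ρ => ENNReal.ofReal (ρ ^ 2) * ∫⁻ ω : S2,
    ENNReal.ofReal ((1 + ‖x₀ + ρ • (ω : E3)‖) ^ γ * |f (x₀ + ρ • (ω : E3))| ^ (p + 1)) ∂sphereMeasure
  have hmh : Measurable h := (by fun_prop : Measurable fun ρ : ℝ => ENNReal.ofReal (ρ ^ 2)).mul
    (measurable_sphere_lintegral hm x₀)
  have hfin : ∫⁻ ρ in Set.Ioi (0 : ℝ), h ρ ≠ ⊤ := by
    have := lintegral_polar _ hm x₀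
    rw [this] at hF
    exact hF.ne
  have htail : Filter.Tendsto (fun n : ℕ => ∫⁻ ρ in Set.Ioi (0 : ℝ),
      (Set.Ioc (n : ℝ) (2 * n)).indicator h ρ) Filter.atTop (nhds 0) := by
    have : (0 : ℝ≥0∞) = ∫⁻ ρ in Set.Ioi (0 : ℝ), (fun _ => 0) ρ := by simp
    rw [this]
    refine tendsto_lintegral_of_dominated_convergence h
      (fun n => hmh.indicator measurableSet_Ioc)
      (fun n => Filter.Eventually.of_forall fun ρ => Set.indicator_le_self _ _ _) hfin
      (Filter.Eventually.of_forall fun ρ => ?_)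
    refine tendsto_const_nhds.congr' ?_
    filter_upwards [Filter.eventually_ge_atTop ⌈ρ⌉₊] with n hn
    rw [Set.indicator_of_notMem]
    simp only [Set.mem_Ioc, not_and_or, not_lt]
    exact Or.inl ((Nat.le_ceil ρ).trans (by exact_mod_cast hn))
  have hexp : Filter.Tendsto (fun n : ℕ => ENNReal.ofReal
      (2 * 4 ^ γ * c * (n : ℝ) ^ (-(4 / (p - 1) - 1 - γ)))) Filter.atTop (nhds 0) := by
    have hpos : 0 < 4 / (p - 1) - 1 - γ := by
      have : 1 + γ < 4 / (p - 1) := by rw [lt_div_iff₀ (by linarith)]; nlinarith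
      linarith
    have h1 := ((tendsto_rpow_neg_atTop hpos).comp tendsto_natCast_atTop_atTop).const_mul
      (2 * 4 ^ γ * c)
    have := (ENNReal.continuous_ofReal.tendsto _).comp h1
    simpa [Function.comp_def] using this
  have hlim := htail.add hexp
  have key : ∀ᶠ n : ℕ in Filter.atTop, ENNReal.ofReal ε ≤
      (∫⁻ ρ in Set.Ioi (0 : ℝ), (Set.Ioc (n : ℝ) (2 * n)).indicator h ρ) +
      ENNReal.ofReal (2 * 4 ^ γ * c * (n : ℝ) ^ (-(4 / (p - 1) - 1 - γ))) := by
    filter_upwards [Filter.eventually_ge_atTop ⌈N₀⌉₊, Filter.eventually_ge_atTop ⌈‖x₀‖⌉₊,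
      Filter.eventually_ge_atTop 1] with n hn1 hn2 hn3
    have a1 : N₀ ≤ n := (Nat.le_ceil _).trans (by exact_mod_cast hn1)
    have a2 : ‖x₀‖ ≤ n := (Nat.le_ceil _).trans (by exact_mod_cast hn2)
    have a3 : (1 : ℝ) ≤ n := by exact_mod_cast hn3
    generalize (n : ℝ) = N at *
    have hN0 : 0 < N := by linarith
    let K : ℝ := 2 * N * (N ^ (-(4 / (p - 1))) * (4 * N) ^ γ)
    have hK0 : 0 ≤ K := by positivity
    have hKe : K * c = 2 * 4 ^ γ * c * N ^ (-(4 / (p - 1) - 1 - γ)) := by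
      simp only [K]
      rw [mul_rpow (by norm_num) hN0.le, show -(4 / (p - 1) - 1 - γ) = -(4 / (p - 1)) + γ + 1 by ring,
        rpow_add_one hN0.ne', rpow_add hN0]
      ring
    have hpt : ∀ ρ ∈ Set.Ioc N (2 * N), ENNReal.ofReal ε ≤
        ENNReal.ofReal N * h ρ + ENNReal.ofReal (K * c) := by
      intro ρ hρ
      have hρ0 : 0 < ρ := hN0.trans hρ.1
      refine (ENNReal.ofReal_le_ofReal (hcon ρ (a1.trans hρ.1.le)).le).trans ?_
      rw [← integral_const_mul]
      refine (ofReal_integral_le_lintegral _ _).trans ?_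
      calc _ ≤ ∫⁻ ω : S2, (ENNReal.ofReal (N * ρ ^ 2) * ENNReal.ofReal
              ((1 + ‖x₀ + ρ • (ω : E3)‖) ^ γ * |f (x₀ + ρ • (ω : E3))| ^ (p + 1))
              + ENNReal.ofReal K) ∂sphereMeasure := by
            refine lintegral_mono fun ω => ?_
            rw [← ENNReal.ofReal_mul (by positivity), ← ENNReal.ofReal_add (by positivity) hK0]
            refine ENNReal.ofReal_le_ofReal ?_
            have b1 := sq_le_rpow_add hp hN0 (f (x₀ + ρ • (ω : E3)))
            have b2 : ‖x₀ + ρ • (ω : E3)‖ ≤ ‖x₀‖ + ρ := by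
              refine (norm_add_le _ _).trans ?_
              rw [norm_smul, S2.norm_coe, mul_one, Real.norm_eq_abs, abs_of_pos hρ0]
            have b3 : (1 + ‖x₀ + ρ • (ω : E3)‖) ^ γ ≤ (4 * N) ^ γ :=
              rpow_le_rpow (by positivity) (by linarith [hρ.2]) hγ.le
            have b4 : 0 ≤ (1 + ‖x₀ + ρ • (ω : E3)‖) ^ γ := by positivity
            have b5 : 0 ≤ |f (x₀ + ρ • (ω : E3))| ^ (p + 1) := by positivity
            have b6 : 0 ≤ N ^ (-(4 / (p - 1))) := by positivity
            generalize (1 + ‖x₀ + ρ • (ω : E3)‖) ^ γ = W at *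
            generalize |f (x₀ + ρ • (ω : E3))| ^ (p + 1) = Y at *
            generalize f (x₀ + ρ • (ω : E3)) ^ 2 = Z at *
            have c1 : ρ * (W * Z) ≤ ρ * (W * (N ^ 2 * Y + N ^ (-(4 / (p - 1))))) := by gcongr
            have c2 : ρ * (W * N ^ (-(4 / (p - 1)))) ≤ K := by
              have : W * N ^ (-(4 / (p - 1))) ≤ N ^ (-(4 / (p - 1))) * (4 * N) ^ γ := by
                rw [mul_comm]; gcongr
              exact mul_le_mul hρ.2 this (by positivity) (by positivity)
            have c3 : ρ * (W * (N ^ 2 * Y)) ≤ N * ρ ^ 2 * (W * Y) := by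
              have : N * ρ * (N * (W * Y)) ≤ N * ρ * (ρ * (W * Y)) := by
                gcongr; exact hρ.1.le
              linarith
            linarith
        _ = _ := by
            rw [lintegral_add_right _ measurable_const, lintegral_const_mul' _ _ ENNReal.ofReal_ne_top,
              lintegral_const, ENNReal.ofReal_mul hN0.le, mul_assoc, ENNReal.ofReal_mul hK0]
            simp [c, h]
    have hint : ∫⁻ ρ in Set.Ioc N (2 * N), ENNReal.ofReal ε ≤
        ∫⁻ ρ in Set.Ioc N (2 * N), (ENNReal.ofReal N * h ρ + ENNReal.ofReal (K * c)) :=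
      setLIntegral_mono' measurableSet_Ioc hpt
    have hvol : volume (Set.Ioc N (2 * N)) = ENNReal.ofReal N := by
      rw [Real.volume_Ioc]; congr 1; ring
    rw [lintegral_add_right _ measurable_const, lintegral_const_mul' _ _ ENNReal.ofReal_ne_top,
      setLIntegral_const, setLIntegral_const, hvol] at hint
    rw [setLIntegral_indicator measurableSet_Ioc, Set.inter_eq_left.2
      (show Set.Ioc N (2 * N) ⊆ Set.Ioi 0 from fun ρ hρ => hN0.trans hρ.1)]
    have hN' : ENNReal.ofReal N ≠ 0 := by simpa using hN0
    rw [← ENNReal.mul_le_mul_iff_right hN' ENNReal.ofReal_ne_top]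
    refine le_trans (le_of_eq (mul_comm _ _)) (hint.trans (le_of_eq ?_))
    rw [hKe]; ring
  have := ge_of_tendsto hlim key
  simp at this
  linarith

end

section
variable {p γ : ℝ} {f : E3 → ℝ}

/-- Regularized radial weight. -/
def jw (a r : ℝ) : ℝ := (1 + r ^ 2) ^ a

lemma jw_nonneg (a r : ℝ) : 0 ≤ jw a r := rpow_nonneg (by positivity) _

lemma jw_le {a r : ℝ} (ha : 0 ≤ a) (hr : 0 ≤ r) : jw a r ≤ (1 + r) ^ (2 * a) := by
  rw [rpow_mul (by linarith), rpow_two]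
  exact rpow_le_rpow (by positivity) (by nlinarith) ha

lemma le_jw {a r : ℝ} (ha : 0 ≤ a) (ha1 : a ≤ 1) (hr : 0 ≤ r) : (1 + r) ^ (2 * a) ≤ 2 * jw a r := by
  rw [rpow_mul (by linarith), rpow_two]
  have h : (1 + r) ^ 2 ≤ 2 * (1 + r ^ 2) := by nlinarith [sq_nonneg (r - 1)]
  refine (rpow_le_rpow (by positivity) h ha).trans ?_
  rw [mul_rpow (by norm_num) (by positivity)]
  refine mul_le_mul_of_nonneg_right ?_ (jw_nonneg a r)
  calc (2 : ℝ) ^ a ≤ 2 ^ (1 : ℝ) := rpow_le_rpow_of_exponent_le (by norm_num) ha1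
    _ = 2 := rpow_one 2

lemma hasDerivAt_jw (a r : ℝ) : HasDerivAt (jw a) (a * (1 + r ^ 2) ^ (a - 1) * (2 * r)) r := by
  have h1 : HasDerivAt (fun r : ℝ => 1 + r ^ 2) (2 * r) r := by
    simpa using (hasDerivAt_pow 2 r).const_add 1
  refine (h1.rpow_const (p := a) (Or.inl (by positivity))).congr_deriv ?_
  ring

lemma continuous_jw_deriv (a : ℝ) : Continuous fun r : ℝ => a * (1 + r ^ 2) ^ (a - 1) * (2 * r) := by
  have : Continuous fun r : ℝ => (1 + r ^ 2) ^ (a - 1) :=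
    (by fun_prop : Continuous fun r : ℝ => 1 + r ^ 2).rpow_const
      fun r => Or.inl (by positivity)
  fun_prop

lemma contDiff_jw_norm (a : ℝ) : ContDiff ℝ 1 fun x : E3 => jw a ‖x‖ := by
  unfold jw
  exact (contDiff_const.add (contDiff_norm_sq ℝ)).rpow_const_of_ne fun x => by positivity

lemma fderiv_jw_norm (a : ℝ) (x : E3) (v : E3) :
    fderiv ℝ (fun x : E3 => jw a ‖x‖) x v = a * (1 + ‖x‖ ^ 2) ^ (a - 1) * (2 * inner ℝ x v) := by
  have h1 : HasFDerivAt (fun x : E3 => ‖x‖ ^ 2) (2 • (innerSL ℝ x)) x :=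
    (hasStrictFDerivAt_norm_sq x).hasFDerivAt
  have h2 : HasDerivAt (fun y : ℝ => (1 + y) ^ a) (a * (1 + ‖x‖ ^ 2) ^ (a - 1)) (‖x‖ ^ 2) := by
    refine (((hasDerivAt_id (‖x‖ ^ 2)).const_add 1).rpow_const (p := a)
      (Or.inl (by simp; positivity))).congr_deriv ?_
    simp
  have h3 := h2.comp_hasFDerivAt x h1
  have h4 : (fun x : E3 => jw a ‖x‖) = (fun y : ℝ => (1 + y) ^ a) ∘ fun x : E3 => ‖x‖ ^ 2 := rfl
  rw [h4, h3.fderiv]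
  simp

lemma norm_fderiv_jw_mul (hf : ContDiff ℝ 1 f) {a : ℝ} (ha : 0 ≤ a) (ha1 : a ≤ 1 / 2) (x : E3) :
    ‖fderiv ℝ (fun x : E3 => jw a ‖x‖ * f x) x‖ ^ 2 ≤
      2 * (jw (2 * a) ‖x‖ * ‖fderiv ℝ f x‖ ^ 2) + 2 * (jw (2 * a) ‖x‖ * (f x ^ 2 / ‖x‖ ^ 2)) := by
  have hj := (contDiff_jw_norm a).differentiable (by norm_num) x
  have hf' := hf.differentiable (by norm_num) x
  have hw : jw (2 * a) ‖x‖ = jw a ‖x‖ ^ 2 := by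
    unfold jw; rw [mul_comm, rpow_mul (by positivity), rpow_two]
  have hb : ‖fderiv ℝ (fun x : E3 => jw a ‖x‖ * f x) x‖ ≤
      jw a ‖x‖ * (‖fderiv ℝ f x‖ + |f x| / ‖x‖) := by
    refine ContinuousLinearMap.opNorm_le_bound _ (mul_nonneg (jw_nonneg _ _) (by positivity))
      fun v => ?_
    have e : fderiv ℝ (fun x : E3 => jw a ‖x‖ * f x) x v =
        jw a ‖x‖ * fderiv ℝ f x v + f x * (a * (1 + ‖x‖ ^ 2) ^ (a - 1) * (2 * inner ℝ x v)) := by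
      rw [← fderiv_jw_norm, fderiv_fun_mul hj hf']; simp
    rw [e, Real.norm_eq_abs]
    have h1 : |fderiv ℝ f x v| ≤ ‖fderiv ℝ f x‖ * ‖v‖ := (fderiv ℝ f x).le_opNorm v
    have h2 : |inner ℝ x v| ≤ ‖x‖ * ‖v‖ := abs_real_inner_le_norm x v
    have h3 : |a * (1 + ‖x‖ ^ 2) ^ (a - 1) * (2 * inner ℝ x v)| ≤ jw a ‖x‖ * (‖v‖ / ‖x‖) := by
      have e1 : (1 + ‖x‖ ^ 2) ^ (a - 1) = jw a ‖x‖ * (1 + ‖x‖ ^ 2)⁻¹ := by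
        rw [jw, rpow_sub_one (by positivity), div_eq_mul_inv]
      rw [e1, abs_mul, abs_mul, abs_mul, abs_mul, abs_of_nonneg ha, abs_of_nonneg (jw_nonneg _ _),
        abs_of_nonneg (by positivity : 0 ≤ (1 + ‖x‖ ^ 2)⁻¹), abs_two]
      have h4 : (1 + ‖x‖ ^ 2)⁻¹ * (‖x‖ * ‖v‖) ≤ ‖v‖ / ‖x‖ := by
        by_cases hx : ‖x‖ = 0
        · simp [hx]
        · have : 0 < ‖x‖ := lt_of_le_of_ne (norm_nonneg _) (Ne.symm hx)
          rw [inv_mul_eq_div, div_le_div_iff₀ (by positivity) this]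
          nlinarith [norm_nonneg v]
      calc a * (jw a ‖x‖ * (1 + ‖x‖ ^ 2)⁻¹) * (2 * |inner ℝ x v|)
          = (2 * a) * (jw a ‖x‖ * ((1 + ‖x‖ ^ 2)⁻¹ * |inner ℝ x v|)) := by ring
        _ ≤ 1 * (jw a ‖x‖ * ((1 + ‖x‖ ^ 2)⁻¹ * (‖x‖ * ‖v‖))) := by
            have := jw_nonneg a ‖x‖
            gcongr
            linarith
        _ ≤ _ := by rw [one_mul]; exact mul_le_mul_of_nonneg_left h4 (jw_nonneg _ _)
    calc _ ≤ |jw a ‖x‖ * fderiv ℝ f x v|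
            + |f x * (a * (1 + ‖x‖ ^ 2) ^ (a - 1) * (2 * inner ℝ x v))| := abs_add_le _ _
      _ ≤ jw a ‖x‖ * (‖fderiv ℝ f x‖ * ‖v‖) + |f x| * (jw a ‖x‖ * (‖v‖ / ‖x‖)) := by
          rw [abs_mul, abs_mul, abs_of_nonneg (jw_nonneg a ‖x‖)]
          have := jw_nonneg a ‖x‖
          gcongr
      _ = _ := by ring
  have h0 : 0 ≤ ‖fderiv ℝ (fun x : E3 => jw a ‖x‖ * f x) x‖ := norm_nonneg _
  refine (pow_le_pow_left₀ h0 hb 2).trans ?_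
  rw [mul_pow, hw]
  have : (‖fderiv ℝ f x‖ + |f x| / ‖x‖) ^ 2 ≤ 2 * ‖fderiv ℝ f x‖ ^ 2 + 2 * (f x ^ 2 / ‖x‖ ^ 2) := by
    rw [← sq_abs (f x), ← div_pow]
    nlinarith [sq_nonneg (‖fderiv ℝ f x‖ - |f x| / ‖x‖)]
  have := mul_le_mul_of_nonneg_left this (sq_nonneg (jw a ‖x‖))
  linarith

/-- Weighted Hardy inequality about an arbitrary centre, with weight centred at the origin. -/
theorem hardy_weighted (hp : 1 < p) (hγ : 0 < γ) (hγ2 : γ ≤ 2) (hγp : γ * (p - 1) < 5 - p)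
    (hf : ContDiff ℝ 1 f)
    (hF : ∫⁻ x, ENNReal.ofReal ((1 + ‖x‖) ^ γ * |f x| ^ (p + 1)) < ⊤) (x₀ : E3) :
    ∫⁻ x, ENNReal.ofReal ((1 + ‖x‖) ^ γ * (f x ^ 2 / ‖x - x₀‖ ^ 2)) ≤
      80 * ∫⁻ x, ENNReal.ofReal ((1 + ‖x‖) ^ γ * ‖fderiv ℝ f x‖ ^ 2) := by
  have e2 : 2 * (γ / 2) = γ := by ring
  have cf := hf.continuous
  have cdf := hf.continuous_fderiv one_ne_zero
  have cw : Continuous fun x : E3 => (1 + ‖x‖) ^ γ :=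
    (continuous_const.add continuous_norm).rpow_const fun _ => Or.inr hγ.le
  have sph : ∀ (x₀ : E3) (R : ℝ) (h : E3 → ℝ), Continuous h → (∀ x, 0 ≤ h x) →
      (∀ x, h x ≤ (1 + ‖x‖) ^ γ * f x ^ 2) → ∫ ω : S2, h (x₀ + R • (ω : E3)) ∂sphereMeasure ≤
      ∫ ω : S2, (1 + ‖x₀ + R • (ω : E3)‖) ^ γ * f (x₀ + R • (ω : E3)) ^ 2 ∂sphereMeasure := by
    intro x₀ R h hc h0 hle
    have hk : Continuous fun ω : S2 => x₀ + R • (ω : E3) := by fun_prop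
    refine integral_mono (S2.continuous_integrable sphereMeasure (hc.comp hk))
      (S2.continuous_integrable sphereMeasure ((cw.comp hk).mul ((cf.comp hk).pow 2)))
      fun ω => hle _
  have D1 : ∫⁻ x, ENNReal.ofReal (jw (γ / 2) ‖x‖ * ‖fderiv ℝ f x‖ ^ 2) ≤
      ∫⁻ x, ENNReal.ofReal ((1 + ‖x‖) ^ γ * ‖fderiv ℝ f x‖ ^ 2) :=
    lintegral_mono fun x => ENNReal.ofReal_le_ofReal <| mul_le_mul_of_nonneg_right
      (by simpa [e2] using jw_le (show 0 ≤ γ / 2 by linarith) (norm_nonneg x)) (sq_nonneg _)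
  have jle : ∀ x : E3, jw (γ / 2) ‖x‖ ≤ (1 + ‖x‖) ^ γ := fun x => by
    simpa [e2] using jw_le (show 0 ≤ γ / 2 by linarith) (norm_nonneg x)
  have H1 : ∫⁻ x, ENNReal.ofReal (jw (γ / 2) ‖x‖ * (f x ^ 2 / ‖x‖ ^ 2)) ≤
      4 * ∫⁻ x, ENNReal.ofReal (jw (γ / 2) ‖x‖ * ‖fderiv ℝ f x‖ ^ 2) := by
    have := hardy hf (hasDerivAt_jw (γ / 2)) (continuous_jw_deriv _) (jw_nonneg _)
      (fun ρ hρ => mul_nonneg (mul_nonneg (by linarith) (rpow_nonneg (by positivity) _))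
        (by linarith)) 0 ?_
    · simpa using this
    · intro ε hε N₀
      obtain ⟨R, hR, hle⟩ := exists_radius_small hp hγ hγp cf hF 0 hε (max N₀ 0)
      have hR0 : 0 ≤ R := (le_max_right _ _).trans hR
      refine ⟨R, (le_max_left _ _).trans hR, le_trans ?_ hle⟩
      refine mul_le_mul_of_nonneg_left ?_ hR0
      have := sph 0 R (fun x => jw (γ / 2) ‖x‖ * f x ^ 2)
        ((contDiff_jw_norm _).continuous.mul (cf.pow 2))
        (fun x => mul_nonneg (jw_nonneg _ _) (sq_nonneg _))
        (fun x => mul_le_mul_of_nonneg_right (jle x) (sq_nonneg _))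
      refine le_trans (le_of_eq ?_) this
      rw [← integral_const_mul]
      congr 1
      ext ω
      simp [norm_smul, abs_of_nonneg hR0]
  have hg : ContDiff ℝ 1 fun x => jw (γ / 4) ‖x‖ * f x := (contDiff_jw_norm _).mul hf
  have hsq : ∀ x : E3, (jw (γ / 4) ‖x‖ * f x) ^ 2 = jw (γ / 2) ‖x‖ * f x ^ 2 := fun x => by
    have : jw (γ / 4) ‖x‖ ^ 2 = jw (γ / 2) ‖x‖ := by
      unfold jw; rw [← rpow_two, ← rpow_mul (by positivity)]; congr 1; ring
    rw [mul_pow, this]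
  have H2 := hardy hg (w := fun _ => 1) (w1 := fun _ => 0) (fun ρ => hasDerivAt_const ρ 1)
    continuous_const (fun _ => zero_le_one) (fun _ _ => le_rfl) x₀ ?_
  · simp only [one_mul, hsq] at H2
    have e4 : 2 * (γ / 4) = γ / 2 := by ring
    have m1 : Measurable fun x : E3 => ENNReal.ofReal (jw (γ / 2) ‖x‖ * ‖fderiv ℝ f x‖ ^ 2) := by
      have := (contDiff_jw_norm (γ / 2)).continuous
      exact (by fun_prop : Continuous fun x : E3 => jw (γ / 2) ‖x‖ * ‖fderiv ℝ f x‖ ^ 2).measurable.ennreal_ofReal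
    have two : ∀ y : ℝ, 2 * ENNReal.ofReal y = ENNReal.ofReal (2 * y) := fun y => by
      rw [ENNReal.ofReal_mul (by norm_num), ENNReal.ofReal_ofNat]
    set D := ∫⁻ x, ENNReal.ofReal ((1 + ‖x‖) ^ γ * ‖fderiv ℝ f x‖ ^ 2) with hD
    calc _ ≤ ∫⁻ x, 2 * ENNReal.ofReal (jw (γ / 2) ‖x‖ * f x ^ 2 / ‖x - x₀‖ ^ 2) := by
          refine lintegral_mono fun x => ?_
          rw [two]
          refine ENNReal.ofReal_le_ofReal ?_
          have := le_jw (show 0 ≤ γ / 2 by linarith) (by linarith) (norm_nonneg x)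
          rw [e2] at this
          have := mul_le_mul_of_nonneg_right this (by positivity : 0 ≤ f x ^ 2 / ‖x - x₀‖ ^ 2)
          rw [mul_div_assoc]; linarith
      _ ≤ 2 * (4 * ∫⁻ x, ENNReal.ofReal (‖fderiv ℝ (fun x => jw (γ / 4) ‖x‖ * f x) x‖ ^ 2)) := by
          rw [lintegral_const_mul' _ _ (by norm_num)]
          gcongr
      _ ≤ 2 * (4 * ∫⁻ x, (2 * ENNReal.ofReal (jw (γ / 2) ‖x‖ * ‖fderiv ℝ f x‖ ^ 2)
            + 2 * ENNReal.ofReal (jw (γ / 2) ‖x‖ * (f x ^ 2 / ‖x‖ ^ 2)))) := by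
          gcongr with x
          have := norm_fderiv_jw_mul hf (show 0 ≤ γ / 4 by linarith) (by linarith) x
          rw [e4] at this
          have j0 := jw_nonneg (γ / 2) ‖x‖
          rw [two, two, ← ENNReal.ofReal_add (by positivity) (by positivity)]
          exact ENNReal.ofReal_le_ofReal this
      _ ≤ 2 * (4 * (2 * D + 2 * (4 * D))) := by
          rw [lintegral_add_left (m1.const_mul _), lintegral_const_mul' _ _ (by norm_num),
            lintegral_const_mul' _ _ (by norm_num)]
          gcongr
          exact H1.trans (by gcongr)
      _ = 80 * D := by ring
  · intro ε hε N₀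
    obtain ⟨R, hR, hle⟩ := exists_radius_small hp hγ hγp cf hF x₀ hε (max N₀ 0)
    have hR0 : 0 ≤ R := (le_max_right _ _).trans hR
    refine ⟨R, (le_max_left _ _).trans hR, le_trans ?_ hle⟩
    refine mul_le_mul_of_nonneg_left ?_ hR0
    rw [one_mul]
    refine sph x₀ R (fun x => (jw (γ / 4) ‖x‖ * f x) ^ 2) (hg.continuous.pow 2)
      (fun x => sq_nonneg _) (fun x => ?_)
    rw [hsq]
    exact mul_le_mul_of_nonneg_right (jle x) (sq_nonneg _)

end

section
variable {γ r r₀ s T z τ : ℝ}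

lemma rpow_le_four_mul {γ a b : ℝ} (hγ : 0 ≤ γ) (hγ2 : γ ≤ 2) (ha : 0 ≤ a) (h : a ≤ 2 * b) :
    a ^ γ ≤ 4 * b ^ γ := by
  have hb : 0 ≤ b := by linarith
  calc a ^ γ ≤ (2 * b) ^ γ := rpow_le_rpow ha h hγ
    _ = 2 ^ γ * b ^ γ := mul_rpow (by norm_num) hb
    _ ≤ 4 * b ^ γ := by
        gcongr
        calc (2 : ℝ) ^ γ ≤ 2 ^ (2 : ℝ) := rpow_le_rpow_of_exponent_le (by norm_num) hγ2
          _ = 4 := by norm_num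

lemma cone_weight_incoming (hγ : 1 ≤ γ) (hγ2 : γ ≤ 2) (hr : 0 < r) (h₀ : 0 ≤ r₀) (hs : 0 < s)
    (hsT : s ≤ T) (hz1 : -1 ≤ z) (hr2 : r ^ 2 = r₀ ^ 2 + s ^ 2 + 2 * r₀ * s * z)
    (hτ : r * τ = r₀ * z + s) (hτ1 : -1 ≤ τ) (hτ2 : τ ≤ 1) :
    (1 + |T - r₀|) ^ γ ≤ 4 * ((1 + (T - s + r)) ^ γ * (1 + τ)
      + (1 + |T - s - r|) ^ γ * (1 - τ)) := by
  have t1 : r₀ ≤ r + s := by nlinarith [mul_nonneg h₀ hs.le]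
  have t2 : s ≤ r + r₀ := by nlinarith [mul_nonneg h₀ hs.le]
  have hv0 : 0 ≤ T - s + r := by linarith
  have huv : |T - s - r| ≤ T - s + r := abs_le.2 ⟨by linarith, by linarith⟩
  -- a common lower bound `b` for both phases
  have both : ∀ b : ℝ, 0 ≤ b → b ≤ 1 + |T - s - r| →
      2 * b ^ γ ≤ (1 + (T - s + r)) ^ γ * (1 + τ) + (1 + |T - s - r|) ^ γ * (1 - τ) := by
    intro b hb hbu
    have e1 := rpow_le_rpow hb hbu (by linarith : 0 ≤ γ)
    have e2 := rpow_le_rpow hb (hbu.trans (by linarith : _ ≤ 1 + (T - s + r))) (by linarith : 0 ≤ γ)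
    have := mul_le_mul_of_nonneg_right e2 (by linarith : 0 ≤ 1 + τ)
    have := mul_le_mul_of_nonneg_right e1 (by linarith : 0 ≤ 1 - τ)
    linarith
  rcases le_total (T - r₀) 0 with hU | hU
  · have hu : |T - r₀| ≤ |T - s - r| := by
      rw [abs_of_nonpos hU, abs_of_nonpos (by linarith)]; linarith
    have := both (1 + |T - r₀|) (by positivity) (by linarith)
    have : 0 ≤ (1 + |T - r₀|) ^ γ := by positivity
    linarith
  · rw [abs_of_nonneg hU]
    set U := T - r₀ with hUdef
    by_cases hU1 : U < 1
    · have := both 1 zero_le_one (by linarith [abs_nonneg (T - s - r)])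
      have h4 := rpow_le_four_mul (show 0 ≤ γ by linarith) hγ2 (by linarith)
        (show 1 + U ≤ 2 * 1 by linarith)
      rw [one_rpow] at this h4
      linarith
    · push Not at hU1
      by_cases hy : r + s - r₀ ≤ U / 2
      · have hu : U / 2 ≤ |T - s - r| := by
          rw [abs_of_nonneg (by linarith)]; linarith
        have := both (1 + U / 2) (by linarith) (by linarith)
        have h4 := rpow_le_four_mul (show 0 ≤ γ by linarith) hγ2 (by linarith)
          (show 1 + U ≤ 2 * (1 + U / 2) by linarith)
        have : 0 ≤ (1 + U / 2) ^ γ := by positivity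
        linarith
      · push Not at hy
        have hτy : U / 2 ≤ r * (1 + τ) := by nlinarith
        have h2 : 0 ≤ (1 + |T - s - r|) ^ γ * (1 - τ) :=
          mul_nonneg (by positivity) (by linarith)
        suffices h : (1 + U) ^ γ ≤ 4 * ((1 + (T - s + r)) ^ γ * (1 + τ)) by linarith
        have hvU : U ≤ T - s + r := by linarith
        by_cases hrU : r ≤ U
        · have hτh : 1 / 2 ≤ 1 + τ := by
            by_contra hlt
            push Not at hlt
            nlinarith
          have e1 := rpow_le_rpow (by linarith) (show 1 + U ≤ 1 + (T - s + r) by linarith)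
            (show 0 ≤ γ by linarith)
          have : 0 ≤ (1 + (T - s + r)) ^ γ := by positivity
          nlinarith
        · push Not at hrU
          have e0 : ∀ y : ℝ, 0 < y → y ^ γ = y * y ^ (γ - 1) := fun y hy => by
            rw [← rpow_one_add' hy.le (by linarith)]; congr 1; ring
          have e1 := rpow_le_rpow (by linarith) (show 1 + U ≤ 1 + r by linarith)
            (show 0 ≤ γ - 1 by linarith)
          have e2 := rpow_le_rpow (by linarith) (show 1 + r ≤ 1 + (T - s + r) by linarith)
            (show 0 ≤ γ by linarith)
          have p1 : 0 ≤ (1 + r) ^ (γ - 1) := by positivity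
          have p2 : 0 ≤ (1 + U) ^ (γ - 1) := by positivity
          calc (1 + U) ^ γ = (1 + U) * (1 + U) ^ (γ - 1) := e0 _ (by linarith)
            _ ≤ (4 * (r * (1 + τ))) * (1 + r) ^ (γ - 1) := by
                apply mul_le_mul _ e1 p2 (by nlinarith)
                linarith
            _ ≤ (4 * ((1 + r) * (1 + τ))) * (1 + r) ^ (γ - 1) := by
                have : 0 ≤ 1 + τ := by linarith
                gcongr
                linarith
            _ = 4 * ((1 + r) ^ γ * (1 + τ)) := by rw [e0 (1 + r) (by linarith)]; ring
            _ ≤ _ := by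
                have : 0 ≤ 1 + τ := by linarith
                gcongr

lemma cone_weight_outgoing (hγ : 1 ≤ γ) (hγ2 : γ ≤ 2) (hr : 0 < r) (h₀ : 0 ≤ r₀) (hs : 0 < s)
    (hsT : s ≤ T) (hz1 : -1 ≤ z) (hz2 : z ≤ 1) (hr2 : r ^ 2 = r₀ ^ 2 + s ^ 2 + 2 * r₀ * s * z)
    (hτ : r * τ = r₀ * z + s) (hτ1 : -1 ≤ τ) (hτ2 : τ ≤ 1) :
    (1 + z) * (1 + T + r₀) ^ γ ≤ 128 * ((1 + (T - s + r)) ^ γ * (1 + τ)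
      + (1 + |T - s - r|) ^ γ * (1 - τ)) := by
  have t1 : r₀ ≤ r + s := by nlinarith [mul_nonneg h₀ hs.le]
  have t2 : s ≤ r + r₀ := by nlinarith [mul_nonneg h₀ hs.le]
  have hA := cone_weight_incoming hγ hγ2 hr h₀ hs hsT hz1 hr2 hτ hτ1 hτ2
  have hγ0 : 0 ≤ γ := by linarith
  by_cases hc : r₀ ≤ T / 2
  · have h1 := rpow_le_four_mul hγ0 hγ2 (by linarith : 0 ≤ 1 + T + r₀)
      (show 1 + T + r₀ ≤ 2 * (2 * (1 + |T - r₀|)) by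
        rw [abs_of_nonneg (by linarith)]; linarith)
    have h2 := rpow_le_four_mul hγ0 hγ2 (by positivity : 0 ≤ 2 * (1 + |T - r₀|)) le_rfl
    have h3 : 0 ≤ (1 + T + r₀) ^ γ := rpow_nonneg (by linarith) _
    nlinarith
  push Not at hc
  have hb2 : 0 ≤ (1 + |T - s - r|) ^ γ * (1 - τ) := mul_nonneg (by positivity) (by linarith)
  have hp1 : 0 ≤ (1 + (T - s + r)) ^ γ := rpow_nonneg (by linarith) _
  by_cases hV1 : T + r₀ < 1
  · have e1 := one_le_rpow (show 1 ≤ 1 + (T - s + r) by linarith) hγ0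
    have e2 := one_le_rpow (show 1 ≤ 1 + |T - s - r| by linarith [abs_nonneg (T - s - r)]) hγ0
    have h4 := rpow_le_four_mul hγ0 hγ2 (by linarith) (show 1 + T + r₀ ≤ 2 * 1 by linarith)
    rw [one_rpow] at h4
    have h5 := mul_le_mul_of_nonneg_right e1 (by linarith : 0 ≤ 1 + τ)
    have h6 := mul_le_mul_of_nonneg_right e2 (by linarith : 0 ≤ 1 - τ)
    have h3 : 0 ≤ (1 + T + r₀) ^ γ := rpow_nonneg (by linarith) _
    nlinarith
  push Not at hV1
  suffices h : (1 + z) * (1 + T + r₀) ^ γ ≤ 128 * ((1 + (T - s + r)) ^ γ * (1 + τ)) by linarith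
  have ha : 0 ≤ 1 + z := by linarith
  have hτr : r₀ * (1 + z) ≤ r * (1 + τ) := by nlinarith
  have e0 : ∀ y : ℝ, 0 < y → y ^ γ = y * y ^ (γ - 1) := fun y hy => by
    rw [← rpow_one_add' hy.le (by linarith)]; congr 1; ring
  have hτ0 : 0 ≤ 1 + τ := by linarith
  by_cases hv : (T + r₀) / 4 ≤ T - s + r
  · have e1 : (1 + T + r₀) ^ (γ - 1) ≤ 4 * (1 + (T - s + r)) ^ (γ - 1) := by
      calc (1 + T + r₀) ^ (γ - 1) ≤ (4 * (1 + (T - s + r))) ^ (γ - 1) :=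
            rpow_le_rpow (by linarith) (by linarith) (by linarith)
        _ = 4 ^ (γ - 1) * (1 + (T - s + r)) ^ (γ - 1) := mul_rpow (by norm_num) (by linarith)
        _ ≤ 4 * (1 + (T - s + r)) ^ (γ - 1) := by
            have : 0 ≤ (1 + (T - s + r)) ^ (γ - 1) := rpow_nonneg (by linarith) _
            gcongr
            calc (4 : ℝ) ^ (γ - 1) ≤ 4 ^ (1 : ℝ) :=
                  rpow_le_rpow_of_exponent_le (by norm_num) (by linarith)
              _ = 4 := rpow_one 4
    have hq : 0 ≤ (1 + T + r₀) ^ (γ - 1) := rpow_nonneg (by linarith) _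
    have hq' : 0 ≤ (1 + (T - s + r)) ^ (γ - 1) := rpow_nonneg (by linarith) _
    calc (1 + z) * (1 + T + r₀) ^ γ = ((1 + z) * (1 + T + r₀)) * (1 + T + r₀) ^ (γ - 1) := by
          rw [e0 (1 + T + r₀) (by linarith)]; ring
      _ ≤ (6 * ((1 + (T - s + r)) * (1 + τ))) * (4 * (1 + (T - s + r)) ^ (γ - 1)) := by
          apply mul_le_mul _ e1 hq (mul_nonneg (by norm_num) (mul_nonneg (by linarith) hτ0))
          nlinarith
      _ = 24 * ((1 + (T - s + r)) ^ γ * (1 + τ)) := by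
          rw [e0 (1 + (T - s + r)) (by linarith)]; ring
      _ ≤ _ := by nlinarith [mul_nonneg hp1 hτ0]
  · push Not at hv
    have hs8 : 3 * (T + r₀) / 8 ≤ s := by linarith
    have hy : (r + s - r₀) * (r + r₀ - s) = 2 * s * r₀ * (1 + z) := by nlinarith
    have hy2 : s * r₀ * (1 + z) ≤ r ^ 2 * (1 + τ) := by
      have h1 : 2 * s * r₀ * (1 + z) ≤ (r + s - r₀) * (2 * r) := by
        rw [← hy]; exact mul_le_mul_of_nonneg_left (by linarith) (by linarith)
      nlinarith [mul_nonneg h₀ ha]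
    have hV : 0 < T + r₀ := by linarith
    have hrV : r ≤ T + r₀ := by linarith
    have e2 : ∀ y : ℝ, 0 < y → y ^ γ * y ^ (2 - γ) = y ^ 2 := fun y hy => by
      rw [← rpow_add hy, show γ + (2 - γ) = 2 by ring, rpow_two]
    have hQ : 0 < (T + r₀) ^ (2 - γ) := rpow_pos_of_pos hV _
    have hmono := rpow_le_rpow hr.le hrV (show 0 ≤ 2 - γ by linarith)
    have h4 := rpow_le_four_mul hγ0 hγ2 (by linarith) (show 1 + T + r₀ ≤ 2 * (T + r₀) by linarith)
    have hrv := rpow_le_rpow hr.le (show r ≤ 1 + (T - s + r) by linarith) hγ0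
    have key : (1 + z) * (T + r₀) ^ γ ≤ 8 * (r ^ γ * (1 + τ)) := by
      refine le_of_mul_le_mul_right ?_ hQ
      calc (1 + z) * (T + r₀) ^ γ * (T + r₀) ^ (2 - γ)
          = (1 + z) * (T + r₀) ^ 2 := by rw [mul_assoc, e2 _ hV]
        _ ≤ 8 * (s * r₀ * (1 + z)) := by
            have : (T + r₀) ^ 2 ≤ 8 * (s * r₀) := by nlinarith
            nlinarith
        _ ≤ 8 * (r ^ 2 * (1 + τ)) := by linarith
        _ = 8 * (r ^ γ * (1 + τ)) * r ^ (2 - γ) := by rw [← e2 r hr]; ring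
        _ ≤ _ := by
            have : 0 ≤ r ^ γ := by positivity
            gcongr
    have h5 := mul_le_mul_of_nonneg_left h4 ha
    have h6 := mul_le_mul_of_nonneg_right hrv hτ0
    linarith [mul_nonneg hp1 hτ0]

end

/-- Weighted energy of a pair of initial data. -/
def dataE (p γ : ℝ) (f g : E3 → ℝ) : ℝ≥0∞ :=
  (∫⁻ x, ENNReal.ofReal ((1 + ‖x‖) ^ γ * (‖fderiv ℝ f x‖ ^ 2 + g x ^ 2)))
    + ∫⁻ x, ENNReal.ofReal ((1 + ‖x‖) ^ γ * |f x| ^ (p + 1))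

lemma sum_sq_apply_bv_le (L : E3 →L[ℝ] ℝ) :
    L (bv 0) ^ 2 + L (bv 1) ^ 2 + L (bv 2) ^ 2 ≤ ‖L‖ ^ 2 := by
  set S := L (bv 0) ^ 2 + L (bv 1) ^ 2 + L (bv 2) ^ 2 with hS
  set v : E3 := ∑ i, L (bv i) • bv i with hv
  have h1 : L v = S := by
    rw [hv, map_sum]; simp only [map_smul, smul_eq_mul, Fin.sum_univ_three, hS]; ring
  have hc : ∀ k, v k = L (bv k) := by
    intro k; rw [hv]; fin_cases k <;> simp [Fin.sum_univ_three]
  have h2 : ‖v‖ ^ 2 = S := by rw [E3.norm_sq, hc, hc, hc]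
  have h3 : S ≤ ‖L‖ * ‖v‖ := by rw [← h1]; exact (le_abs_self _).trans (L.le_opNorm v)
  have h4 : S ^ 2 ≤ ‖L‖ ^ 2 * S := by
    rw [← h2, ← mul_pow, h2]
    exact pow_le_pow_left₀ (by positivity) h3 2
  rcases (show 0 ≤ S by positivity).eq_or_lt with h | h
  · rw [← h]; positivity
  · nlinarith

lemma one_add_rpow_le {γ x : ℝ} (hγ : 0 ≤ γ) (hγ2 : γ ≤ 2) (hx : 0 ≤ x) :
    (1 + x) ^ γ ≤ 4 * (1 + x ^ γ) := by
  rcases le_total x 1 with h | h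
  · have := rpow_le_four_mul hγ hγ2 (by linarith) (show 1 + x ≤ 2 * 1 by linarith)
    rw [one_rpow] at this
    have h2 : 0 ≤ x ^ γ := by positivity
    linarith
  · have := rpow_le_four_mul hγ hγ2 (by linarith) (show 1 + x ≤ 2 * x by linarith)
    linarith

lemma one_add_rpow_ge {γ x : ℝ} (hγ : 0 ≤ γ) (hx : 0 ≤ x) :
    1 + x ^ γ ≤ 2 * (1 + x) ^ γ := by
  have h1 : 1 ≤ (1 + x) ^ γ := one_le_rpow (by linarith) hγ
  have h2 : x ^ γ ≤ (1 + x) ^ γ := rpow_le_rpow hx (by linarith) hγ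
  linarith

lemma curE_diag_le {a y κ V F : ℝ} {b w : Fin 3 → ℝ} (hF : 0 ≤ F)
    (hw : w 0 ^ 2 + w 1 ^ 2 + w 2 ^ 2 = 1) :
    curE a y κ b w F F V ≤
      F * (a ^ 2 + 2 * (b 0 ^ 2 + b 1 ^ 2 + b 2 ^ 2) + 2 * (y ^ 2 * κ ^ 2) + 2 * V) := by
  have h : (w 0 * b 0 + w 1 * b 1 + w 2 * b 2) ^ 2 ≤ b 0 ^ 2 + b 1 ^ 2 + b 2 ^ 2 := by
    have : (w 0 * b 0 + w 1 * b 1 + w 2 * b 2) ^ 2 ≤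
        (w 0 ^ 2 + w 1 ^ 2 + w 2 ^ 2) * (b 0 ^ 2 + b 1 ^ 2 + b 2 ^ 2) := by
      nlinarith [sq_nonneg (w 0 * b 1 - w 1 * b 0), sq_nonneg (w 0 * b 2 - w 2 * b 0),
        sq_nonneg (w 1 * b 2 - w 2 * b 1)]
    rwa [hw, one_mul] at this
  unfold curE
  generalize w 0 * b 0 + w 1 * b 1 + w 2 * b 2 = ρ at *
  generalize b 0 ^ 2 + b 1 ^ 2 + b 2 ^ 2 = N at *
  have e : F * (a + ρ + κ * y) ^ 2 / 2 + F * (a - ρ - κ * y) ^ 2 / 2 + (F + F) * (N - ρ ^ 2) / 2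
      + (F + F) * V = F * (a ^ 2 + (ρ + κ * y) ^ 2 + (N - ρ ^ 2) + 2 * V) := by ring
  rw [e]
  apply mul_le_mul_of_nonneg_left _ hF
  nlinarith [sq_nonneg (ρ - κ * y)]

section
variable {p γ : ℝ} {Φ : ℝ × E3 → ℝ}

lemma lintegral_JE_le (hp : 2 < p) (hp3 : p ≤ 3) (hγ : 1 < γ) (hγp : γ < p - 1)
    (hγ5 : γ * (p - 1) < 5 - p) (hΦ : ContDiff ℝ (⊤ : ℕ∞) Φ)
    (hF : ∫⁻ x, ENNReal.ofReal ((1 + ‖x‖) ^ γ * |Φ (0, x)| ^ (p + 1)) < ⊤) :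
    ∫⁻ x, ENNReal.ofReal (JE Φ (wtF γ) (wtG p γ) (fun y => |y| ^ (p + 1) / (p + 1)) (0, x)) ≤
      324 * dataE p γ (fun x => Φ (0, x)) (fun x => pT Φ (0, x)) := by
  set f : E3 → ℝ := fun x => Φ (0, x) with hf
  set g : E3 → ℝ := fun x => pT Φ (0, x) with hg
  have cf1 : ContDiff ℝ 1 f := (hΦ.of_le (by simp)).comp (contDiff_prodMk_right 0)
  have cdf := cf1.continuous_fderiv one_ne_zero
  have cg : Continuous g := by
    have : ContDiff ℝ (⊤ : ℕ∞) (pT Φ) := contDiff_pT hΦ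
    exact this.continuous.comp (by fun_prop)
  have cw : Continuous fun x : E3 => (1 + ‖x‖) ^ γ :=
    Continuous.rpow_const (by fun_prop) fun x => Or.inl (by positivity)
  have cfp : Continuous fun x : E3 => |f x| ^ (p + 1) :=
    Continuous.rpow_const cf1.continuous.abs fun x => Or.inr (by linarith)
  have pt : ∀ x : E3, x ≠ 0 →
      JE Φ (wtF γ) (wtG p γ) (fun y => |y| ^ (p + 1) / (p + 1)) (0, x) ≤
      4 * ((1 + ‖x‖) ^ γ * (‖fderiv ℝ f x‖ ^ 2 + g x ^ 2)
        + ((1 + ‖x‖) ^ γ * (f x ^ 2 / ‖x - 0‖ ^ 2) + (1 + ‖x‖) ^ γ * |f x| ^ (p + 1))) := by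
    intro x hx
    have hb : ∀ i, pX i Φ (0, x) = fderiv ℝ f x (bv i) := fun i =>
      (pX_eq_fderiv_slice (hΦ.differentiable (by simp)) 0 x (bv i)).symm
    unfold JE
    have e1 : wtG p γ ((0 : ℝ) - ‖x‖) = wtF γ (0 + ‖x‖) := by
      rw [wtG_of_nonpos hγ hγp (by simp), wtF]; simp
    simp only [e1]
    have hFpos : 0 ≤ wtF γ (0 + ‖x‖) := by unfold wtF; positivity
    refine (curE_diag_le hFpos (E3.sum_sq_unit hx)).trans ?_
    have hF2 : wtF γ (0 + ‖x‖) ≤ 2 * (1 + ‖x‖) ^ γ := by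
      rw [wtF, zero_add, abs_norm]; exact one_add_rpow_ge (by linarith) (norm_nonneg _)
    have hs := sum_sq_apply_bv_le (fderiv ℝ f x)
    have hV : |f x| ^ (p + 1) / (p + 1) ≤ |f x| ^ (p + 1) :=
      div_le_self (by positivity) (by linarith)
    have hV0 : 0 ≤ |f x| ^ (p + 1) / (p + 1) := by
      have : 0 < p + 1 := by linarith
      positivity
    rw [hb, hb, hb, sub_zero, inv_pow, ← div_eq_mul_inv]
    have hy : 0 ≤ f x ^ 2 / ‖x‖ ^ 2 := by positivity
    refine (mul_le_mul_of_nonneg_right hF2 (by positivity)).trans ?_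
    have hW : 0 ≤ (1 + ‖x‖) ^ γ := by positivity
    calc _ ≤ 2 * (1 + ‖x‖) ^ γ * (2 * (‖fderiv ℝ f x‖ ^ 2 + g x ^ 2)
          + 2 * (f x ^ 2 / ‖x‖ ^ 2) + 2 * |f x| ^ (p + 1)) := by
            apply mul_le_mul_of_nonneg_left _ (by positivity)
            have : 0 ≤ g x ^ 2 := sq_nonneg _
            simp only [hf, hg] at *
            linarith
      _ = _ := by ring
  have hne : ∀ᵐ x : E3, x ≠ 0 := by
    rw [ae_iff]; simp
  refine (lintegral_mono_ae (hne.mono fun x hx => ENNReal.ofReal_le_ofReal (pt x hx))).trans ?_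
  have h80 := hardy_weighted (by linarith) (by linarith) (by linarith) hγ5 cf1 hF 0
  have hsplit : ∀ x : E3, ENNReal.ofReal (4 * ((1 + ‖x‖) ^ γ * (‖fderiv ℝ f x‖ ^ 2 + g x ^ 2)
        + ((1 + ‖x‖) ^ γ * (f x ^ 2 / ‖x - 0‖ ^ 2) + (1 + ‖x‖) ^ γ * |f x| ^ (p + 1)))) =
      4 * (ENNReal.ofReal ((1 + ‖x‖) ^ γ * (‖fderiv ℝ f x‖ ^ 2 + g x ^ 2))
        + (ENNReal.ofReal ((1 + ‖x‖) ^ γ * (f x ^ 2 / ‖x - 0‖ ^ 2))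
        + ENNReal.ofReal ((1 + ‖x‖) ^ γ * |f x| ^ (p + 1)))) := fun x => by
    rw [ENNReal.ofReal_mul (by norm_num), ENNReal.ofReal_add (by positivity) (by positivity),
      ENNReal.ofReal_add (by positivity) (by positivity)]
    norm_num
  simp_rw [hsplit]
  have m1 : Measurable fun x : E3 =>
      ENNReal.ofReal ((1 + ‖x‖) ^ γ * (‖fderiv ℝ f x‖ ^ 2 + g x ^ 2)) :=
    (cw.mul ((cdf.norm.pow 2).add (cg.pow 2))).measurable.ennreal_ofReal
  have m2 : Measurable fun x : E3 => ENNReal.ofReal ((1 + ‖x‖) ^ γ * |f x| ^ (p + 1)) :=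
    (cw.mul cfp).measurable.ennreal_ofReal
  rw [lintegral_const_mul' _ _ (by simp), lintegral_add_left m1, lintegral_add_right _ m2]
  have hle : ∫⁻ x, ENNReal.ofReal ((1 + ‖x‖) ^ γ * ‖fderiv ℝ f x‖ ^ 2) ≤
      ∫⁻ x, ENNReal.ofReal ((1 + ‖x‖) ^ γ * (‖fderiv ℝ f x‖ ^ 2 + g x ^ 2)) := by
    refine lintegral_mono fun x => ENNReal.ofReal_le_ofReal ?_
    gcongr
    have : 0 ≤ g x ^ 2 := sq_nonneg _
    linarith
  have h81 := h80.trans (mul_le_mul_right hle 80)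
  unfold dataE
  generalize (∫⁻ x, ENNReal.ofReal ((1 + ‖x‖) ^ γ * (‖fderiv ℝ f x‖ ^ 2 + g x ^ 2))) = A at *
  generalize (∫⁻ x, ENNReal.ofReal ((1 + ‖x‖) ^ γ * |f x| ^ (p + 1))) = D at *
  calc _ ≤ 4 * (A + (80 * A + D)) := by gcongr
    _ ≤ 4 * (A + (80 * A + 81 * D)) := by
        gcongr
        exact le_mul_of_one_le_left' (by norm_num)
    _ = 324 * (A + D) := by ring

/-- Constant in the final form of the weighted flux estimate. -/
def fluxC (p γ : ℝ) : ℝ := (p + 1) * (528 * ((p - 1 + γ) / (p - 1 - γ)))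

lemma fluxW_lower (hp3 : p ≤ 3) (hγ : 1 < γ) (hγp : γ < p - 1) {T s : ℝ} (hs : 0 < s)
    (hsT : s ≤ T) (e ω : E3) (he : ‖e‖ = 1) (hω : ‖ω‖ = 1) {r₀ : ℝ} (h₀ : 0 ≤ r₀)
    (hx : r₀ • e + s • ω ≠ 0) :
    (1 + inner ℝ e ω) * (1 + T + r₀) ^ γ + (1 + |T - r₀|) ^ γ ≤
      528 * ((p - 1 + γ) / (p - 1 - γ)) *
        fluxW (wtF γ) (wtG p γ) (T - s) (r₀ • e + s • ω) ω := by
  set x := r₀ • e + s • ω with hxd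
  set z : ℝ := inner ℝ e ω with hz
  have hr : 0 < ‖x‖ := norm_pos_iff.2 hx
  have hz' : |z| ≤ 1 := by
    have := abs_real_inner_le_norm e ω; rwa [he, hω, one_mul] at this
  obtain ⟨hz1, hz2⟩ := abs_le.1 hz'
  have hr2 : ‖x‖ ^ 2 = r₀ ^ 2 + s ^ 2 + 2 * r₀ * s * z := by
    rw [hxd, norm_add_sq_real, norm_smul, norm_smul, he, hω, inner_smul_left, inner_smul_right]
    simp only [norm_eq_abs, mul_one, sq_abs, conj_trivial]; ring
  set τ : ℝ := inner ℝ x ω * ‖x‖⁻¹ with hτd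
  have hτ : ‖x‖ * τ = r₀ * z + s := by
    have : inner ℝ x ω = r₀ * z + s := by
      rw [hxd, inner_add_left, inner_smul_left, inner_smul_left, real_inner_self_eq_norm_sq, hω]
      simp [hz]
    rw [hτd, this]; field_simp
  have hτ' : |τ| ≤ 1 := by
    have := abs_real_inner_le_norm x ω
    rw [hω, mul_one] at this
    rw [hτd, abs_mul, abs_inv, abs_norm, ← div_eq_mul_inv]
    exact div_le_one_of_le₀ this hr.le
  obtain ⟨hτ1, hτ2⟩ := abs_le.1 hτ'
  have hA := cone_weight_incoming hγ.le (by linarith) hr h₀ hs hsT hz1 hr2 hτ hτ1 hτ2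
  have hB := cone_weight_outgoing hγ.le (by linarith) hr h₀ hs hsT hz1 hz2 hr2 hτ hτ1 hτ2
  set W' := (1 + (T - s + ‖x‖)) ^ γ * (1 + τ) + (1 + |T - s - ‖x‖|) ^ γ * (1 - τ) with hW'
  set c := (p - 1 - γ) / (p - 1 + γ) with hc
  have hc0 : 0 < c := div_pos (by linarith) (by linarith)
  have hc1 : c ≤ 1 := by rw [hc, div_le_one (by linarith)]; linarith
  have hinv : (p - 1 + γ) / (p - 1 - γ) = c⁻¹ := by rw [hc, inv_div]
  have hv : 0 ≤ T - s + ‖x‖ := by linarith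
  have f1 : c * (1 + (T - s + ‖x‖)) ^ γ ≤ 4 * wtF γ (T - s + ‖x‖) := by
    have h1 := one_add_rpow_le (by linarith : 0 ≤ γ) (by linarith) hv
    rw [wtF, abs_of_nonneg hv]
    have : 0 ≤ (1 + (T - s + ‖x‖)) ^ γ := by positivity
    nlinarith
  have g1 : c * (1 + |T - s - ‖x‖|) ^ γ ≤ 4 * wtG p γ (T - s - ‖x‖) := by
    have h1 := one_add_rpow_le (by linarith : 0 ≤ γ) (by linarith) (abs_nonneg (T - s - ‖x‖))
    have h2 := le_wtG hγ hγp (T - s - ‖x‖)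
    nlinarith
  have key : c * W' ≤ 4 * fluxW (wtF γ) (wtG p γ) (T - s) x ω := by
    have h1 := mul_le_mul_of_nonneg_right f1 (show 0 ≤ 1 + τ by linarith)
    have h2 := mul_le_mul_of_nonneg_right g1 (show 0 ≤ 1 - τ by linarith)
    rw [fluxW, hW', ← hτd]
    linarith
  rw [hinv]
  have : W' ≤ c⁻¹ * (4 * fluxW (wtF γ) (wtG p γ) (T - s) x ω) := by
    rw [← div_eq_inv_mul, le_div_iff₀ hc0]; linarith
  linarith

/-- Weighted flux estimate through a backward light cone. -/
theorem flux_estimate (hp : 2 < p) (hp3 : p ≤ 3) (hγ : 1 < γ) (hγp : γ < p - 1)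
    (hγ5 : γ * (p - 1) < 5 - p) (hΦ : ContDiff ℝ (⊤ : ℕ∞) Φ)
    (hpde : ∀ q : ℝ × E3, 0 ≤ q.1 →
      pT (pT Φ) q - ∑ i, pX i (pX i Φ) q + |Φ q| ^ (p - 1) * Φ q = 0)
    (hF : ∫⁻ x, ENNReal.ofReal ((1 + ‖x‖) ^ γ * |Φ (0, x)| ^ (p + 1)) < ⊤)
    {T r₀ : ℝ} (hT : 0 ≤ T) (h₀ : 0 ≤ r₀) (e : E3) (he : ‖e‖ = 1) :
    ∫⁻ s in Set.Ioc 0 T, ∫⁻ ω : S2, ENNReal.ofReal (s ^ 2 *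
      (|Φ (T - s, r₀ • e + s • (ω : E3))| ^ (p + 1) *
        ((1 + inner ℝ e (ω : E3)) * (1 + T + r₀) ^ γ + (1 + |T - r₀|) ^ γ))) ∂sphereMeasure ≤
    ENNReal.ofReal (fluxC p γ) *
      (324 * dataE p γ (fun x => Φ (0, x)) (fun x => pT Φ (0, x))) := by
  refine le_trans ?_ (mul_le_mul_right ((weighted_flux hp3 (weights_concrete hp3 hγ hγp)
    (pot_concrete (by linarith)) hΦ hpde hT (r₀ • e)).trans
      (lintegral_JE_le hp hp3 hγ hγp hγ5 hΦ hF)) _)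
  rw [← lintegral_const_mul' _ _ ENNReal.ofReal_ne_top]
  have hne : ∀ᵐ s ∂(volume.restrict (Set.Ioc 0 T)), s ≠ r₀ := by
    refine ae_restrict_of_ae ?_
    rw [ae_iff]; simp
  refine lintegral_mono_ae ?_
  filter_upwards [hne, ae_restrict_mem measurableSet_Ioc] with s hs1 hs2
  rw [← lintegral_const_mul' _ _ ENNReal.ofReal_ne_top]
  refine lintegral_mono fun ω => ?_
  have hC : 0 ≤ fluxC p γ := by
    unfold fluxC
    have : 0 < (p - 1 + γ) / (p - 1 - γ) := div_pos (by linarith) (by linarith)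
    have : 0 < p + 1 := by linarith
    positivity
  rw [← ENNReal.ofReal_mul hC]
  apply ENNReal.ofReal_le_ofReal
  have hω := S2.norm_coe ω
  have hx : r₀ • e + s • (ω : E3) ≠ 0 := by
    intro h
    have h1 : r₀ • e = -(s • (ω : E3)) := eq_neg_of_add_eq_zero_left h
    have h2 := congrArg norm h1
    rw [norm_neg, norm_smul, norm_smul, he, hω, norm_eq_abs, norm_eq_abs, abs_of_nonneg h₀,
      abs_of_pos hs2.1] at h2
    exact hs1 (by linarith)
  have h := fluxW_lower hp3 hγ hγp hs2.1 hs2.2 e ω he hω h₀ hx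
  set a := |Φ (T - s, r₀ • e + s • (ω : E3))| ^ (p + 1) with ha
  have ha0 : 0 ≤ a := by positivity
  have hp1 : p + 1 ≠ 0 := by linarith
  calc _ ≤ s ^ 2 * (a * (528 * ((p - 1 + γ) / (p - 1 - γ)) *
        fluxW (wtF γ) (wtG p γ) (T - s) (r₀ • e + s • (ω : E3)) ω)) := by gcongr
    _ = _ := by rw [fluxC]; field_simp

end

lemma abs_le_interval_average {h h' : ℝ → ℝ} (hd : ∀ s, HasDerivAt h (h' s) s)
    (hh' : Continuous h') (T : ℝ) {ℓ : ℝ} (hℓ : 0 < ℓ) :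
    ENNReal.ofReal |h T| ≤ ∫⁻ s in Set.Ioc T (T + ℓ), ENNReal.ofReal (ℓ⁻¹ * |h s| + |h' s|) := by
  have ch : Continuous h := continuous_iff_continuousAt.2 fun s => (hd s).continuousAt
  have hT : T ≤ T + ℓ := by linarith
  set D := ∫ s in T..(T + ℓ), |h' s| with hD
  have h1 : ∀ s ∈ Set.Icc T (T + ℓ), |h T| ≤ |h s| + D := by
    intro s hs
    have e : ∫ r in T..s, h' r = h s - h T :=
      intervalIntegral.integral_eq_sub_of_hasDerivAt (fun r _ => hd r) (hh'.intervalIntegrable _ _)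
    have h2 : |∫ r in T..s, h' r| ≤ ∫ r in T..s, |h' r| :=
      intervalIntegral.abs_integral_le_integral_abs hs.1
    have h3 : ∫ r in T..s, |h' r| ≤ D :=
      intervalIntegral.integral_mono_interval le_rfl hs.1 hs.2
        (Filter.Eventually.of_forall fun _ => abs_nonneg _) (hh'.abs.intervalIntegrable _ _)
    rw [e] at h2
    have := abs_sub_abs_le_abs_sub (h T) (h s)
    rw [abs_sub_comm] at this
    linarith
  have h2 : |h T| ≤ ∫ s in T..(T + ℓ), (ℓ⁻¹ * |h s| + |h' s|) := by
    have e1 : ∫ _ in T..(T + ℓ), |h T| ≤ ∫ s in T..(T + ℓ), (|h s| + D) :=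
      intervalIntegral.integral_mono_on hT (by simp) ((ch.abs.add continuous_const).intervalIntegrable _ _) h1
    rw [intervalIntegral.integral_add (ch.abs.intervalIntegrable _ _) (by simp)] at e1
    rw [intervalIntegral.integral_add ((ch.abs.intervalIntegrable _ _).const_mul _)
      (hh'.abs.intervalIntegrable _ _), intervalIntegral.integral_const_mul]
    simp only [intervalIntegral.integral_const, smul_eq_mul, add_sub_cancel_left] at e1
    rw [← hD]
    have : |h T| = ℓ⁻¹ * (ℓ * |h T|) := by field_simp
    rw [this]
    calc _ ≤ ℓ⁻¹ * ((∫ s in T..(T + ℓ), |h s|) + ℓ * D) := by gcongr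
      _ = _ := by field_simp
  rw [intervalIntegral.integral_of_le hT] at h2
  exact (ENNReal.ofReal_le_ofReal h2).trans (ofReal_integral_le_lintegral _ _)

lemma fderiv_comp_snd {F : E3 → ℝ} (hF : Differentiable ℝ F) (q v : ℝ × E3) :
    fderiv ℝ (fun q : ℝ × E3 => F q.2) q v = fderiv ℝ F q.2 v.2 := by
  have h := (hF q.2).hasFDerivAt.comp q (hasFDerivAt_snd (𝕜 := ℝ) (E := ℝ) (F := E3) (p := q))
  have h2 : HasFDerivAt (fun q : ℝ × E3 => F q.2) _ q := h
  rw [h2.fderiv]; simp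

lemma pX_comp_snd {F : E3 → ℝ} (hF : Differentiable ℝ F) (i : Fin 3) :
    pX i (fun q : ℝ × E3 => F q.2) = fun q => fderiv ℝ F q.2 (bv i) :=
  funext fun q => fderiv_comp_snd hF q _

lemma pT_comp_snd {F : E3 → ℝ} (hF : Differentiable ℝ F) :
    pT (fun q : ℝ × E3 => F q.2) = fun _ => 0 :=
  funext fun q => by rw [pT, fderiv_comp_snd hF]; simp

lemma abs_second_deriv_le {f : E3 → ℝ} (hf : ContDiff ℝ 2 f) (x : E3) (i : Fin 3) :
    |fderiv ℝ (fun y => fderiv ℝ f y (bv i)) x (bv i)| ≤ ‖iteratedFDeriv ℝ 2 f x‖ := by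
  have hd : DifferentiableAt ℝ (fderiv ℝ f) x :=
    (hf.fderiv_right (m := 1) (by norm_num)).differentiable (by simp) x
  have e : fderiv ℝ (fun y => fderiv ℝ f y (bv i)) x (bv i) =
      iteratedFDeriv ℝ 2 f x ![bv i, bv i] := by
    rw [iteratedFDeriv_two_apply, fderiv_clm_apply hd (differentiableAt_const _)]
    simp
  rw [e, ← norm_eq_abs]
  refine (ContinuousMultilinearMap.le_opNorm _ _).trans ?_
  simp [Fin.prod_univ_two]

section
variable {f g : E3 → ℝ}

lemma spherical_mean_deriv_le (hf : ContDiff ℝ (⊤ : ℕ∞) f) {T ℓ : ℝ} (hT : 0 ≤ T) (hℓ : 0 < ℓ)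
    (x₀ : E3) :
    ENNReal.ofReal |∫ ω : S2, (f (x₀ + T • (ω : E3)) + T * fderiv ℝ f (x₀ + T • (ω : E3)) ω)
      ∂sphereMeasure| ≤
    ∫⁻ s in Set.Ioc T (T + ℓ), ∫⁻ ω : S2, ENNReal.ofReal (s *
      (ℓ⁻¹ * (|f (x₀ + s • (ω : E3))| / ‖x₀ + s • (ω : E3) - x₀‖
        + ‖fderiv ℝ f (x₀ + s • (ω : E3))‖)
        + 3 * ‖iteratedFDeriv ℝ 2 f (x₀ + s • (ω : E3))‖)) ∂sphereMeasure := by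
  have df : Differentiable ℝ f := hf.differentiable (by simp)
  have hdf : ∀ i, ContDiff ℝ (⊤ : ℕ∞) (fun x => fderiv ℝ f x (bv i)) := fun i =>
    (hf.fderiv_right (m := (⊤ : ℕ∞)) (by simp)).clm_apply contDiff_const
  have cdf := (hf.of_le (by simp) : ContDiff ℝ 1 f).continuous_fderiv one_ne_zero
  have hΨ : ContDiff ℝ (⊤ : ℕ∞) (fun q : ℝ × E3 => f q.2) := hf.comp contDiff_snd
  have eT := pT_comp_snd df
  have eX := fun i => pX_comp_snd df i
  have eXX : ∀ i, pX i (pX i fun q : ℝ × E3 => f q.2) =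
      fun q => fderiv ℝ (fun x => fderiv ℝ f x (bv i)) q.2 (bv i) := fun i => by
    rw [eX i, pX_comp_snd ((hdf i).differentiable (by simp))]
  have eTT : pT (pT fun q : ℝ × E3 => f q.2) = fun _ => 0 := by
    rw [eT]; funext q; simp [pT]
  have hk : ∀ s (ω : E3), kirchhoffInt (fun q : ℝ × E3 => f q.2) 0 x₀ s ω =
      f (x₀ + s • ω) + s * fderiv ℝ f (x₀ + s • ω) ω := fun s ω => by
    rw [kirchhoffInt, eT, fderiv_E3_sum f _ ω]
    simp only [eX, Fin.sum_univ_three]; ring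
  have hd := hasDerivAt_kirchhoff hΨ 0 x₀
  simp only [hk, eXX, eTT, sub_zero] at hd
  have hc : Continuous fun s : ℝ => ∫ ω : S2, s * ∑ i, fderiv ℝ (fun x => fderiv ℝ f x (bv i))
      (x₀ + s • (ω : E3)) (bv i) ∂sphereMeasure := by
    apply continuous_integral_compact sphereMeasure (Y := ℝ) (F := fun s (ω : S2) =>
      s * ∑ i, fderiv ℝ (fun x => fderiv ℝ f x (bv i)) (x₀ + s • (ω : E3)) (bv i))
    have c2 : ∀ i, Continuous fun x => fderiv ℝ (fun x => fderiv ℝ f x (bv i)) x (bv i) := fun i =>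
      (((hdf i).of_le (by simp) : ContDiff ℝ 1 _).continuous_fderiv one_ne_zero).clm_apply
        continuous_const
    refine continuous_fst.mul (continuous_finsetSum _ fun i _ => (c2 i).comp (by fun_prop))
  refine (abs_le_interval_average hd hc T hℓ).trans ?_
  refine setLIntegral_mono' measurableSet_Ioc fun s hs => ?_
  have hs0 : 0 < s := hT.trans_lt hs.1
  have habs : ∀ h : S2 → ℝ, |∫ ω, h ω ∂sphereMeasure| ≤ ∫ ω, |h ω| ∂sphereMeasure := fun h =>
    abs_integral_le_integral_abs
  have hcω : Continuous fun ω : S2 => x₀ + s • (ω : E3) := by fun_prop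
  have i1 : Integrable (fun ω : S2 => ℓ⁻¹ * |f (x₀ + s • (ω : E3))
      + s * fderiv ℝ f (x₀ + s • (ω : E3)) ω|) sphereMeasure := by
    apply S2.continuous_integrable
    exact continuous_const.mul ((df.continuous.comp hcω).add (continuous_const.mul
      ((cdf.comp hcω).clm_apply continuous_subtype_val))).abs
  have i2 : Integrable (fun ω : S2 => |s * ∑ i, fderiv ℝ (fun x => fderiv ℝ f x (bv i))
      (x₀ + s • (ω : E3)) (bv i)|) sphereMeasure := by
    apply S2.continuous_integrable
    refine (continuous_const.mul (continuous_finsetSum _ fun i _ => ?_)).abs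
    exact ((((hdf i).of_le (by simp) : ContDiff ℝ 1 _).continuous_fderiv one_ne_zero).comp
      hcω).clm_apply continuous_const
  have h1 : ℓ⁻¹ * |∫ ω : S2, (f (x₀ + s • (ω : E3)) + s * fderiv ℝ f (x₀ + s • (ω : E3)) ω)
      ∂sphereMeasure| + |∫ ω : S2, s * ∑ i, fderiv ℝ (fun x => fderiv ℝ f x (bv i))
      (x₀ + s • (ω : E3)) (bv i) ∂sphereMeasure| ≤
      ∫ ω : S2, (ℓ⁻¹ * |f (x₀ + s • (ω : E3)) + s * fderiv ℝ f (x₀ + s • (ω : E3)) ω|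
        + |s * ∑ i, fderiv ℝ (fun x => fderiv ℝ f x (bv i)) (x₀ + s • (ω : E3)) (bv i)|)
        ∂sphereMeasure := by
    rw [integral_add i1 i2]
    refine add_le_add ?_ (habs _)
    rw [integral_const_mul]
    exact mul_le_mul_of_nonneg_left (habs _) (by positivity)
  refine (ENNReal.ofReal_le_ofReal h1).trans ((ofReal_integral_le_lintegral _ _).trans ?_)
  refine lintegral_mono fun ω => ENNReal.ofReal_le_ofReal ?_
  have hω := S2.norm_coe ω
  set x := x₀ + s • (ω : E3) with hx
  have hn : ‖x - x₀‖ = s := by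
    rw [hx, add_sub_cancel_left, norm_smul, hω, norm_eq_abs, abs_of_pos hs0, mul_one]
  have b1 : |fderiv ℝ f x ω| ≤ ‖fderiv ℝ f x‖ := by
    have := (fderiv ℝ f x).le_opNorm (ω : E3); rwa [hω, mul_one, norm_eq_abs] at this
  have b2 := fun i => abs_second_deriv_le (hf.of_le (by norm_cast)) x i
  have b3 : |∑ i, fderiv ℝ (fun x => fderiv ℝ f x (bv i)) x (bv i)| ≤
      3 * ‖iteratedFDeriv ℝ 2 f x‖ := by
    refine (Finset.abs_sum_le_sum_abs _ _).trans ?_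
    rw [Fin.sum_univ_three]; linarith [b2 0, b2 1, b2 2]
  have b4 : |f x + s * fderiv ℝ f x ω| ≤ |f x| + s * ‖fderiv ℝ f x‖ := by
    refine (abs_add_le _ _).trans ?_
    rw [abs_mul, abs_of_pos hs0]; gcongr
  rw [hn, abs_mul, abs_of_pos hs0]
  calc _ ≤ ℓ⁻¹ * (|f x| + s * ‖fderiv ℝ f x‖) + s * (3 * ‖iteratedFDeriv ℝ 2 f x‖) := by gcongr
    _ = _ := by field_simp

lemma spherical_mean_le (hg : ContDiff ℝ (⊤ : ℕ∞) g) {T ℓ : ℝ} (hT : 0 ≤ T) (hℓ : 0 < ℓ)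
    (x₀ : E3) :
    ENNReal.ofReal |∫ ω : S2, T * g (x₀ + T • (ω : E3)) ∂sphereMeasure| ≤
    ∫⁻ s in Set.Ioc T (T + ℓ), ∫⁻ ω : S2, ENNReal.ofReal (s *
      (ℓ⁻¹ * |g (x₀ + s • (ω : E3))| + ‖fderiv ℝ g (x₀ + s • (ω : E3))‖)) ∂sphereMeasure := by
  have dg : Differentiable ℝ g := hg.differentiable (by simp)
  have cdg := (hg.of_le (by simp) : ContDiff ℝ 1 g).continuous_fderiv one_ne_zero
  have hcq : Continuous fun q : ℝ × S2 => x₀ + q.1 • (q.2 : E3) := by fun_prop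
  have hm : Measurable fun q : ℝ × S2 => ENNReal.ofReal (q.1 *
      (ℓ⁻¹ * |g (x₀ + q.1 • (q.2 : E3))| + ‖fderiv ℝ g (x₀ + q.1 • (q.2 : E3))‖)) :=
    (continuous_fst.mul ((continuous_const.mul (dg.continuous.comp hcq).abs).add
      (cdg.comp hcq).norm)).measurable.ennreal_ofReal
  rw [lintegral_lintegral_swap hm.aemeasurable]
  refine (ENNReal.ofReal_le_ofReal abs_integral_le_integral_abs).trans ?_
  refine (ofReal_integral_le_lintegral _ _).trans (lintegral_mono fun ω => ?_)
  have hω := S2.norm_coe ω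
  have hd : ∀ s : ℝ, HasDerivAt (fun s : ℝ => g (x₀ + s • (ω : E3)))
      (fderiv ℝ g (x₀ + s • (ω : E3)) ω) s := fun s => by
    have h1 : HasDerivAt (fun s : ℝ => x₀ + s • (ω : E3)) (ω : E3) s := by
      simpa using ((hasDerivAt_id s).smul_const (ω : E3)).const_add x₀
    exact (dg _).hasFDerivAt.comp_hasDerivAt s h1
  have hc : Continuous fun s : ℝ => fderiv ℝ g (x₀ + s • (ω : E3)) ω :=
    (cdg.comp (by fun_prop)).clm_apply continuous_const
  have h := abs_le_interval_average hd hc T hℓ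
  rw [abs_mul, abs_of_nonneg hT, ENNReal.ofReal_mul hT]
  refine (mul_le_mul_right h _).trans ?_
  rw [← lintegral_const_mul' _ _ ENNReal.ofReal_ne_top]
  refine setLIntegral_mono' measurableSet_Ioc fun s hs => ?_
  rw [← ENNReal.ofReal_mul hT]
  apply ENNReal.ofReal_le_ofReal
  have b1 : |fderiv ℝ g (x₀ + s • (ω : E3)) ω| ≤ ‖fderiv ℝ g (x₀ + s • (ω : E3))‖ := by
    have := (fderiv ℝ g (x₀ + s • (ω : E3))).le_opNorm (ω : E3)
    rwa [hω, mul_one, norm_eq_abs] at this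
  have h1 : T ≤ s := hs.1.le
  have h2 : 0 ≤ s := hT.trans h1
  gcongr

/-- Hölder's inequality for iterated integrals over a time interval and the sphere. -/
lemma lintegral_sphere_holder {a b : ℝ} (hab : a.HolderConjugate b) (μ : Measure ℝ) [SFinite μ]
    {F G : ℝ × S2 → ℝ≥0∞} (hF : Measurable F) (hG : Measurable G) :
    ∫⁻ s, ∫⁻ ω : S2, F (s, ω) * G (s, ω) ∂sphereMeasure ∂μ ≤
      (∫⁻ s, ∫⁻ ω : S2, F (s, ω) ^ a ∂sphereMeasure ∂μ) ^ (1 / a) *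
      (∫⁻ s, ∫⁻ ω : S2, G (s, ω) ^ b ∂sphereMeasure ∂μ) ^ (1 / b) := by
  rw [← lintegral_prod (fun q : ℝ × S2 => F q * G q) (hF.mul hG).aemeasurable,
    ← lintegral_prod (fun q : ℝ × S2 => F q ^ a) (hF.pow_const a).aemeasurable,
    ← lintegral_prod (fun q : ℝ × S2 => G q ^ b) (hG.pow_const b).aemeasurable]
  exact ENNReal.lintegral_mul_le_Lp_mul_Lq _ hab hF.aemeasurable hG.aemeasurable

end

lemma lintegral_sphere_one_add_inner (e : E3) (he : ‖e‖ = 1) {h : ℝ → ℝ≥0∞} (hh : Measurable h) :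
    ∫⁻ ω : S2, h (1 + inner ℝ e (ω : E3)) ∂sphereMeasure =
      ENNReal.ofReal (sphereMeasure.real Set.univ / 2) * ∫⁻ w in Set.Icc 0 2, h w := by
  rw [lintegral_sphere_inner e he (h := fun z => h (1 + z)) (hh.comp (by fun_prop))]
  congr 1
  have h1 := (measurePreserving_add_left (volume : Measure ℝ) 1).setLIntegral_comp_preimage
    (measurableSet_Icc (a := (0 : ℝ)) (b := 2)) hh
  rw [← h1]
  congr 2
  ext z; simp only [Set.mem_Icc, Set.mem_preimage]; constructor <;> rintro ⟨a, b⟩ <;> constructor <;> linarith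

lemma ae_inner_ne (e : E3) (he : ‖e‖ = 1) (c : ℝ) :
    ∀ᵐ ω : S2 ∂sphereMeasure, inner ℝ e (ω : E3) ≠ c := by
  have h := lintegral_sphere_inner e he
    (measurable_const.indicator (measurableSet_singleton c) : Measurable (Set.indicator {c} fun _ : ℝ => (1 : ℝ≥0∞)))
  have h2 : ∫⁻ z in Set.Icc (-1) 1, Set.indicator {c} (fun _ : ℝ => (1 : ℝ≥0∞)) z = 0 := by
    rw [lintegral_indicator (measurableSet_singleton c)]
    simp
  rw [h2, mul_zero, lintegral_eq_zero_iff' (by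
    apply Measurable.aemeasurable
    exact (measurable_const.indicator (measurableSet_singleton c)).comp
      (by fun_prop : Measurable fun ω : S2 => inner ℝ e (ω : E3)))] at h
  filter_upwards [h] with ω hω heq
  simp [heq] at hω

lemma lintegral_rpow_neg {a b : ℝ} (ha : a < 1) (hb : 0 ≤ b) :
    ∫⁻ w in Set.Icc 0 b, ENNReal.ofReal (w ^ (-a)) = ENNReal.ofReal (b ^ (1 - a) / (1 - a)) := by
  rw [setLIntegral_congr (Ioc_ae_eq_Icc).symm]
  have hi : IntervalIntegrable (fun w : ℝ => w ^ (-a)) volume 0 b :=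
    intervalIntegral.intervalIntegrable_rpow' (by linarith)
  rw [intervalIntegrable_iff_integrableOn_Ioc_of_le hb] at hi
  rw [← ofReal_integral_eq_lintegral_ofReal hi, ← intervalIntegral.integral_of_le hb,
    integral_rpow (Or.inl (by linarith))]
  · rw [show -a + 1 = 1 - a by ring, zero_rpow (by linarith), sub_zero]
  · filter_upwards [ae_restrict_mem measurableSet_Ioc] with w hw
    exact rpow_nonneg hw.1.le _

/-- Constant in `lintegral_sphere_rpow`. -/
def capC (a : ℝ) : ℝ := sphereMeasure.real Set.univ / 2 * (2 ^ (1 - a) / (1 - a))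

lemma capC_nonneg {a : ℝ} (ha : a < 1) : 0 ≤ capC a := by
  unfold capC
  have : 0 < 1 - a := by linarith
  positivity

lemma lintegral_sphere_rpow (e : E3) (he : ‖e‖ = 1) {a : ℝ} (ha : a < 1) :
    ∫⁻ ω : S2, ENNReal.ofReal ((1 + inner ℝ e (ω : E3)) ^ (-a)) ∂sphereMeasure =
      ENNReal.ofReal (capC a) := by
  rw [lintegral_sphere_one_add_inner e he (h := fun w => ENNReal.ofReal (w ^ (-a)))
    (by fun_prop), lintegral_rpow_neg ha (by norm_num), ← ENNReal.ofReal_mul (by positivity), capC]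

lemma S2.abs_inner_le (e : E3) (he : ‖e‖ = 1) (ω : S2) : |inner ℝ e (ω : E3)| ≤ 1 := by
  have := abs_real_inner_le_norm e (ω : E3)
  rwa [he, S2.norm_coe, one_mul] at this

lemma norm_sq_cone (e : E3) (he : ‖e‖ = 1) (ω : S2) (r₀ s : ℝ) :
    ‖r₀ • e + s • (ω : E3)‖ ^ 2 = r₀ ^ 2 + s ^ 2 + 2 * r₀ * s * inner ℝ e (ω : E3) := by
  rw [norm_add_sq_real, norm_smul, norm_smul, he, S2.norm_coe, inner_smul_left, inner_smul_right]
  simp only [norm_eq_abs, mul_one, sq_abs, conj_trivial]; ring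

lemma one_add_norm_cone_rpow_le {γ : ℝ} (hγ : 0 ≤ γ) (hγ2 : γ ≤ 2) (e : E3) (he : ‖e‖ = 1) (ω : S2)
    {r₀ s T : ℝ} (h₀ : 0 ≤ r₀) (hT : 0 ≤ T) (hs : T ≤ s) (hω : inner ℝ e (ω : E3) ≠ -1) :
    (1 + ‖r₀ • e + s • (ω : E3)‖) ^ (-γ) ≤
      2 * (1 + T + r₀) ^ (-γ) * (1 + inner ℝ e (ω : E3)) ^ (-(γ / 2)) := by
  have h1 := S2.abs_inner_le e he ω
  have hr2 := norm_sq_cone e he ω r₀ s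
  have hr := norm_nonneg (r₀ • e + s • (ω : E3))
  set z := inner ℝ e (ω : E3) with hz
  set r := ‖r₀ • e + s • (ω : E3)‖
  obtain ⟨hz1, hz2⟩ := abs_le.1 h1
  have hz3 : 0 < 1 + z := by
    rcases hz1.lt_or_eq with h | h
    · linarith
    · exact absurd h.symm hω
  set y := (1 + z) / 2 with hy
  have hy0 : 0 < y := by positivity
  have hy1 : y ≤ 1 := by rw [hy]; linarith
  have hzy : z = 2 * y - 1 := by rw [hy]; ring
  have hq : (r₀ + s) ^ 2 * y ≤ r ^ 2 := by
    rw [hr2, hzy]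
    nlinarith [mul_nonneg (sq_nonneg (r₀ - s)) (sub_nonneg.2 hy1)]
  have hq2 : (r₀ + s) * y ≤ r := by
    refine (pow_le_pow_iff_left₀ (mul_nonneg (by linarith) hy0.le) hr two_ne_zero).1 ?_
    calc ((r₀ + s) * y) ^ 2 = (r₀ + s) ^ 2 * y * y := by ring
      _ ≤ (r₀ + s) ^ 2 * y * 1 := by gcongr
      _ ≤ r ^ 2 := by linarith
  have hV : 0 ≤ r₀ + T := by linarith
  have hm : (r₀ + T) * y ≤ (r₀ + s) * y := by gcongr
  have hm2 : (r₀ + T) ^ 2 * y ≤ (r₀ + s) ^ 2 * y := by gcongr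
  have h3 : (1 + T + r₀) ^ 2 * y ≤ (1 + r) ^ 2 := by nlinarith
  have e1 : ∀ x : ℝ, 0 < x → x ^ (-γ) = (x ^ 2) ^ (-(γ / 2)) := fun x hx => by
    rw [← rpow_two, ← rpow_mul hx.le]; congr 1; ring
  rw [e1 (1 + r) (by linarith), e1 (1 + T + r₀) (by linarith)]
  calc ((1 + r) ^ 2) ^ (-(γ / 2)) ≤ ((1 + T + r₀) ^ 2 * y) ^ (-(γ / 2)) :=
        rpow_le_rpow_of_nonpos (by positivity) h3 (by linarith)
    _ = ((1 + T + r₀) ^ 2) ^ (-(γ / 2)) * y ^ (-(γ / 2)) := mul_rpow (by positivity) hy0.le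
    _ ≤ ((1 + T + r₀) ^ 2) ^ (-(γ / 2)) * (2 * (1 + z) ^ (-(γ / 2))) := by
        gcongr
        rw [hy, div_rpow hz3.le (by norm_num), rpow_neg (by norm_num : (0:ℝ) ≤ 2), div_inv_eq_mul,
          mul_comm]
        gcongr
        calc (2 : ℝ) ^ (γ / 2) ≤ 2 ^ (1 : ℝ) := rpow_le_rpow_of_exponent_le (by norm_num) (by linarith)
          _ = 2 := rpow_one 2
    _ = _ := by ring

/-- Higher order part of the weighted energy of a pair of initial data. -/
def dataE2 (γ : ℝ) (f g : E3 → ℝ) : ℝ≥0∞ :=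
  ∫⁻ x, ENNReal.ofReal ((1 + ‖x‖) ^ (γ + 2) * (‖iteratedFDeriv ℝ 2 f x‖ ^ 2 + ‖fderiv ℝ g x‖ ^ 2))

section
variable {p γ : ℝ} {f g : E3 → ℝ}

/-- Density obtained from the data after averaging over a shell of width `ℓ`. -/
def shellH (f g : E3 → ℝ) (ℓ : ℝ) (x₀ x : E3) : ℝ :=
  ℓ⁻¹ * (|f x| / ‖x - x₀‖ + ‖fderiv ℝ f x‖ + |g x|)
    + (3 * ‖iteratedFDeriv ℝ 2 f x‖ + ‖fderiv ℝ g x‖)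

/-- Quadratic density controlling `shellH`. -/
def shellX (γ : ℝ) (f g : E3 → ℝ) (x₀ x : E3) : ℝ :=
  5 * ((1 + ‖x‖) ^ γ * (f x ^ 2 / ‖x - x₀‖ ^ 2) + (1 + ‖x‖) ^ γ * (‖fderiv ℝ f x‖ ^ 2 + g x ^ 2)
    + 9 * ((1 + ‖x‖) ^ (γ + 2) * (‖iteratedFDeriv ℝ 2 f x‖ ^ 2 + ‖fderiv ℝ g x‖ ^ 2)))

lemma shellH_sq_le {ℓ : ℝ} (hℓ : 0 < ℓ) {x₀ x : E3} (hx : ℓ ≤ 1 + ‖x‖) :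
    (1 + ‖x‖) ^ γ * (ℓ * shellH f g ℓ x₀ x) ^ 2 ≤ shellX γ f g x₀ x := by
  have hw : 0 ≤ (1 + ‖x‖) ^ γ := by positivity
  have e : (1 + ‖x‖) ^ (γ + 2) = (1 + ‖x‖) ^ γ * (1 + ‖x‖) ^ 2 := by
    rw [rpow_add (by positivity), rpow_two]
  have h1 : ℓ * shellH f g ℓ x₀ x = |f x| / ‖x - x₀‖ + ‖fderiv ℝ f x‖ + |g x|
      + 3 * (ℓ * ‖iteratedFDeriv ℝ 2 f x‖) + ℓ * ‖fderiv ℝ g x‖ := by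
    rw [shellH]; field_simp; ring
  have h2 : (|f x| / ‖x - x₀‖) ^ 2 = f x ^ 2 / ‖x - x₀‖ ^ 2 := by rw [div_pow, sq_abs]
  have h3 := sq_abs (g x)
  rw [h1, shellX, e, ← h2, ← h3]
  set a := |f x| / ‖x - x₀‖
  set b := ‖fderiv ℝ f x‖
  set c := |g x|
  set d := ‖iteratedFDeriv ℝ 2 f x‖
  set k := ‖fderiv ℝ g x‖
  have hl : ℓ ^ 2 ≤ (1 + ‖x‖) ^ 2 := by gcongr
  calc (1 + ‖x‖) ^ γ * (a + b + c + 3 * (ℓ * d) + ℓ * k) ^ 2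
      ≤ (1 + ‖x‖) ^ γ * (5 * (a ^ 2 + (b ^ 2 + c ^ 2) + 9 * (ℓ ^ 2 * (d ^ 2 + k ^ 2)))) := by
        gcongr
        nlinarith [sq_nonneg (a - b), sq_nonneg (a - c), sq_nonneg (a - 3 * (ℓ * d)),
          sq_nonneg (a - ℓ * k), sq_nonneg (b - c), sq_nonneg (b - 3 * (ℓ * d)),
          sq_nonneg (b - ℓ * k), sq_nonneg (c - 3 * (ℓ * d)), sq_nonneg (c - ℓ * k),
          sq_nonneg (3 * (ℓ * d) - ℓ * k), sq_nonneg (ℓ * k)]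
    _ ≤ (1 + ‖x‖) ^ γ * (5 * (a ^ 2 + (b ^ 2 + c ^ 2) + 9 * ((1 + ‖x‖) ^ 2 * (d ^ 2 + k ^ 2)))) := by
        gcongr
    _ = _ := by ring

lemma measurable_shellX (hf : ContDiff ℝ (⊤ : ℕ∞) f) (hg : ContDiff ℝ (⊤ : ℕ∞) g) (x₀ : E3) :
    Measurable (shellX γ f g x₀) := by
  have cdf := (hf.of_le (by simp) : ContDiff ℝ 1 f).continuous_fderiv one_ne_zero
  have cdg := (hg.of_le (by simp) : ContDiff ℝ 1 g).continuous_fderiv one_ne_zero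
  have cd2 := hf.continuous_iteratedFDeriv (m := 2) (by norm_cast)
  have m1 := hf.continuous.measurable
  have m2 := hg.continuous.measurable
  have m3 := cdf.norm.measurable
  have m4 := cdg.norm.measurable
  have m5 := cd2.norm.measurable
  unfold shellX
  fun_prop

lemma measurable_shellH (hf : ContDiff ℝ (⊤ : ℕ∞) f) (hg : ContDiff ℝ (⊤ : ℕ∞) g) (ℓ : ℝ) (x₀ : E3) :
    Measurable (shellH f g ℓ x₀) := by
  have cdf := (hf.of_le (by simp) : ContDiff ℝ 1 f).continuous_fderiv one_ne_zero
  have cdg := (hg.of_le (by simp) : ContDiff ℝ 1 g).continuous_fderiv one_ne_zero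
  have cd2 := hf.continuous_iteratedFDeriv (m := 2) (by norm_cast)
  have m1 : Measurable fun x => |f x| := hf.continuous.abs.measurable
  have m2 : Measurable fun x => |g x| := hg.continuous.abs.measurable
  have m3 := cdf.norm.measurable
  have m4 := cdg.norm.measurable
  have m5 := cd2.norm.measurable
  unfold shellH
  fun_prop

lemma lintegral_shellX_le (hp : 1 < p) (hγ : 0 < γ) (hγ2 : γ ≤ 2) (hγp : γ * (p - 1) < 5 - p)
    (hf : ContDiff ℝ (⊤ : ℕ∞) f) (hg : ContDiff ℝ (⊤ : ℕ∞) g)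
    (hF : ∫⁻ x, ENNReal.ofReal ((1 + ‖x‖) ^ γ * |f x| ^ (p + 1)) < ⊤) (x₀ : E3) :
    ∫⁻ x, ENNReal.ofReal (shellX γ f g x₀ x) ≤ 405 * (dataE p γ f g + dataE2 γ f g) := by
  have cdf := (hf.of_le (by simp) : ContDiff ℝ 1 f).continuous_fderiv one_ne_zero
  have cdg := (hg.of_le (by simp) : ContDiff ℝ 1 g).continuous_fderiv one_ne_zero
  have cd2 := hf.continuous_iteratedFDeriv (m := 2) (by norm_cast)
  have cw : ∀ γ : ℝ, Continuous fun x : E3 => (1 + ‖x‖) ^ γ := fun γ =>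
    Continuous.rpow_const (by fun_prop) fun x => Or.inl (by positivity)
  have hsplit : ∀ x : E3, ENNReal.ofReal (shellX γ f g x₀ x) =
      5 * (ENNReal.ofReal ((1 + ‖x‖) ^ γ * (f x ^ 2 / ‖x - x₀‖ ^ 2))
        + ENNReal.ofReal ((1 + ‖x‖) ^ γ * (‖fderiv ℝ f x‖ ^ 2 + g x ^ 2))
        + 9 * ENNReal.ofReal ((1 + ‖x‖) ^ (γ + 2) *
          (‖iteratedFDeriv ℝ 2 f x‖ ^ 2 + ‖fderiv ℝ g x‖ ^ 2))) := fun x => by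
    rw [shellX, ENNReal.ofReal_mul (by norm_num), ENNReal.ofReal_add (by positivity) (by positivity),
      ENNReal.ofReal_add (by positivity) (by positivity), ENNReal.ofReal_mul (p := 9) (by norm_num)]
    norm_num
  simp_rw [hsplit]
  have m1 : Measurable fun x : E3 =>
      ENNReal.ofReal ((1 + ‖x‖) ^ γ * (‖fderiv ℝ f x‖ ^ 2 + g x ^ 2)) :=
    ((cw γ).mul ((cdf.norm.pow 2).add (hg.continuous.pow 2))).measurable.ennreal_ofReal
  have m2 : Measurable fun x : E3 => 9 * ENNReal.ofReal ((1 + ‖x‖) ^ (γ + 2) *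
      (‖iteratedFDeriv ℝ 2 f x‖ ^ 2 + ‖fderiv ℝ g x‖ ^ 2)) :=
    (((cw (γ + 2)).mul ((cd2.norm.pow 2).add
      (cdg.norm.pow 2))).measurable.ennreal_ofReal).const_mul 9
  rw [lintegral_const_mul' _ _ (by simp), lintegral_add_right _ m2, lintegral_add_right _ m1,
    lintegral_const_mul' _ _ (by simp)]
  have h80 := hardy_weighted hp hγ hγ2 hγp (hf.of_le (by simp)) hF x₀
  have hle : ∫⁻ x, ENNReal.ofReal ((1 + ‖x‖) ^ γ * ‖fderiv ℝ f x‖ ^ 2) ≤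
      ∫⁻ x, ENNReal.ofReal ((1 + ‖x‖) ^ γ * (‖fderiv ℝ f x‖ ^ 2 + g x ^ 2)) := by
    refine lintegral_mono fun x => ENNReal.ofReal_le_ofReal ?_
    gcongr
    have : 0 ≤ g x ^ 2 := sq_nonneg _
    linarith
  have h81 := h80.trans (mul_le_mul_right hle 80)
  rw [dataE, ← dataE2]
  generalize (∫⁻ x, ENNReal.ofReal ((1 + ‖x‖) ^ γ * (‖fderiv ℝ f x‖ ^ 2 + g x ^ 2))) = A at *
  generalize (∫⁻ x, ENNReal.ofReal ((1 + ‖x‖) ^ γ * |f x| ^ (p + 1))) = D at *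
  generalize dataE2 γ f g = L at *
  calc _ ≤ 5 * (80 * A + A + 9 * L) := by gcongr
    _ = 405 * A + 45 * L := by ring
    _ ≤ 405 * (A + D) + 405 * L := by
        gcongr
        · exact le_self_add
        · norm_num
    _ = _ := by ring

end

section
variable {p γ : ℝ} {f g : E3 → ℝ}

lemma abs_kirchhoff_data_le_shell (hf : ContDiff ℝ (⊤ : ℕ∞) f) (hg : ContDiff ℝ (⊤ : ℕ∞) g)
    {T ℓ : ℝ} (hT : 0 ≤ T) (hℓ : 0 < ℓ) (x₀ : E3) :
    ENNReal.ofReal |∫ ω : S2, (T * g (x₀ + T • (ω : E3)) + (f (x₀ + T • (ω : E3))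
      + T * fderiv ℝ f (x₀ + T • (ω : E3)) ω)) ∂sphereMeasure| ≤
    ∫⁻ s in Set.Ioc T (T + ℓ), ∫⁻ ω : S2,
      ENNReal.ofReal (s * shellH f g ℓ x₀ (x₀ + s • (ω : E3))) ∂sphereMeasure := by
  have df : Differentiable ℝ f := hf.differentiable (by simp)
  have cdf := (hf.of_le (by simp) : ContDiff ℝ 1 f).continuous_fderiv one_ne_zero
  have cdg := (hg.of_le (by simp) : ContDiff ℝ 1 g).continuous_fderiv one_ne_zero
  have hcω : Continuous fun ω : S2 => x₀ + T • (ω : E3) := by fun_prop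
  have i1 : Integrable (fun ω : S2 => T * g (x₀ + T • (ω : E3))) sphereMeasure :=
    S2.continuous_integrable _ (continuous_const.mul (hg.continuous.comp hcω))
  have i2 : Integrable (fun ω : S2 => f (x₀ + T • (ω : E3))
      + T * fderiv ℝ f (x₀ + T • (ω : E3)) ω) sphereMeasure :=
    S2.continuous_integrable _ ((hf.continuous.comp hcω).add (continuous_const.mul
      ((cdf.comp hcω).clm_apply continuous_subtype_val)))
  rw [integral_add i1 i2]
  refine (ENNReal.ofReal_le_ofReal (abs_add_le _ _)).trans ?_
  rw [ENNReal.ofReal_add (abs_nonneg _) (abs_nonneg _)]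
  refine (add_le_add (spherical_mean_le hg hT hℓ x₀) (spherical_mean_deriv_le hf hT hℓ x₀)).trans ?_
  have hcq : Continuous fun q : ℝ × S2 => x₀ + q.1 • (q.2 : E3) := by fun_prop
  have hm : Measurable fun q : ℝ × S2 => ENNReal.ofReal (q.1 *
      (ℓ⁻¹ * |g (x₀ + q.1 • (q.2 : E3))| + ‖fderiv ℝ g (x₀ + q.1 • (q.2 : E3))‖)) :=
    (continuous_fst.mul ((continuous_const.mul (hg.continuous.comp hcq).abs).add
      (cdg.comp hcq).norm)).measurable.ennreal_ofReal
  rw [← lintegral_add_left hm.lintegral_prod_right']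
  refine setLIntegral_mono' measurableSet_Ioc fun s hs => ?_
  have hs0 : 0 ≤ s := hT.trans hs.1.le
  have hm' : Measurable fun ω : S2 => ENNReal.ofReal (s *
      (ℓ⁻¹ * |g (x₀ + s • (ω : E3))| + ‖fderiv ℝ g (x₀ + s • (ω : E3))‖)) :=
    hm.comp measurable_prodMk_left
  dsimp only
  rw [← lintegral_add_left hm']
  refine lintegral_mono fun ω => ?_
  rw [← ENNReal.ofReal_add (by positivity) (by positivity)]
  apply ENNReal.ofReal_le_ofReal
  rw [shellH]; apply le_of_eq; ring

/-- Decay of the contribution of the data to the spherical mean formula. -/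
theorem data_decay (hp : 1 < p) (hγ : 0 < γ) (hγ2 : γ < 2) (hγp : γ * (p - 1) < 5 - p)
    (hf : ContDiff ℝ (⊤ : ℕ∞) f) (hg : ContDiff ℝ (⊤ : ℕ∞) g)
    (hF : ∫⁻ x, ENNReal.ofReal ((1 + ‖x‖) ^ γ * |f x| ^ (p + 1)) < ⊤)
    {T r₀ : ℝ} (hT : 0 ≤ T) (h₀ : 0 ≤ r₀) (e : E3) (he : ‖e‖ = 1) :
    ENNReal.ofReal |∫ ω : S2, (T * g (r₀ • e + T • (ω : E3)) + (f (r₀ • e + T • (ω : E3))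
      + T * fderiv ℝ f (r₀ • e + T • (ω : E3)) ω)) ∂sphereMeasure| ≤
    (405 * (dataE p γ f g + dataE2 γ f g)) ^ (1 / 2 : ℝ) *
      (ENNReal.ofReal (4 * capC (γ / 2) * ((1 + T + r₀) ^ (-γ) * (1 + |T - r₀|)⁻¹)))
        ^ (1 / 2 : ℝ) := by
  set x₀ : E3 := r₀ • e with hx₀
  set ℓ : ℝ := (1 + |T - r₀|) / 2 with hℓd
  have hℓ : 0 < ℓ := by positivity
  refine (abs_kirchhoff_data_le_shell hf hg hT hℓ x₀).trans ?_
  have hcq : Continuous fun q : ℝ × S2 => x₀ + q.1 • (q.2 : E3) := by fun_prop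
  have cw : ∀ γ : ℝ, Continuous fun x : E3 => (1 + ‖x‖) ^ γ := fun γ =>
    Continuous.rpow_const (by fun_prop) fun x => Or.inl (by positivity)
  let F : ℝ × S2 → ℝ≥0∞ := fun q => ENNReal.ofReal ((1 + ‖x₀ + q.1 • (q.2 : E3)‖) ^ (γ / 2) *
    (ℓ * (q.1 * shellH f g ℓ x₀ (x₀ + q.1 • (q.2 : E3)))))
  let G : ℝ × S2 → ℝ≥0∞ := fun q => ENNReal.ofReal ((1 + ‖x₀ + q.1 • (q.2 : E3)‖) ^ (-(γ / 2)) *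
    ℓ⁻¹)
  have mF : Measurable F := by
    have m1 := ((cw (γ / 2)).comp hcq).measurable
    have m2 := (measurable_shellH hf hg ℓ x₀).comp hcq.measurable
    exact (m1.mul ((measurable_fst.mul m2).const_mul ℓ)).ennreal_ofReal
  have mG : Measurable G :=
    (((cw (-(γ / 2))).comp hcq).mul continuous_const).measurable.ennreal_ofReal
  have step1 : ∫⁻ s in Set.Ioc T (T + ℓ), ∫⁻ ω : S2,
      ENNReal.ofReal (s * shellH f g ℓ x₀ (x₀ + s • (ω : E3))) ∂sphereMeasure ≤
      ∫⁻ s in Set.Ioc T (T + ℓ), ∫⁻ ω : S2, F (s, ω) * G (s, ω) ∂sphereMeasure := by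
    refine setLIntegral_mono' measurableSet_Ioc fun s hs => lintegral_mono fun ω => ?_
    have hs0 : 0 ≤ s := hT.trans hs.1.le
    have hH : 0 ≤ shellH f g ℓ x₀ (x₀ + s • (ω : E3)) := by unfold shellH; positivity
    simp only [F, G]
    rw [← ENNReal.ofReal_mul (by positivity)]
    apply ENNReal.ofReal_le_ofReal
    rw [rpow_neg (by positivity)]
    have : (1 + ‖x₀ + s • (ω : E3)‖) ^ (γ / 2) ≠ 0 := by positivity
    apply le_of_eq; field_simp
  refine (step1.trans (lintegral_sphere_holder (a := 2) (b := 2) Real.HolderConjugate.two_two _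
    mF mG)).trans ?_
  gcongr ?_ ^ _ * ?_ ^ _
  · refine le_trans ?_ (lintegral_shellX_le hp hγ hγ2.le hγp hf hg hF x₀)
    refine le_trans ?_ (lintegral_polar_Ioc_le (measurable_shellX hf hg x₀).ennreal_ofReal x₀ (T + ℓ))
    refine le_trans ?_ (lintegral_mono_set (Set.Ioc_subset_Ioc_left hT))
    refine setLIntegral_mono' measurableSet_Ioc fun s hs => ?_
    rw [← lintegral_const_mul' _ _ ENNReal.ofReal_ne_top]
    refine lintegral_mono fun ω => ?_
    have hs0 : 0 ≤ s := hT.trans hs.1.le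
    have hH : 0 ≤ shellH f g ℓ x₀ (x₀ + s • (ω : E3)) := by unfold shellH; positivity
    have hr : ℓ ≤ 1 + ‖x₀ + s • (ω : E3)‖ := by
      have h1 : |r₀ - s| ≤ ‖x₀ + s • (ω : E3)‖ := by
        have := abs_norm_sub_norm_le x₀ (-(s • (ω : E3)))
        rw [norm_neg, sub_neg_eq_add, hx₀, norm_smul, norm_smul, he, S2.norm_coe, norm_eq_abs,
          norm_eq_abs, abs_of_nonneg h₀, abs_of_nonneg hs0, mul_one, mul_one] at this
        exact this
      have h2 := hs.1
      have h3 := hs.2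
      have h4 := le_abs_self (r₀ - s)
      have h5 := neg_abs_le (r₀ - s)
      have h6 : 2 * ℓ = 1 + |T - r₀| := by rw [hℓd]; ring
      rcases abs_cases (T - r₀) with ⟨h, _⟩ | ⟨h, _⟩ <;> linarith
    simp only [F]
    rw [ENNReal.ofReal_rpow_of_nonneg (by positivity) (by norm_num), rpow_two,
      ← ENNReal.ofReal_mul (by positivity)]
    apply ENNReal.ofReal_le_ofReal
    refine le_trans (le_of_eq ?_) (mul_le_mul_of_nonneg_left (shellH_sq_le hℓ hr) (sq_nonneg s))
    have e : ((1 + ‖x₀ + s • (ω : E3)‖) ^ (γ / 2)) ^ 2 = (1 + ‖x₀ + s • (ω : E3)‖) ^ γ := by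
      rw [← rpow_mul_natCast (by positivity)]; congr 1; push_cast; ring
    rw [mul_pow, e]; ring
  · have hc := capC_nonneg (show γ / 2 < 1 by linarith)
    have hb : ∀ s ∈ Set.Ioc T (T + ℓ), ∫⁻ ω : S2, G (s, ω) ^ (2 : ℝ) ∂sphereMeasure ≤
        ENNReal.ofReal (2 * (1 + T + r₀) ^ (-γ) * (ℓ⁻¹) ^ 2 * capC (γ / 2)) := by
      intro s hs
      rw [ENNReal.ofReal_mul (by positivity), ← lintegral_sphere_rpow e he (by linarith),
        ← lintegral_const_mul' _ _ ENNReal.ofReal_ne_top]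
      refine lintegral_mono_ae ((ae_inner_ne e he (-1)).mono fun ω hω => ?_)
      have h1 := one_add_norm_cone_rpow_le hγ.le hγ2.le e he ω h₀ hT hs.1.le hω
      simp only [G]
      rw [ENNReal.ofReal_rpow_of_nonneg (by positivity) (by norm_num), rpow_two,
        ← ENNReal.ofReal_mul (by positivity)]
      apply ENNReal.ofReal_le_ofReal
      have e2 : ((1 + ‖x₀ + s • (ω : E3)‖) ^ (-(γ / 2))) ^ 2 = (1 + ‖x₀ + s • (ω : E3)‖) ^ (-γ) := by
        rw [← rpow_mul_natCast (by positivity)]; congr 1; push_cast; ring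
      rw [mul_pow, e2]
      refine (mul_le_mul_of_nonneg_right h1 (by positivity)).trans (le_of_eq ?_)
      ring
    refine (setLIntegral_mono' measurableSet_Ioc hb).trans ?_
    rw [lintegral_const, Measure.restrict_apply_univ, Real.volume_Ioc, add_sub_cancel_left,
      ← ENNReal.ofReal_mul (by positivity)]
    apply ENNReal.ofReal_le_ofReal
    apply le_of_eq
    have : (1 + |T - r₀|)⁻¹ = (2 * ℓ)⁻¹ := by rw [hℓd]; congr 1; ring
    rw [this]; field_simp; ring

end

lemma lintegral_abs_rpow_neg {b : ℝ} (hb : b < 1) :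
    ∫⁻ y in Set.Icc (-1 : ℝ) 1, ENNReal.ofReal (|y| ^ (-b)) ≤ ENNReal.ofReal (2 / (1 - b)) := by
  have h0 : ∫⁻ y in Set.Icc (0 : ℝ) 1, ENNReal.ofReal (|y| ^ (-b)) =
      ENNReal.ofReal (1 / (1 - b)) := by
    rw [setLIntegral_congr_fun measurableSet_Icc (g := fun y => ENNReal.ofReal (y ^ (-b)))
      (fun y hy => by simp only [abs_of_nonneg hy.1]), lintegral_rpow_neg hb zero_le_one, one_rpow]
  have h1 : ∫⁻ y in Set.Icc (-1 : ℝ) 0, ENNReal.ofReal (|y| ^ (-b)) =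
      ENNReal.ofReal (1 / (1 - b)) := by
    have := (Measure.measurePreserving_neg (volume : Measure ℝ)).setLIntegral_comp_preimage
      (measurableSet_Icc (a := (0 : ℝ)) (b := 1))
      (f := fun y => ENNReal.ofReal (|y| ^ (-b))) (by fun_prop)
    simp only [abs_neg] at this
    rw [← h0, ← this]
    simp
  have h2 : (1 : ℝ) - b > 0 := by linarith
  rw [← Set.Icc_union_Icc_eq_Icc (show (-1 : ℝ) ≤ 0 by norm_num) zero_le_one]
  refine (lintegral_union_le _ _ _).trans ?_
  rw [h0, h1, ← ENNReal.ofReal_add (by positivity) (by positivity)]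
  apply le_of_eq; congr 1; ring

lemma mul_lintegral_comp_one_sub_mul {X : ℝ} (hX : 0 ≤ X) {k : ℝ → ℝ≥0∞} (hk : Measurable k) :
    ENNReal.ofReal X * ∫⁻ w, k (1 - X * w) ≤ ∫⁻ y, k y := by
  rcases hX.eq_or_lt with rfl | h
  · simp
  have h1 : ∫⁻ w, k (1 - X * w) = ∫⁻ y, k (1 - y) ∂(Measure.map (X * ·) volume) :=
    (lintegral_map (f := fun y => k (1 - y)) (by fun_prop) (by fun_prop)).symm
  rw [h1, Real.map_volume_mul_left h.ne', lintegral_smul_measure, lintegral_sub_left_eq_self,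
    smul_eq_mul, ← mul_assoc, ← ENNReal.ofReal_mul hX, abs_of_pos (inv_pos.2 h),
    mul_inv_cancel₀ h.ne', ENNReal.ofReal_one, one_mul]

/-- Constant in `lintegral_two_rpow_le`. -/
def twoC (a b : ℝ) : ℝ := 2 * (2 ^ (1 - a) / (1 - a)) + 8 * (2 / (1 - b))

lemma lintegral_two_rpow_le {a b X : ℝ} (ha0 : 0 < a) (ha : a < 1) (hb0 : 0 < b) (hb : b < 1)
    (hX : 0 ≤ X) :
    ∫⁻ w in Set.Icc (0 : ℝ) 2, ENNReal.ofReal (w ^ (-a) * |1 - X * w| ^ (-b)) ≤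
      ENNReal.ofReal (twoC a b) := by
  set k : ℝ → ℝ≥0∞ := Set.indicator (Set.Icc (-1 : ℝ) 1)
    (fun y => ENNReal.ofReal 8 * ENNReal.ofReal (|y| ^ (-b))) with hk
  have hkm : Measurable k := Measurable.indicator (by fun_prop) measurableSet_Icc
  have hpt : ∀ w ∈ Set.Icc (0 : ℝ) 2, ENNReal.ofReal (w ^ (-a) * |1 - X * w| ^ (-b)) ≤
      ENNReal.ofReal 2 * ENNReal.ofReal (w ^ (-a)) + ENNReal.ofReal X * k (1 - X * w) := by
    intro w hw
    have hw0 := hw.1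
    by_cases h : 1 / 2 ≤ |1 - X * w|
    · refine le_trans ?_ le_self_add
      rw [← ENNReal.ofReal_mul (by norm_num), mul_comm]
      apply ENNReal.ofReal_le_ofReal
      refine mul_le_mul_of_nonneg_right ?_ (by positivity)
      refine (rpow_le_rpow_of_nonpos (by norm_num) h (by linarith)).trans ?_
      rw [one_div, inv_rpow (by norm_num), ← rpow_neg (by norm_num), neg_neg]
      calc (2 : ℝ) ^ b ≤ 2 ^ (1 : ℝ) := rpow_le_rpow_of_exponent_le (by norm_num) hb.le
        _ = 2 := rpow_one 2
    · push Not at h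
      have h' := abs_lt.1 h
      have hXw : 1 / 2 < X * w := by linarith
      have hX4 : 1 / 4 ≤ X := by nlinarith [hw.2]
      have hX0 : 0 < X := by linarith
      refine le_trans ?_ le_add_self
      have hm : 1 - X * w ∈ Set.Icc (-1 : ℝ) 1 := ⟨by linarith, by linarith⟩
      rw [hk, Set.indicator_of_mem hm, ← ENNReal.ofReal_mul (by norm_num),
        ← ENNReal.ofReal_mul hX]
      apply ENNReal.ofReal_le_ofReal
      rw [← mul_assoc]
      refine mul_le_mul_of_nonneg_right ?_ (by positivity)
      have h3 : (2 * X)⁻¹ ≤ w := by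
        rw [inv_le_iff_one_le_mul₀ (by positivity)]; linarith
      refine (rpow_le_rpow_of_nonpos (by positivity) h3 (by linarith)).trans ?_
      rw [inv_rpow (by positivity), ← rpow_neg (by positivity), neg_neg]
      calc (2 * X) ^ a ≤ (8 * X) ^ a := rpow_le_rpow (by positivity) (by linarith) ha0.le
        _ ≤ (8 * X) ^ (1 : ℝ) := rpow_le_rpow_of_exponent_le (by linarith) ha.le
        _ = X * 8 := by rw [rpow_one, mul_comm]
  refine (setLIntegral_mono' measurableSet_Icc hpt).trans ?_
  have hm1 : Measurable fun w : ℝ => ENNReal.ofReal 2 * ENNReal.ofReal (w ^ (-a)) := by fun_prop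
  rw [lintegral_add_left hm1, lintegral_const_mul' _ _ ENNReal.ofReal_ne_top,
    lintegral_const_mul' _ _ ENNReal.ofReal_ne_top, lintegral_rpow_neg ha (by norm_num)]
  have h1 : ENNReal.ofReal X * ∫⁻ w in Set.Icc (0 : ℝ) 2, k (1 - X * w) ≤
      ENNReal.ofReal (8 * (2 / (1 - b))) := by
    refine (mul_le_mul_right (setLIntegral_le_lintegral _ _) _).trans ?_
    refine (mul_lintegral_comp_one_sub_mul hX hkm).trans ?_
    rw [hk, lintegral_indicator measurableSet_Icc, lintegral_const_mul' _ _ ENNReal.ofReal_ne_top,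
      ENNReal.ofReal_mul (by norm_num)]
    exact mul_le_mul_right (lintegral_abs_rpow_neg hb) _
  have h2 : 0 < 1 - a := by linarith
  have h3 : 0 < 1 - b := by linarith
  rw [← ENNReal.ofReal_mul (by norm_num), twoC, ENNReal.ofReal_add (by positivity) (by positivity)]
  gcongr

lemma twoC_nonneg {a b : ℝ} (ha : a < 1) (hb : b < 1) : 0 ≤ twoC a b := by
  have h2 : 0 < 1 - a := by linarith
  have h3 : 0 < 1 - b := by linarith
  unfold twoC; positivity

/-- Constant in `lintegral_sphere_two_weights`. -/
def angC (a b : ℝ) : ℝ := sphereMeasure.real Set.univ / 2 * (4 * twoC a b)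

lemma angC_nonneg {a b : ℝ} (ha : a < 1) (hb : b < 1) : 0 ≤ angC a b := by
  have := twoC_nonneg ha hb
  unfold angC; positivity

lemma one_add_abs_cone_rpow_le {b : ℝ} (hb0 : 0 < b) (hb : b < 1) {T s r₀ : ℝ} (hs : 0 < s) (hsT : s ≤ T)
    (h₀ : 0 ≤ r₀) (hsV : 16 * s ≤ 1 + T + r₀) :
    ∃ X : ℝ, 0 ≤ X ∧ ∀ w r : ℝ, 0 ≤ w → 0 ≤ r → r ≤ r₀ + s → X * w ≠ 1 →
      r ^ 2 = (r₀ - s) ^ 2 + 2 * r₀ * s * w →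
      (1 + |r - (T - s)|) ^ (-b) ≤ 4 * ((1 + |T - r₀|) ^ (-b) * |1 - X * w| ^ (-b)) := by
  have four : (1 / 4 : ℝ) ^ (-b) ≤ 4 := by
    rw [one_div, inv_rpow (by norm_num), ← rpow_neg (by norm_num), neg_neg]
    calc (4 : ℝ) ^ b ≤ 4 ^ (1 : ℝ) := rpow_le_rpow_of_exponent_le (by norm_num) hb.le
      _ = 4 := rpow_one 4
  have red : ∀ y u z : ℝ, 0 ≤ y → 0 < u → 0 < z → 1 / 4 * (u * z) ≤ y → 
      y ^ (-b) ≤ 4 * (u ^ (-b) * z ^ (-b)) := by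
    intro y u z hy hu hz h
    refine (rpow_le_rpow_of_nonpos (by positivity) h (by linarith)).trans ?_
    rw [mul_rpow (by norm_num) (by positivity), mul_rpow hu.le hz.le]
    gcongr
  by_cases hT1 : T - r₀ ≤ 1
  · refine ⟨0, le_rfl, fun w r hw hr hr2 _ hrw => ?_⟩
    refine red _ _ _ (by positivity) (by positivity) (by norm_num) ?_
    simp only [zero_mul, sub_zero, abs_one, mul_one]
    have h1 := abs_nonneg (r - (T - s))
    rcases le_or_gt 0 (T - r₀) with h | h
    · rw [abs_of_nonneg h]; linarith
    · rw [abs_of_neg h]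
      have h2 : r₀ - s ≤ r := by
        apply le_of_sq_le_sq _ hr
        rw [hrw]; nlinarith [mul_nonneg (mul_nonneg h₀ hs.le) hw]
      have := le_abs_self (r - (T - s))
      linarith
  · push Not at hT1
    have hD : 3 / 4 * ((T - r₀) * (T + r₀)) ≤ (T - r₀) * (T + r₀ - 2 * s) := by
      have : 3 / 4 * (T + r₀) ≤ T + r₀ - 2 * s := by linarith
      nlinarith
    have hD0 : 0 < (T - r₀) * (T + r₀) := by nlinarith
    set D := (T - r₀) * (T + r₀ - 2 * s) with hDd
    have hDp : 0 < D := by linarith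
    refine ⟨2 * r₀ * s / D, by positivity, fun w r hw hr hr2 hne hrw => ?_⟩
    have hz : 0 < |1 - 2 * r₀ * s / D * w| := abs_pos.2 (sub_ne_zero.2 (Ne.symm hne))
    refine red _ _ _ (by positivity) (by positivity) hz ?_
    rw [abs_of_pos (show 0 < T - r₀ by linarith)]
    have h1 : D * |1 - 2 * r₀ * s / D * w| = |r - (T - s)| * (r + (T - s)) := by
      rw [← abs_of_pos hDp, ← abs_mul, abs_of_pos hDp,
        ← abs_of_nonneg (show 0 ≤ r + (T - s) by linarith), ← abs_mul, ← abs_neg]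
      congr 1
      field_simp
      rw [hDd]; linear_combination -hrw
    have h2 : r + (T - s) ≤ T + r₀ := by linarith
    have hTr : 0 < T + r₀ := by linarith
    have h3 : 3 / 4 * (T - r₀) * |1 - 2 * r₀ * s / D * w| * (T + r₀) ≤
        |r - (T - s)| * (T + r₀) := by
      calc _ = 3 / 4 * ((T - r₀) * (T + r₀)) * |1 - 2 * r₀ * s / D * w| := by ring
        _ ≤ D * |1 - 2 * r₀ * s / D * w| := mul_le_mul_of_nonneg_right hD hz.le
        _ = _ := h1
        _ ≤ _ := mul_le_mul_of_nonneg_left h2 (abs_nonneg _)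
    have h4 := le_of_mul_le_mul_right h3 hTr
    nlinarith

lemma lintegral_sphere_two_weights {a b : ℝ} (ha0 : 0 < a) (ha : a < 1) (hb0 : 0 < b) (hb : b < 1)
    (e : E3) (he : ‖e‖ = 1) {T s r₀ : ℝ} (hs : 0 < s) (hsT : s ≤ T)
    (h₀ : 0 ≤ r₀) (hsV : 16 * s ≤ 1 + T + r₀) :
    ∫⁻ ω : S2, ENNReal.ofReal ((1 + inner ℝ e (ω : E3)) ^ (-a) *
      (1 + |‖r₀ • e + s • (ω : E3)‖ - (T - s)|) ^ (-b)) ∂sphereMeasure ≤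
    ENNReal.ofReal (angC a b * (1 + |T - r₀|) ^ (-b)) := by
  obtain ⟨X, hX, hXb⟩ := one_add_abs_cone_rpow_le hb0 hb hs hsT h₀ hsV
  have hae : ∀ᵐ ω : S2 ∂sphereMeasure, X * (1 + inner ℝ e (ω : E3)) ≠ 1 := by
    rcases hX.eq_or_lt with rfl | h
    · simp
    · refine (ae_inner_ne e he (X⁻¹ - 1)).mono fun ω hω h2 => hω ?_
      field_simp; linarith
  have hpt : ∀ᵐ ω : S2 ∂sphereMeasure, ENNReal.ofReal ((1 + inner ℝ e (ω : E3)) ^ (-a) *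
      (1 + |‖r₀ • e + s • (ω : E3)‖ - (T - s)|) ^ (-b)) ≤
      ENNReal.ofReal (4 * (1 + |T - r₀|) ^ (-b)) * (fun w : ℝ => ENNReal.ofReal
        (w ^ (-a) * |1 - X * w| ^ (-b))) (1 + inner ℝ e (ω : E3)) := by
    refine hae.mono fun ω hω => ?_
    have hin := (abs_le.1 (S2.abs_inner_le e he ω)).1
    have hw : 0 ≤ 1 + inner ℝ e (ω : E3) := by linarith
    have hn := norm_sq_cone e he ω r₀ s
    have hn2 : ‖r₀ • e + s • (ω : E3)‖ ≤ r₀ + s := by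
      refine (norm_add_le _ _).trans ?_
      rw [norm_smul, norm_smul, he, S2.norm_coe, norm_of_nonneg h₀, norm_of_nonneg hs.le]; simp
    have h1 := hXb _ _ hw (norm_nonneg _) hn2 hω (by rw [hn]; ring)
    dsimp only
    rw [← ENNReal.ofReal_mul (by positivity)]
    apply ENNReal.ofReal_le_ofReal
    refine (mul_le_mul_of_nonneg_left h1 (rpow_nonneg hw _)).trans (le_of_eq ?_)
    ring
  refine (lintegral_mono_ae hpt).trans ?_
  rw [lintegral_const_mul' _ _ ENNReal.ofReal_ne_top, lintegral_sphere_one_add_inner e he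
    (h := fun w : ℝ => ENNReal.ofReal (w ^ (-a) * |1 - X * w| ^ (-b))) (by fun_prop)]
  refine (mul_le_mul_right (mul_le_mul_right (lintegral_two_rpow_le ha0 ha hb0 hb hX) _) _).trans ?_
  rw [← ENNReal.ofReal_mul (by positivity), ← ENNReal.ofReal_mul (by positivity)]
  apply ENNReal.ofReal_le_ofReal
  rw [angC]; apply le_of_eq; ring

lemma lintegral_sphere_interpolate {θ : ℝ} (h0 : 0 < θ) (h1 : θ < 1) {S : Set ℝ} (hS : MeasurableSet S)
    {X Y Z : ℝ × S2 → ℝ≥0∞} (hY : Measurable Y) (hZ : Measurable Z)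
    (h : ∀ s ∈ S, ∀ ω, X (s, ω) ≤ Y (s, ω) ^ θ * Z (s, ω) ^ (1 - θ)) :
    ∫⁻ s in S, ∫⁻ ω : S2, X (s, ω) ∂sphereMeasure ≤
      (∫⁻ s in S, ∫⁻ ω : S2, Y (s, ω) ∂sphereMeasure) ^ θ *
      (∫⁻ s in S, ∫⁻ ω : S2, Z (s, ω) ∂sphereMeasure) ^ (1 - θ) := by
  have h2 : 0 < 1 - θ := by linarith
  have hab : (θ⁻¹).HolderConjugate (1 - θ)⁻¹ := by
    rw [Real.holderConjugate_iff]
    exact ⟨(one_lt_inv₀ h0).2 h1, by rw [inv_inv, inv_inv]; ring⟩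
  refine (setLIntegral_mono' hS fun s hs => lintegral_mono fun ω => h s hs ω).trans ?_
  have := lintegral_sphere_holder hab (volume.restrict S) (hY.pow_const θ) (hZ.pow_const (1 - θ))
  simpa only [one_div, inv_inv, ← ENNReal.rpow_mul, mul_inv_cancel₀ h0.ne', mul_inv_cancel₀ h2.ne',
    ENNReal.rpow_one] using this

section
variable {p : ℝ} {ψ : ℝ × S2 → ℝ} {W : S2 → ℝ}

lemma far_integrand_eq (hp : 2 < p) {s x w : ℝ} (hs : 0 < s) (hx : 0 ≤ x) (hw : 0 < w) :
    s * x ^ p = (s ^ 2 * (x ^ (p + 1) * w)) ^ (p / (p + 1)) *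
      (s ^ (1 - p) * w ^ (-p)) ^ (1 - p / (p + 1)) := by
  have hp1 : p + 1 ≠ 0 := by linarith
  have e1 : 1 - p / (p + 1) = 1 / (p + 1) := by field_simp; ring
  rw [e1, mul_rpow (by positivity) (by positivity), mul_rpow (by positivity) hw.le,
    mul_rpow (by positivity) (by positivity), ← rpow_natCast s 2, ← rpow_mul hs.le,
    ← rpow_mul hx, ← rpow_mul hs.le, ← rpow_mul hw.le]
  have e2 : (p + 1) * (p / (p + 1)) = p := by field_simp
  have e3 : w ^ (p / (p + 1)) * w ^ (-p * (1 / (p + 1))) = 1 := by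
    rw [← rpow_add hw]
    have : p / (p + 1) + -p * (1 / (p + 1)) = 0 := by field_simp; ring
    rw [this, rpow_zero]
  have e4 : s ^ (((2 : ℕ) : ℝ) * (p / (p + 1))) * s ^ ((1 - p) * (1 / (p + 1))) = s := by
    rw [← rpow_add hs]
    have : ((2 : ℕ) : ℝ) * (p / (p + 1)) + (1 - p) * (1 / (p + 1)) = 1 := by
      push_cast; field_simp; ring
    rw [this, rpow_one]
  rw [e2]
  calc s * x ^ p = (s ^ (((2 : ℕ) : ℝ) * (p / (p + 1))) * s ^ ((1 - p) * (1 / (p + 1)))) * x ^ p *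
        (w ^ (p / (p + 1)) * w ^ (-p * (1 / (p + 1)))) := by rw [e3, e4, mul_one]
    _ = _ := by ring

lemma near_integrand_eq (hp : 2 < p) {s x w : ℝ} (hs : 0 < s) (hx : 0 ≤ x) (hw : 0 < w) :
    s * x ^ p = (s ^ 2 * (x ^ (p + 1) * w)) ^ ((p - 1) / (p + 1)) *
      (s ^ ((3 - p) / 2) * (x ^ ((p + 1) / 2) * w ^ (-((p - 1) / 2)))) ^
        (1 - (p - 1) / (p + 1)) := by
  have hp1 : p + 1 ≠ 0 := by linarith
  have e1 : 1 - (p - 1) / (p + 1) = 2 / (p + 1) := by field_simp; ring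
  rw [e1, mul_rpow (by positivity) (by positivity), mul_rpow (by positivity) hw.le,
    mul_rpow (by positivity) (by positivity), mul_rpow (by positivity) (by positivity),
    ← rpow_natCast s 2, ← rpow_mul hs.le,
    ← rpow_mul hx, ← rpow_mul hs.le, ← rpow_mul hx, ← rpow_mul hw.le]
  have e2 : x ^ ((p + 1) * ((p - 1) / (p + 1))) * x ^ ((p + 1) / 2 * (2 / (p + 1))) = x ^ p := by
    rw [← rpow_add' hx]
    · congr 1; field_simp; ring
    · have : (p + 1) * ((p - 1) / (p + 1)) + (p + 1) / 2 * (2 / (p + 1)) = p := by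
        field_simp; ring
      rw [this]; linarith
  have e3 : w ^ ((p - 1) / (p + 1)) * w ^ (-((p - 1) / 2) * (2 / (p + 1))) = 1 := by
    rw [← rpow_add hw]
    have : (p - 1) / (p + 1) + -((p - 1) / 2) * (2 / (p + 1)) = 0 := by field_simp; ring
    rw [this, rpow_zero]
  have e4 : s ^ (((2 : ℕ) : ℝ) * ((p - 1) / (p + 1))) * s ^ ((3 - p) / 2 * (2 / (p + 1))) = s := by
    rw [← rpow_add hs]
    have : ((2 : ℕ) : ℝ) * ((p - 1) / (p + 1)) + (3 - p) / 2 * (2 / (p + 1)) = 1 := by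
      push_cast; field_simp; ring
    rw [this, rpow_one]
  calc s * x ^ p = (s ^ (((2 : ℕ) : ℝ) * ((p - 1) / (p + 1))) * s ^ ((3 - p) / 2 * (2 / (p + 1))))
        * (x ^ ((p + 1) * ((p - 1) / (p + 1))) * x ^ ((p + 1) / 2 * (2 / (p + 1)))) *
        (w ^ ((p - 1) / (p + 1)) * w ^ (-((p - 1) / 2) * (2 / (p + 1)))) := by
          rw [e3, e4, e2, mul_one]
    _ = _ := by ring

lemma far_holder (hp : 2 < p) (hψ : Measurable ψ) (hψ0 : ∀ q, 0 ≤ ψ q) (hW : Measurable W)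
    (hW1 : ∀ ω, 1 ≤ W ω) {R T : ℝ} (hR : 0 < R) :
    ∫⁻ s in Set.Ioc R T, ∫⁻ ω : S2, ENNReal.ofReal (s * ψ (s, ω) ^ p) ∂sphereMeasure ≤
      (∫⁻ s in Set.Ioc 0 T, ∫⁻ ω : S2,
        ENNReal.ofReal (s ^ 2 * (ψ (s, ω) ^ (p + 1) * W ω)) ∂sphereMeasure) ^ (p / (p + 1)) *
      (ENNReal.ofReal (R ^ (2 - p) / (p - 2)) *
        ∫⁻ ω : S2, ENNReal.ofReal (W ω ^ (-2 : ℝ)) ∂sphereMeasure) ^ (1 - p / (p + 1)) := by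
  have hp1 : 0 < p + 1 := by linarith
  have h1 : p / (p + 1) < 1 := by rw [div_lt_one hp1]; linarith
  have hm2 : Measurable fun q : ℝ × S2 => W q.2 := hW.comp measurable_snd
  refine (lintegral_sphere_interpolate (θ := p / (p + 1)) (by positivity) h1
    (measurableSet_Ioc (a := R) (b := T)) (X := fun q => ENNReal.ofReal (q.1 * ψ q ^ p))
    (Y := fun q => ENNReal.ofReal (q.1 ^ 2 * (ψ q ^ (p + 1) * W q.2)))
    (Z := fun q => ENNReal.ofReal (q.1 ^ (1 - p) * W q.2 ^ (-p))) (by fun_prop)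
    (by fun_prop) ?_).trans ?_
  · intro s hs ω
    have hs0 : 0 < s := hR.trans hs.1
    have hw : 0 < W ω := by linarith [hW1 ω]
    have hx := hψ0 (s, ω)
    dsimp only
    rw [ENNReal.ofReal_rpow_of_nonneg (by positivity) (by positivity),
      ENNReal.ofReal_rpow_of_nonneg (by positivity) (by linarith),
      ← ENNReal.ofReal_mul (by positivity), ← far_integrand_eq hp hs0 hx hw]
  dsimp only
  refine mul_le_mul' (ENNReal.rpow_le_rpow (lintegral_mono_set
    (Set.Ioc_subset_Ioc_left hR.le)) (by positivity)) (ENNReal.rpow_le_rpow ?_ (by linarith))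
  have hb : ∀ s ∈ Set.Ioc R T,
      ∫⁻ ω : S2, ENNReal.ofReal (s ^ (1 - p) * W ω ^ (-p)) ∂sphereMeasure ≤
      ENNReal.ofReal (s ^ (1 - p)) *
        ∫⁻ ω : S2, ENNReal.ofReal (W ω ^ (-2 : ℝ)) ∂sphereMeasure := by
    intro s hs
    have hs0 : 0 < s := hR.trans hs.1
    rw [← lintegral_const_mul' _ _ ENNReal.ofReal_ne_top]
    refine lintegral_mono fun ω => ?_
    rw [← ENNReal.ofReal_mul (by positivity)]
    apply ENNReal.ofReal_le_ofReal
    refine mul_le_mul_of_nonneg_left ?_ (by positivity)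
    exact rpow_le_rpow_of_exponent_le (hW1 ω) (by linarith)
  refine (setLIntegral_mono' measurableSet_Ioc hb).trans ?_
  have hmm : Measurable fun s : ℝ => ENNReal.ofReal (s ^ (1 - p)) := by fun_prop
  rw [lintegral_mul_const _ hmm]
  refine mul_le_mul_left ?_ _
  refine (lintegral_mono_set (Set.Ioc_subset_Ioi_self)).trans ?_
  rw [← ofReal_integral_eq_lintegral_ofReal (integrableOn_Ioi_rpow_of_lt (by linarith) hR)
    ((ae_restrict_mem measurableSet_Ioi).mono fun s hs => rpow_nonneg (hR.le.trans (le_of_lt hs)) _),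
    integral_Ioi_rpow_of_lt (by linarith) hR]
  apply ENNReal.ofReal_le_ofReal
  apply le_of_eq
  rw [show 1 - p + 1 = 2 - p by ring, ← neg_sub p 2, neg_div_neg_eq]

lemma near_holder (hp : 2 < p) (hψ : Measurable ψ) (hψ0 : ∀ q, 0 ≤ ψ q) (hW : Measurable W)
    (hW1 : ∀ ω, 1 ≤ W ω) {R T : ℝ} (hR : R ≤ T) :
    ∫⁻ s in Set.Ioc 0 R, ∫⁻ ω : S2, ENNReal.ofReal (s * ψ (s, ω) ^ p) ∂sphereMeasure ≤
      (∫⁻ s in Set.Ioc 0 T, ∫⁻ ω : S2,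
        ENNReal.ofReal (s ^ 2 * (ψ (s, ω) ^ (p + 1) * W ω)) ∂sphereMeasure) ^ ((p - 1) / (p + 1)) *
      (∫⁻ s in Set.Ioc 0 R, ∫⁻ ω : S2, ENNReal.ofReal (s ^ ((3 - p) / 2) *
        (ψ (s, ω) ^ ((p + 1) / 2) * W ω ^ (-((p - 1) / 2)))) ∂sphereMeasure) ^
          (1 - (p - 1) / (p + 1)) := by
  have hp1 : 0 < p + 1 := by linarith
  have h1 : (p - 1) / (p + 1) < 1 := by rw [div_lt_one hp1]; linarith
  have h0 : 0 < (p - 1) / (p + 1) := div_pos (by linarith) hp1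
  have hm2 : Measurable fun q : ℝ × S2 => W q.2 := hW.comp measurable_snd
  refine (lintegral_sphere_interpolate (θ := (p - 1) / (p + 1)) h0 h1
    (measurableSet_Ioc (a := 0) (b := R)) (X := fun q => ENNReal.ofReal (q.1 * ψ q ^ p))
    (Y := fun q => ENNReal.ofReal (q.1 ^ 2 * (ψ q ^ (p + 1) * W q.2)))
    (Z := fun q => ENNReal.ofReal (q.1 ^ ((3 - p) / 2) *
        (ψ q ^ ((p + 1) / 2) * W q.2 ^ (-((p - 1) / 2))))) (by fun_prop)
    (by fun_prop) ?_).trans ?_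
  · intro s hs ω
    have hs0 : 0 < s := hs.1
    have hw : 0 < W ω := by linarith [hW1 ω]
    have hx := hψ0 (s, ω)
    dsimp only
    rw [ENNReal.ofReal_rpow_of_nonneg (by positivity) h0.le,
      ENNReal.ofReal_rpow_of_nonneg (by positivity) (by linarith),
      ← ENNReal.ofReal_mul (rpow_nonneg (by positivity) _), ← near_integrand_eq hp hs0 hx hw]
  dsimp only
  exact mul_le_mul_left (ENNReal.rpow_le_rpow (lintegral_mono_set
    (Set.Ioc_subset_Ioc_right hR)) h0.le) _

end

lemma lintegral_sphere_weight_inv_sq (e : E3) (he : ‖e‖ = 1) {A D : ℝ} (hA : 0 < A) (hD : 0 < D) :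
    ∫⁻ ω : S2, ENNReal.ofReal (((1 + inner ℝ e (ω : E3)) * A + D) ^ (-2 : ℝ)) ∂sphereMeasure ≤
      ENNReal.ofReal (sphereMeasure.real Set.univ / 2 * (A⁻¹ * D⁻¹)) := by
  rw [lintegral_sphere_one_add_inner e he
    (h := fun w : ℝ => ENNReal.ofReal ((w * A + D) ^ (-2 : ℝ))) (by fun_prop),
    ENNReal.ofReal_mul (by positivity)]
  refine mul_le_mul_right ?_ _
  have hder : ∀ w ∈ Set.uIcc (0 : ℝ) 2,
      HasDerivAt (fun w => -(A⁻¹ * (w * A + D)⁻¹)) ((w * A + D) ^ (-2 : ℝ)) w := by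
    intro w hw
    rw [Set.uIcc_of_le (by norm_num)] at hw
    have hpos : 0 < w * A + D := by nlinarith [hw.1]
    have h1 : HasDerivAt (fun w => w * A + D) A w := by
      simpa using ((hasDerivAt_id w).mul_const A).add_const D
    have h2 := ((h1.inv hpos.ne').const_mul A⁻¹).neg
    refine HasDerivAt.congr_deriv h2 ?_
    rw [show (-2 : ℝ) = -((2 : ℕ) : ℝ) by norm_num, rpow_neg hpos.le, rpow_natCast]
    field_simp
  have hcont : ContinuousOn (fun w : ℝ => (w * A + D) ^ (-2 : ℝ)) (Set.Icc 0 2) := by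
    refine ContinuousOn.rpow_const (by fun_prop) fun w hw => Or.inl ?_
    nlinarith [hw.1]
  have hint : IntervalIntegrable (fun w : ℝ => (w * A + D) ^ (-2 : ℝ)) volume 0 2 := by
    apply ContinuousOn.intervalIntegrable
    rwa [Set.uIcc_of_le (by norm_num)]
  rw [setLIntegral_congr (Ioc_ae_eq_Icc).symm, ← ofReal_integral_eq_lintegral_ofReal
    ((intervalIntegrable_iff_integrableOn_Ioc_of_le (by norm_num)).1 hint)
    ((ae_restrict_mem measurableSet_Ioc).mono fun w hw => rpow_nonneg (by nlinarith [hw.1]) _),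
    ← intervalIntegral.integral_of_le (by norm_num),
    intervalIntegral.integral_eq_sub_of_hasDerivAt hder hint]
  apply ENNReal.ofReal_le_ofReal
  have : 0 ≤ A⁻¹ * (2 * A + D)⁻¹ := by positivity
  simp only [zero_mul, zero_add]
  linarith

section
variable {p γ : ℝ} {Φ : ℝ × E3 → ℝ}

lemma two_mul_rpow_neg_le {α v V : ℝ} (hα : 0 ≤ α) (hα1 : α ≤ 1) (hV : 0 < V) (hv : V ≤ 2 * v) :
    v ^ (-α) ≤ 2 * V ^ (-α) := by
  have h : V * 2⁻¹ ≤ v := by linarith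
  refine (rpow_le_rpow_of_nonpos (by positivity) h (by linarith)).trans ?_
  rw [mul_rpow hV.le (by norm_num), mul_comm, inv_rpow (by norm_num), ← rpow_neg (by norm_num),
    neg_neg]
  refine mul_le_mul_of_nonneg_right ?_ (by positivity)
  calc (2 : ℝ) ^ α ≤ 2 ^ (1 : ℝ) := rpow_le_rpow_of_exponent_le (by norm_num) hα1
    _ = 2 := rpow_one 2

lemma norm_cone_le (e : E3) (he : ‖e‖ = 1) (ω : S2) {r₀ s : ℝ} (h₀ : 0 ≤ r₀) (hs : 0 ≤ s) :
    ‖r₀ • e + s • (ω : E3)‖ ≤ r₀ + s := by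
  refine (norm_add_le _ _).trans ?_
  rw [norm_smul, norm_smul, he, S2.norm_coe, norm_of_nonneg h₀, norm_of_nonneg hs]; simp

lemma le_norm_cone (e : E3) (he : ‖e‖ = 1) (ω : S2) {r₀ s : ℝ} (h₀ : 0 ≤ r₀) (hs : 0 ≤ s) :
    r₀ - s ≤ ‖r₀ • e + s • (ω : E3)‖ := by
  have := norm_sub_le_norm_add (r₀ • e) (s • (ω : E3))
  rwa [norm_smul, norm_smul, he, S2.norm_coe, norm_of_nonneg h₀, norm_of_nonneg hs, mul_one,
    mul_one] at this

lemma near_lintegral_le (hp : 2 < p) (hp3 : p < 3) (hγ : 0 < γ) (hγ2 : γ < 2) {α M : ℝ}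
    (hα : 0 ≤ α) (hα1 : α ≤ 1) (hM : 0 ≤ M)
    {T r₀ R : ℝ} (hT : 0 ≤ T) (h₀ : 0 ≤ r₀) (e : E3) (he : ‖e‖ = 1) (hR : 0 ≤ R) (hRT : R ≤ T)
    (hRV : 16 * R ≤ 1 + T + r₀)
    (hb : ∀ q : ℝ × E3, 0 ≤ q.1 → q.1 + ‖q.2‖ ≤ T + r₀ →
      |Φ q| ≤ M * ((1 + q.1 + ‖q.2‖) ^ (-α) * (1 + |‖q.2‖ - q.1|) ^ (-(γ / (p + 1))))) :
    ∫⁻ s in Set.Ioc 0 R, ∫⁻ ω : S2, ENNReal.ofReal (s ^ ((3 - p) / 2) *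
      (|Φ (T - s, r₀ • e + s • (ω : E3))| ^ ((p + 1) / 2) *
        ((1 + inner ℝ e (ω : E3)) * (1 + T + r₀) ^ γ + (1 + |T - r₀|) ^ γ) ^ (-((p - 1) / 2))))
          ∂sphereMeasure ≤
    ENNReal.ofReal (R ^ ((5 - p) / 2) * ((1 + T + r₀) ^ (-(γ * ((p - 1) / 2))) *
      (angC ((p - 1) / 2) (γ / 2) * (1 + |T - r₀|) ^ (-(γ / 2)))) *
        (M * (2 * (1 + T + r₀) ^ (-α))) ^ ((p + 1) / 2)) := by
  set V := 1 + T + r₀ with hV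
  have hV1 : 1 ≤ V := by linarith
  have hang := angC_nonneg (a := (p - 1) / 2) (b := γ / 2) (by linarith) (by linarith)
  set c := R ^ ((3 - p) / 2) * V ^ (-(γ * ((p - 1) / 2))) *
    (M * (2 * V ^ (-α))) ^ ((p + 1) / 2) with hc
  have hc0 : 0 ≤ c := by positivity
  have key : ∀ s ∈ Set.Ioc 0 R, ∫⁻ ω : S2, ENNReal.ofReal (s ^ ((3 - p) / 2) *
      (|Φ (T - s, r₀ • e + s • (ω : E3))| ^ ((p + 1) / 2) *
        ((1 + inner ℝ e (ω : E3)) * V ^ γ + (1 + |T - r₀|) ^ γ) ^ (-((p - 1) / 2))))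
          ∂sphereMeasure ≤
      ENNReal.ofReal c * ENNReal.ofReal (angC ((p - 1) / 2) (γ / 2) *
        (1 + |T - r₀|) ^ (-(γ / 2))) := by
    intro s hs
    have hs0 := hs.1
    have hsR := hs.2
    refine le_trans ?_ (mul_le_mul_right (lintegral_sphere_two_weights (a := (p - 1) / 2)
      (b := γ / 2) (by linarith) (by linarith) (by linarith) (by linarith) e he hs0
      (hsR.trans hRT) h₀ (by linarith)) _)
    rw [← lintegral_const_mul' _ _ ENNReal.ofReal_ne_top]
    refine lintegral_mono_ae ((ae_inner_ne e he (-1)).mono fun ω hω => ?_)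
    have hin := (abs_le.1 (S2.abs_inner_le e he ω)).1
    have hw : 0 < 1 + inner ℝ e (ω : E3) := by
      rcases hin.lt_or_eq with h | h
      · linarith
      · exact absurd h.symm hω
    rw [← ENNReal.ofReal_mul hc0]
    apply ENNReal.ofReal_le_ofReal
    have hn1 := norm_cone_le e he ω h₀ hs0.le
    have hn2 := le_norm_cone e he ω h₀ hs0.le
    set x := r₀ • e + s • (ω : E3) with hx
    set U := 1 + |‖x‖ - (T - s)| with hU
    have hUp : 0 < U := by positivity
    have e1 : |Φ (T - s, x)| ≤ M * (2 * V ^ (-α)) * U ^ (-(γ / (p + 1))) := by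
      refine (hb (T - s, x) (by simpa using hsR.trans hRT) (by dsimp only; linarith)).trans ?_
      dsimp only
      rw [mul_assoc]
      refine mul_le_mul_of_nonneg_left (mul_le_mul_of_nonneg_right ?_ (by positivity)) hM
      exact two_mul_rpow_neg_le hα hα1 (by linarith) (by linarith)
    have e2 : |Φ (T - s, x)| ^ ((p + 1) / 2) ≤
        (M * (2 * V ^ (-α))) ^ ((p + 1) / 2) * U ^ (-(γ / 2)) := by
      refine (rpow_le_rpow (abs_nonneg _) e1 (by linarith)).trans (le_of_eq ?_)
      rw [mul_rpow (by positivity) (by positivity), ← rpow_mul hUp.le]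
      congr 2
      have : p + 1 ≠ 0 := by linarith
      field_simp
    have e3 : ((1 + inner ℝ e (ω : E3)) * V ^ γ + (1 + |T - r₀|) ^ γ) ^ (-((p - 1) / 2)) ≤
        (1 + inner ℝ e (ω : E3)) ^ (-((p - 1) / 2)) * V ^ (-(γ * ((p - 1) / 2))) := by
      have h1 : 0 < (1 + inner ℝ e (ω : E3)) * V ^ γ := by positivity
      have h2 : (1 + inner ℝ e (ω : E3)) * V ^ γ ≤
          (1 + inner ℝ e (ω : E3)) * V ^ γ + (1 + |T - r₀|) ^ γ :=
        le_add_of_nonneg_right (by positivity)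
      refine (rpow_le_rpow_of_nonpos h1 h2 (by linarith)).trans (le_of_eq ?_)
      rw [mul_rpow hw.le (by positivity), ← rpow_mul (by positivity)]
      congr 2; ring
    have e4 : s ^ ((3 - p) / 2) ≤ R ^ ((3 - p) / 2) := rpow_le_rpow hs0.le hsR (by linarith)
    calc _ ≤ R ^ ((3 - p) / 2) * ((M * (2 * V ^ (-α))) ^ ((p + 1) / 2) * U ^ (-(γ / 2)) *
          ((1 + inner ℝ e (ω : E3)) ^ (-((p - 1) / 2)) * V ^ (-(γ * ((p - 1) / 2))))) := by
          gcongr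
      _ = _ := by rw [hc]; ring
  refine (setLIntegral_mono' measurableSet_Ioc key).trans ?_
  rw [lintegral_const, Measure.restrict_apply_univ, Real.volume_Ioc, sub_zero,
    ← ENNReal.ofReal_mul hc0, ← ENNReal.ofReal_mul (by positivity)]
  apply ENNReal.ofReal_le_ofReal
  rcases hR.eq_or_lt with h | h
  · rw [← h, mul_zero]; positivity
  have e5 : R ^ ((5 - p) / 2) = R ^ ((3 - p) / 2) * R := by
    rw [← rpow_add_one h.ne']; congr 1; ring
  rw [e5, hc]; apply le_of_eq; ring

/-- The exponent of `1 + t + |x|` before it is rewritten. -/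
def decayExp (p γ : ℝ) : ℝ := (γ + γ * (p - 1) / (5 - p) * (p - 2)) / (p + 1)

/-- Constant for the far part of the cone. -/
def farC (p δ : ℝ) : ℝ :=
  (δ ^ (2 - p) / (p - 2) * (sphereMeasure.real Set.univ / 2)) ^ (1 - p / (p + 1))

/-- Constant for the part of the cone near its vertex. -/
def nearC (p γ δ : ℝ) : ℝ :=
  2 * (δ ^ ((5 - p) / 2) * angC ((p - 1) / 2) (γ / 2)) ^ (1 - (p - 1) / (p + 1))

lemma far_weight_eq (hp : 2 < p) (hp5 : p < 5) {δ V u m : ℝ} (hδ : 0 < δ) (hV : 0 < V) (hu : 0 < u)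
    (hm : 0 ≤ m) :
    ((δ * V ^ (γ * (p - 1) / (5 - p))) ^ (2 - p) / (p - 2) * (m * ((V ^ γ)⁻¹ * (u ^ γ)⁻¹))) ^
      (1 - p / (p + 1)) =
    (δ ^ (2 - p) / (p - 2) * m) ^ (1 - p / (p + 1)) *
      (V ^ (-decayExp p γ) * u ^ (-(γ / (p + 1)))) := by
  have hp1 : p + 1 ≠ 0 := by linarith
  have hp2 : 0 < p - 2 := by linarith
  rw [mul_rpow hδ.le (by positivity), ← rpow_mul hV.le, ← rpow_neg hV.le, ← rpow_neg hu.le]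
  have e1 : δ ^ (2 - p) * V ^ (γ * (p - 1) / (5 - p) * (2 - p)) / (p - 2) *
      (m * (V ^ (-γ) * u ^ (-γ))) = (δ ^ (2 - p) / (p - 2) * m) *
      (V ^ (γ * (p - 1) / (5 - p) * (2 - p) + -γ) * u ^ (-γ)) := by
    rw [rpow_add hV]; ring
  rw [e1, mul_rpow (x := δ ^ (2 - p) / (p - 2) * m) (by positivity) (by positivity),
    mul_rpow (x := V ^ _) (by positivity) (by positivity), ← rpow_mul hV.le, ← rpow_mul hu.le]
  have h5 : 5 - p ≠ 0 := by linarith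
  congr 3
  · rw [decayExp]; field_simp; ring
  · field_simp; ring

lemma near_weight_le (hp : 2 < p) (hp5 : p < 5) {δ V u m M α R : ℝ} (hδ : 0 < δ) (hV : 0 < V)
    (hu : 0 < u) (hm : 0 ≤ m) (hM : 0 ≤ M) (hR : 0 ≤ R)
    (hRV : R ≤ δ * V ^ (γ * (p - 1) / (5 - p))) :
    (R ^ ((5 - p) / 2) * (V ^ (-(γ * ((p - 1) / 2))) * (m * u ^ (-(γ / 2)))) *
        (M * (2 * V ^ (-α))) ^ ((p + 1) / 2)) ^ (1 - (p - 1) / (p + 1)) ≤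
    2 * (δ ^ ((5 - p) / 2) * m) ^ (1 - (p - 1) / (p + 1)) *
      (M * (V ^ (-α) * u ^ (-(γ / (p + 1))))) := by
  have hp1 : p + 1 ≠ 0 := by linarith
  have h5 : 5 - p ≠ 0 := by linarith
  have h1 : 0 ≤ 1 - (p - 1) / (p + 1) := by
    rw [sub_nonneg, div_le_one (by linarith)]; linarith
  have e1 : R ^ ((5 - p) / 2) * V ^ (-(γ * ((p - 1) / 2))) ≤ δ ^ ((5 - p) / 2) := by
    refine (mul_le_mul_of_nonneg_right (rpow_le_rpow hR hRV (by linarith))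
      (by positivity)).trans (le_of_eq ?_)
    rw [mul_rpow hδ.le (by positivity), ← rpow_mul hV.le, mul_assoc, ← rpow_add hV]
    have : γ * (p - 1) / (5 - p) * ((5 - p) / 2) + -(γ * ((p - 1) / 2)) = 0 := by
      field_simp; ring
    rw [this, rpow_zero, mul_one]
  have e2 : R ^ ((5 - p) / 2) * (V ^ (-(γ * ((p - 1) / 2))) * (m * u ^ (-(γ / 2)))) *
        (M * (2 * V ^ (-α))) ^ ((p + 1) / 2) ≤
      (δ ^ ((5 - p) / 2) * m) * (u ^ (-(γ / 2)) * (M * (2 * V ^ (-α))) ^ ((p + 1) / 2)) := by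
    calc _ = R ^ ((5 - p) / 2) * V ^ (-(γ * ((p - 1) / 2))) * (m * u ^ (-(γ / 2)) *
        (M * (2 * V ^ (-α))) ^ ((p + 1) / 2)) := by ring
      _ ≤ δ ^ ((5 - p) / 2) * (m * u ^ (-(γ / 2)) *
        (M * (2 * V ^ (-α))) ^ ((p + 1) / 2)) := by gcongr
      _ = _ := by ring
  refine (rpow_le_rpow (by positivity) e2 h1).trans (le_of_eq ?_)
  rw [mul_rpow (x := δ ^ ((5 - p) / 2) * m) (by positivity) (by positivity),
    mul_rpow (x := u ^ _) (by positivity) (by positivity),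
    ← rpow_mul hu.le, ← rpow_mul (by positivity)]
  have e3 : -(γ / 2) * (1 - (p - 1) / (p + 1)) = -(γ / (p + 1)) := by field_simp; ring
  have e4 : (p + 1) / 2 * (1 - (p - 1) / (p + 1)) = 1 := by field_simp; ring
  rw [e3, e4, rpow_one]; ring

end

lemma sphereMeasure_real_univ_pos : 0 < sphereMeasure.real Set.univ := by
  rw [measureReal_def, ENNReal.toReal_pos_iff]
  refine ⟨?_, ?_⟩
  · rw [pos_iff_ne_zero, Measure.measure_univ_ne_zero]
    exact Measure.toSphere_ne_zero _
  · exact measure_lt_top (volume : Measure E3).toSphere _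

section
variable {p γ : ℝ} {Φ : ℝ × E3 → ℝ}

lemma vertex_bound (hp : 1 < p) (hΦ : ContDiff ℝ (⊤ : ℕ∞) Φ)
    (hpde : ∀ q : ℝ × E3, 0 ≤ q.1 →
      pT (pT Φ) q - ∑ i, pX i (pX i Φ) q + |Φ q| ^ (p - 1) * Φ q = 0)
    {T : ℝ} (hT : 0 ≤ T) (x₀ : E3) :
    ENNReal.ofReal (sphereMeasure.real Set.univ * |Φ (T, x₀)|) ≤
      ENNReal.ofReal |∫ ω : S2, kirchhoffInt Φ T x₀ T ω ∂sphereMeasure| +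
      ∫⁻ s in Set.Ioc 0 T, ∫⁻ ω : S2,
        ENNReal.ofReal (s * |Φ (T - s, x₀ + s • (ω : E3))| ^ p) ∂sphereMeasure := by
  have hN : Continuous fun q => |Φ q| ^ (p - 1) * Φ q :=
    (hΦ.continuous.abs.rpow_const fun _ => Or.inr (by linarith)).mul hΦ.continuous
  have hk := kirchhoff_formula hΦ hN hpde hT x₀
  have h1 : sphereMeasure.real Set.univ * |Φ (T, x₀)| ≤
      |∫ ω : S2, kirchhoffInt Φ T x₀ T ω ∂sphereMeasure| +
      |∫ s in (0 : ℝ)..T, s * ∫ ω : S2, |Φ (T - s, x₀ + s • (ω : E3))| ^ (p - 1) *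
        Φ (T - s, x₀ + s • (ω : E3)) ∂sphereMeasure| := by
    rw [← abs_of_nonneg (measureReal_nonneg (μ := sphereMeasure) (s := Set.univ)), ← abs_mul, hk]
    exact abs_sub _ _
  refine (ENNReal.ofReal_le_ofReal h1).trans ?_
  rw [ENNReal.ofReal_add (abs_nonneg _) (abs_nonneg _)]
  refine add_le_add le_rfl ?_
  rw [intervalIntegral.integral_of_le hT, ← Real.enorm_eq_ofReal_abs]
  refine (enorm_integral_le_lintegral_enorm _).trans ?_
  refine setLIntegral_mono' measurableSet_Ioc fun s hs => ?_
  rw [enorm_mul, Real.enorm_eq_ofReal hs.1.le]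
  refine (mul_le_mul_right (enorm_integral_le_lintegral_enorm _) _).trans ?_
  rw [← lintegral_const_mul' _ _ ENNReal.ofReal_ne_top]
  refine lintegral_mono fun ω => le_of_eq ?_
  rw [Real.enorm_eq_ofReal_abs, ← ENNReal.ofReal_mul hs.1.le, abs_mul,
    abs_of_nonneg (by positivity : 0 ≤ |Φ (T - s, x₀ + s • (ω : E3))| ^ (p - 1))]
  congr 2
  have h := rpow_add' (abs_nonneg (Φ (T - s, x₀ + s • (ω : E3)))) (y := p - 1) (z := 1)
    (by linarith)
  rw [rpow_one] at h
  rw [← h]; congr 1; ring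

lemma kirchhoffInt_at_zero (hΦ : ContDiff ℝ (⊤ : ℕ∞) Φ) (T : ℝ) (x₀ : E3) (ω : E3) :
    kirchhoffInt Φ T x₀ T ω = T * pT Φ (0, x₀ + T • ω) + (Φ (0, x₀ + T • ω)
      + T * fderiv ℝ (fun x => Φ (0, x)) (x₀ + T • ω) ω) := by
  rw [kirchhoffInt, sub_self, fderiv_E3_sum]
  simp only [pX_eq_fderiv_slice (hΦ.differentiable (by simp))]
  simp only [pX, Fin.sum_univ_three]
  ring

lemma nonlinear_bound (hp : 2 < p) (hp3 : p < 3) (hγ : 1 < γ) (hγp : γ < p - 1)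
    (hpp : (p - 1) ^ 2 ≤ 5 - p) (hΦ : ContDiff ℝ (⊤ : ℕ∞) Φ) {M δ : ℝ} (hM : 0 ≤ M)
    (hδ : 0 < δ) (hδ1 : δ ≤ 1 / 16)
    {T r₀ : ℝ} (hT : 0 ≤ T) (h₀ : 0 ≤ r₀) (e : E3) (he : ‖e‖ = 1)
    (hb : ∀ q : ℝ × E3, 0 ≤ q.1 → q.1 + ‖q.2‖ ≤ T + r₀ → |Φ q| ≤
      M * ((1 + q.1 + ‖q.2‖) ^ (-decayExp p γ) * (1 + |‖q.2‖ - q.1|) ^ (-(γ / (p + 1)))))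
    {Fl : ℝ≥0∞} (hFl : ∫⁻ s in Set.Ioc 0 T, ∫⁻ ω : S2, ENNReal.ofReal (s ^ 2 *
      (|Φ (T - s, r₀ • e + s • (ω : E3))| ^ (p + 1) *
        ((1 + inner ℝ e (ω : E3)) * (1 + T + r₀) ^ γ + (1 + |T - r₀|) ^ γ))) ∂sphereMeasure ≤ Fl) :
    ∫⁻ s in Set.Ioc 0 T, ∫⁻ ω : S2,
        ENNReal.ofReal (s * |Φ (T - s, r₀ • e + s • (ω : E3))| ^ p) ∂sphereMeasure ≤
      Fl ^ ((p - 1) / (p + 1)) * ENNReal.ofReal (nearC p γ δ *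
        (M * ((1 + T + r₀) ^ (-decayExp p γ) * (1 + |T - r₀|) ^ (-(γ / (p + 1)))))) +
      Fl ^ (p / (p + 1)) * ENNReal.ofReal (farC p δ *
        ((1 + T + r₀) ^ (-decayExp p γ) * (1 + |T - r₀|) ^ (-(γ / (p + 1))))) := by
  have h5 : 0 < 5 - p := by linarith
  have hp1 : 0 < p + 1 := by linarith
  set κ := γ * (p - 1) / (5 - p) with hκ
  have hκ0 : 0 ≤ κ := by rw [hκ]; exact div_nonneg (mul_nonneg (by linarith) (by linarith)) h5.le
  have hκ1 : κ ≤ 1 := by rw [hκ, div_le_one h5]; nlinarith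
  have hα0 : 0 ≤ decayExp p γ := by
    rw [decayExp]; exact div_nonneg (add_nonneg (by linarith) (mul_nonneg hκ0 (by linarith))) hp1.le
  have hα1 : decayExp p γ ≤ 1 := by rw [decayExp, div_le_one hp1]; nlinarith
  set V := 1 + T + r₀ with hV
  set u := 1 + |T - r₀| with hu
  have hV1 : 1 ≤ V := by linarith
  have hu1 : 1 ≤ u := by rw [hu]; linarith [abs_nonneg (T - r₀)]
  set R := δ * V ^ κ with hR
  have hR0 : 0 < R := by positivity
  have hRV : 16 * R ≤ V := by
    have : V ^ κ ≤ V := by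
      calc V ^ κ ≤ V ^ (1 : ℝ) := rpow_le_rpow_of_exponent_le hV1 hκ1
        _ = V := rpow_one V
    rw [hR]; nlinarith [rpow_nonneg (by linarith : 0 ≤ V) κ]
  set ψ : ℝ × S2 → ℝ := fun q => |Φ (T - q.1, r₀ • e + q.1 • (q.2 : E3))| with hψ
  have hψm : Measurable ψ := by
    have : Continuous ψ := (hΦ.continuous.comp (by fun_prop)).abs
    exact this.measurable
  have hψ0 : ∀ q, 0 ≤ ψ q := fun q => abs_nonneg _
  set W : S2 → ℝ := fun ω => (1 + inner ℝ e (ω : E3)) * V ^ γ + u ^ γ with hW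
  have hWm : Measurable W := by
    have : Continuous W := by rw [hW]; fun_prop
    exact this.measurable
  have hW1 : ∀ ω, 1 ≤ W ω := by
    intro ω
    have hin := (abs_le.1 (S2.abs_inner_le e he ω)).1
    have h1 : 0 ≤ (1 + inner ℝ e (ω : E3)) * V ^ γ := mul_nonneg (by linarith) (by positivity)
    have h2 : 1 ≤ u ^ γ := one_le_rpow hu1 (by linarith)
    simp only [hW]; linarith
  have hcov : Set.Ioc 0 T ⊆ Set.Ioc 0 (min T R) ∪ Set.Ioc R T := by
    intro s hs
    rcases le_or_gt s R with h | h
    · exact Or.inl ⟨hs.1, le_min hs.2 h⟩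
    · exact Or.inr ⟨h, hs.2⟩
  refine (lintegral_mono_set hcov).trans ((lintegral_union_le _ _ _).trans (add_le_add ?_ ?_))
  · refine (near_holder hp hψm hψ0 hWm hW1 (min_le_left T R)).trans ?_
    have hθ : 0 ≤ (p - 1) / (p + 1) := div_nonneg (by linarith) hp1.le
    have hθ' : 0 ≤ 1 - (p - 1) / (p + 1) := by
      rw [sub_nonneg, div_le_one hp1]; linarith
    refine mul_le_mul' (ENNReal.rpow_le_rpow hFl hθ) ?_
    have hang := angC_nonneg (a := (p - 1) / 2) (b := γ / 2) (by linarith) (by linarith)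
    refine (ENNReal.rpow_le_rpow (near_lintegral_le hp hp3 (by linarith) (by linarith) hα0 hα1 hM
      hT h₀ e he (le_min hT hR0.le) (min_le_left _ _)
      ((mul_le_mul_of_nonneg_left (min_le_right T R) (by norm_num)).trans hRV) hb) hθ').trans ?_
    rw [ENNReal.ofReal_rpow_of_nonneg (by positivity) hθ']
    apply ENNReal.ofReal_le_ofReal
    rw [nearC]
    exact near_weight_le hp (by linarith) hδ (by linarith) (by linarith) hang hM
      (le_min hT hR0.le) (min_le_right _ _)
  · refine (far_holder hp hψm hψ0 hWm hW1 hR0).trans ?_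
    have hθ' : 0 ≤ 1 - p / (p + 1) := by
      rw [sub_nonneg, div_le_one hp1]; linarith
    refine mul_le_mul' (ENNReal.rpow_le_rpow hFl (by positivity)) ?_
    have hp2 : 0 < p - 2 := by linarith
    have hu0 : 0 < u := by linarith
    refine (ENNReal.rpow_le_rpow (mul_le_mul_right (lintegral_sphere_weight_inv_sq e he
      (A := V ^ γ) (D := u ^ γ) (by positivity) (by positivity)) _) hθ').trans ?_
    rw [← ENNReal.ofReal_mul (by positivity), ENNReal.ofReal_rpow_of_nonneg (by positivity) hθ',
      hR, hκ, far_weight_eq hp (by linarith) hδ (by linarith) hu0 (by positivity), farC]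

end

section
variable {p γ : ℝ} {Φ : ℝ × E3 → ℝ}

lemma decayExp_le_half (hp : 2 < p) (hγ : 0 < γ) (hpp : (p - 1) ^ 2 ≤ 5 - p) :
    decayExp p γ ≤ γ / 2 := by
  have h5 : 0 < 5 - p := by nlinarith
  have h1 : (p - 1) / (5 - p) * (p - 2) ≤ (p - 1) / 2 := by
    rw [div_mul_eq_mul_div, div_le_div_iff₀ h5 (by norm_num)]
    nlinarith
  rw [decayExp, div_le_div_iff₀ (by linarith) (by norm_num)]
  have h2 : γ * (p - 1) / (5 - p) * (p - 2) = γ * ((p - 1) / (5 - p) * (p - 2)) := by ring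
  rw [h2]
  nlinarith

lemma nearC_nonneg (hp3 : p < 3) (hγ2 : γ < 2) {δ : ℝ} (hδ : 0 ≤ δ) :
    0 ≤ nearC p γ δ := by
  have hang := angC_nonneg (a := (p - 1) / 2) (b := γ / 2) (by linarith) (by linarith)
  unfold nearC; positivity

lemma farC_nonneg (hp : 2 < p) {δ : ℝ} (hδ : 0 ≤ δ) : 0 ≤ farC p δ := by
  have : 0 < p - 2 := by linarith
  unfold farC; positivity

lemma fluxC_nonneg (hp : 2 < p) (hγ : 1 < γ) (hγp : γ < p - 1) : 0 ≤ fluxC p γ := by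
  unfold fluxC
  have h1 : 0 ≤ (p - 1 + γ) / (p - 1 - γ) := div_nonneg (by linarith) (by linarith)
  have h2 : 0 ≤ p + 1 := by linarith
  positivity

/-- Improvement of an a priori decay bound in a backward light cone. -/
lemma decay_improvement (hp : 2 < p) (hp3 : p < 3) (hγ : 1 < γ) (hγp : γ < p - 1)
    (hpp : (p - 1) ^ 2 ≤ 5 - p) (hΦ : ContDiff ℝ (⊤ : ℕ∞) Φ)
    (hpde : ∀ q : ℝ × E3, 0 ≤ q.1 →
      pT (pT Φ) q - ∑ i, pX i (pX i Φ) q + |Φ q| ^ (p - 1) * Φ q = 0)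
    {E₀ E₁ : ℝ} (hE₀ : 0 ≤ E₀) (hE₁ : 0 ≤ E₁)
    (h0 : dataE p γ (fun x => Φ (0, x)) (fun x => pT Φ (0, x)) ≤ ENNReal.ofReal E₀)
    (h1 : dataE p γ (fun x => Φ (0, x)) (fun x => pT Φ (0, x)) +
      dataE2 γ (fun x => Φ (0, x)) (fun x => pT Φ (0, x)) ≤ ENNReal.ofReal E₁)
    {M δ : ℝ} (hM : 0 ≤ M) (hδ : 0 < δ) (hδ1 : δ ≤ 1 / 16)
    {T r₀ : ℝ} (hT : 0 ≤ T) (h₀ : 0 ≤ r₀) (e : E3) (he : ‖e‖ = 1)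
    (hb : ∀ q : ℝ × E3, 0 ≤ q.1 → q.1 + ‖q.2‖ ≤ T + r₀ → |Φ q| ≤
      M * ((1 + q.1 + ‖q.2‖) ^ (-decayExp p γ) * (1 + |‖q.2‖ - q.1|) ^ (-(γ / (p + 1))))) :
    sphereMeasure.real Set.univ * |Φ (T, r₀ • e)| ≤
      (√(405 * E₁) * √(4 * capC (γ / 2)) +
        ((fluxC p γ * (324 * E₀)) ^ ((p - 1) / (p + 1)) * nearC p γ δ * M +
        (fluxC p γ * (324 * E₀)) ^ (p / (p + 1)) * farC p δ)) *
      ((1 + T + r₀) ^ (-decayExp p γ) * (1 + |T - r₀|) ^ (-(γ / (p + 1)))) := by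
  have hγ5 : γ * (p - 1) < 5 - p := by nlinarith
  have hp1 : 0 < p + 1 := by linarith
  have hfx := fluxC_nonneg hp hγ hγp
  have hF : ∫⁻ x, ENNReal.ofReal ((1 + ‖x‖) ^ γ * |Φ (0, x)| ^ (p + 1)) < ⊤ :=
    lt_of_le_of_lt (le_trans le_add_self h0) ENNReal.ofReal_lt_top
  have hFl := (flux_estimate hp hp3.le hγ hγp hγ5 hΦ hpde hF hT h₀ e he).trans
    (show _ ≤ ENNReal.ofReal (fluxC p γ * (324 * E₀)) by
      rw [ENNReal.ofReal_mul hfx, ENNReal.ofReal_mul (by norm_num)]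
      refine mul_le_mul_right (mul_le_mul' (by simp) h0) _)
  have hnl := nonlinear_bound hp hp3 hγ hγp hpp hΦ hM hδ hδ1 hT h₀ e he hb hFl
  have cf : ContDiff ℝ (⊤ : ℕ∞) fun x => Φ (0, x) := hΦ.comp (by fun_prop)
  have cg : ContDiff ℝ (⊤ : ℕ∞) fun x => pT Φ (0, x) := (contDiff_pT hΦ).comp (by fun_prop)
  have hlin := data_decay (by linarith) (by linarith : 0 < γ) (by linarith) hγ5 cf cg hF hT h₀ e he
  have hv := vertex_bound (by linarith) hΦ hpde hT (r₀ • e)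
  simp only [kirchhoffInt_at_zero hΦ] at hv
  set V := 1 + T + r₀ with hV
  set u := 1 + |T - r₀| with hu
  have hV1 : 1 ≤ V := by linarith
  have hu1 : 1 ≤ u := by rw [hu]; linarith [abs_nonneg (T - r₀)]
  have hu0 : 0 < u := by linarith
  set w := V ^ (-decayExp p γ) * u ^ (-(γ / (p + 1))) with hw
  have hw0 : 0 ≤ w := by positivity
  have hcap := capC_nonneg (show γ / 2 < 1 by linarith)
  have hn := nearC_nonneg hp3 (show γ < 2 by linarith) hδ.le
  have hf := farC_nonneg hp hδ.le
  have hvw : √(V ^ (-γ) * u⁻¹) ≤ w := by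
    rw [sqrt_eq_rpow, mul_rpow (by positivity) (by positivity), ← rpow_mul (by positivity),
      ← rpow_neg_one u, ← rpow_mul (by positivity)]
    refine mul_le_mul ?_ ?_ (by positivity) (by positivity)
    · refine rpow_le_rpow_of_exponent_le hV1 ?_
      have := decayExp_le_half hp (by linarith : 0 < γ) hpp
      linarith
    · refine rpow_le_rpow_of_exponent_le hu1 ?_
      have : γ / (p + 1) ≤ 1 / 2 := by
        rw [div_le_div_iff₀ hp1 (by norm_num)]; linarith
      linarith
  have hlin' : (405 * (dataE p γ (fun x => Φ (0, x)) (fun x => pT Φ (0, x)) +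
      dataE2 γ (fun x => Φ (0, x)) (fun x => pT Φ (0, x)))) ^ (1 / 2 : ℝ) *
      (ENNReal.ofReal (4 * capC (γ / 2) * (V ^ (-γ) * u⁻¹))) ^ (1 / 2 : ℝ) ≤
      ENNReal.ofReal (√(405 * E₁) * √(4 * capC (γ / 2)) * w) := by
    have h2 : (405 * (dataE p γ (fun x => Φ (0, x)) (fun x => pT Φ (0, x)) +
      dataE2 γ (fun x => Φ (0, x)) (fun x => pT Φ (0, x)))) ≤ ENNReal.ofReal (405 * E₁) := by
      rw [ENNReal.ofReal_mul (by norm_num)]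
      exact mul_le_mul' (by simp) h1
    refine (mul_le_mul_left (ENNReal.rpow_le_rpow h2 (by norm_num)) _).trans ?_
    rw [ENNReal.ofReal_rpow_of_nonneg (by positivity) (by norm_num),
      ENNReal.ofReal_rpow_of_nonneg (by positivity) (by norm_num),
      ← ENNReal.ofReal_mul (by positivity), ← sqrt_eq_rpow, ← sqrt_eq_rpow]
    apply ENNReal.ofReal_le_ofReal
    rw [sqrt_mul (by positivity) (V ^ (-γ) * u⁻¹), ← mul_assoc]
    exact mul_le_mul_of_nonneg_left hvw (by positivity)
  have hq : 0 ≤ (p - 1) / (p + 1) := div_nonneg (by linarith) hp1.le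
  have hq' : 0 ≤ p / (p + 1) := by positivity
  rw [ENNReal.ofReal_rpow_of_nonneg (by positivity) hq,
    ENNReal.ofReal_rpow_of_nonneg (by positivity) hq', ← ENNReal.ofReal_mul (by positivity),
    ← ENNReal.ofReal_mul (by positivity), ← ENNReal.ofReal_add (by positivity) (by positivity)]
    at hnl
  have hfin := hv.trans (add_le_add (hlin.trans hlin') hnl)
  rw [← ENNReal.ofReal_add (by positivity) (by positivity),
    ENNReal.ofReal_le_ofReal_iff (by positivity)] at hfin
  refine hfin.trans (le_of_eq ?_)
  ring

end

lemma exists_unit_eq_norm_smul (x : E3) : ∃ e : E3, ‖e‖ = 1 ∧ ‖x‖ • e = x := by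
  by_cases hx : x = 0
  · exact ⟨bv 0, by simp [bv], by simp [hx]⟩
  · have h : ‖x‖ ≠ 0 := norm_ne_zero_iff.2 hx
    refine ⟨‖x‖⁻¹ • x, ?_, ?_⟩
    · rw [norm_smul, norm_inv, norm_norm, inv_mul_cancel₀ h]
    · rw [smul_smul, mul_inv_cancel₀ h, one_smul]

/-- A bound that improves itself on every truncated cone holds with twice the source constant. -/
lemma bootstrap_cone {h w : ℝ × E3 → ℝ} (hh : Continuous h) (hh0 : ∀ q, 0 ≤ h q)
    (hw : ContinuousOn w {q | 0 ≤ q.1}) (hw0 : ∀ q, 0 ≤ q.1 → 0 < w q) {A : ℝ}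
    (himp : ∀ M q, 0 ≤ M → 0 ≤ q.1 → (∀ q' : ℝ × E3, 0 ≤ q'.1 → q'.1 + ‖q'.2‖ ≤ q.1 + ‖q.2‖ →
      h q' ≤ M * w q') → h q ≤ (A + M / 2) * w q) (q : ℝ × E3) (hq : 0 ≤ q.1) :
    h q ≤ 2 * A * w q := by
  set K : Set (ℝ × E3) := {q' | 0 ≤ q'.1 ∧ q'.1 + ‖q'.2‖ ≤ q.1 + ‖q.2‖} with hK
  have hKc : IsCompact K := by
    refine ((isCompact_Icc (a := 0) (b := q.1 + ‖q.2‖)).prod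
      (isCompact_closedBall (0 : E3) (q.1 + ‖q.2‖))).of_isClosed_subset ?_ ?_
    · exact (isClosed_le continuous_const continuous_fst).inter
        (isClosed_le (f := fun q' : ℝ × E3 => q'.1 + ‖q'.2‖)
          (continuous_fst.add continuous_snd.norm) continuous_const)
    · rintro ⟨t, x⟩ ⟨h1, h2⟩
      dsimp only at h1 h2
      have := norm_nonneg x
      exact ⟨⟨h1, by linarith⟩, by simp only [mem_closedBall_zero_iff]; linarith⟩
  have hqK : q ∈ K := ⟨hq, le_rfl⟩
  have hcont : ContinuousOn (fun q' => h q' / w q') K :=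
    hh.continuousOn.div (hw.mono fun q' hq' => hq'.1) fun q' hq' => (hw0 q' hq'.1).ne'
  obtain ⟨qm, hqm, hmax⟩ := hKc.exists_isMaxOn ⟨q, hqK⟩ hcont
  set M := h qm / w qm with hM
  have hwm := hw0 qm hqm.1
  have hM0 : 0 ≤ M := div_nonneg (hh0 _) hwm.le
  have hbd : ∀ q' ∈ K, h q' ≤ M * w q' := fun q' hq' =>
    (div_le_iff₀ (hw0 q' hq'.1)).1 (hmax hq')
  have h1 := himp M qm hM0 hqm.1 fun q' h2 h3 => hbd q' ⟨h2, h3.trans hqm.2⟩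
  have h2 : M ≤ A + M / 2 := by rwa [hM, div_le_iff₀ hwm]
  exact (hbd q hqK).trans (mul_le_mul_of_nonneg_right (by linarith) (hw0 q hq).le)

section
variable {p γ : ℝ}

lemma exists_small_nearC (hp : 2 < p) (hp3 : p < 3) (c : ℝ) :
    ∃ δ : ℝ, 0 < δ ∧ δ ≤ 1 / 16 ∧ c * nearC p γ δ ≤ 1 / 2 := by
  have h1 : 0 < 1 - (p - 1) / (p + 1) := by
    rw [sub_pos, div_lt_one (by linarith)]; linarith
  have hc : Continuous fun δ : ℝ => c * nearC p γ δ := by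
    unfold nearC
    have c1 : Continuous fun δ : ℝ => δ ^ ((5 - p) / 2) :=
      continuous_id.rpow_const fun _ => Or.inr (by linarith)
    have c2 : Continuous fun δ : ℝ => (δ ^ ((5 - p) / 2) * angC ((p - 1) / 2) (γ / 2)) ^
        (1 - (p - 1) / (p + 1)) := (c1.mul continuous_const).rpow_const fun _ => Or.inr h1.le
    exact continuous_const.mul (continuous_const.mul c2)
  have h0 : c * nearC p γ 0 = 0 := by
    rw [nearC, zero_rpow (by linarith), zero_mul, zero_rpow h1.ne']; ring
  have ht : ∀ᶠ δ in nhds (0 : ℝ), c * nearC p γ δ < 1 / 2 := by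
    refine hc.tendsto 0 (gt_mem_nhds ?_)
    rw [h0]; norm_num
  obtain ⟨ε, hε, hball⟩ := Metric.eventually_nhds_iff.1 ht
  refine ⟨min (ε / 2) (1 / 16), by positivity, min_le_right _ _, (hball ?_).le⟩
  rw [dist_zero_right, norm_of_nonneg (by positivity)]
  exact (min_le_left _ _).trans_lt (by linarith)

theorem decay_of_data (hp : 2 < p) (hp3 : p < 3) (hγ : 1 < γ) (hγp : γ < p - 1)
    (hpp : (p - 1) ^ 2 ≤ 5 - p) {B : ℝ} (hB : 0 < B) :
    ∃ C : ℝ, 0 < C ∧ ∀ Φ : ℝ × E3 → ℝ, ContDiff ℝ (⊤ : ℕ∞) Φ →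
      (∀ q : ℝ × E3, 0 ≤ q.1 →
        pT (pT Φ) q - ∑ i, pX i (pX i Φ) q + |Φ q| ^ (p - 1) * Φ q = 0) →
      ∀ E₀ E₁ : ℝ, 0 ≤ E₀ → E₀ ≤ B → E₀ ≤ E₁ →
      dataE p γ (fun x => Φ (0, x)) (fun x => pT Φ (0, x)) ≤ ENNReal.ofReal E₀ →
      dataE p γ (fun x => Φ (0, x)) (fun x => pT Φ (0, x)) +
        dataE2 γ (fun x => Φ (0, x)) (fun x => pT Φ (0, x)) ≤ ENNReal.ofReal E₁ →
      ∀ t : ℝ, 0 ≤ t → ∀ x : E3, |Φ (t, x)| ≤ C * √E₁ *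
        ((1 + t + ‖x‖) ^ (-decayExp p γ) * (1 + |‖x‖ - t|) ^ (-(γ / (p + 1)))) := by
  set m := sphereMeasure.real Set.univ with hm
  have hm0 : 0 < m := sphereMeasure_real_univ_pos
  have hp1 : 0 < p + 1 := by linarith
  set θ := (p - 1) / (p + 1) with hθ
  set θ' := p / (p + 1) with hθ'
  have hθ0 : 0 ≤ θ := div_nonneg (by linarith) hp1.le
  have hθ2 : 0 ≤ θ' - 1 / 2 := by
    rw [hθ', sub_nonneg, div_le_div_iff₀ (by norm_num) hp1]; linarith
  have hfx := fluxC_nonneg hp hγ hγp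
  obtain ⟨δ, hδ, hδ1, hδ2⟩ := exists_small_nearC (γ := γ) hp hp3
    (m⁻¹ * (fluxC p γ * (324 * B)) ^ θ)
  have hn := nearC_nonneg hp3 (show γ < 2 by linarith) hδ.le
  have hf := farC_nonneg hp hδ.le
  set c₁ := √405 * √(4 * capC (γ / 2)) with hc₁
  set c₂ := (fluxC p γ * 324) ^ θ' * B ^ (θ' - 1 / 2) * farC p δ with hc₂
  have hc₁0 : 0 ≤ c₁ := by positivity
  have hc₂0 : 0 ≤ c₂ := by positivity
  refine ⟨2 * (m⁻¹ * (c₁ + c₂)) + 1, by positivity, ?_⟩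
  intro Φ hΦ hpde E₀ E₁ hE₀ hEB hE h0 h1 t ht x
  have hE₁ : 0 ≤ E₁ := hE₀.trans hE
  have hpow : (fluxC p γ * (324 * E₀)) ^ θ' * farC p δ ≤ c₂ * √E₁ := by
    have e1 : E₀ ^ θ' ≤ √E₁ * B ^ (θ' - 1 / 2) := by
      have : E₀ ^ θ' = E₀ ^ (1 / 2 : ℝ) * E₀ ^ (θ' - 1 / 2) := by
        rw [← rpow_add' hE₀ (by linarith)]; congr 1; ring
      rw [this, ← sqrt_eq_rpow]
      exact mul_le_mul (sqrt_le_sqrt hE) (rpow_le_rpow hE₀ hEB hθ2) (by positivity) (by positivity)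
    rw [← mul_assoc, mul_rpow (by positivity) hE₀, hc₂]
    calc _ ≤ (fluxC p γ * 324) ^ θ' * (√E₁ * B ^ (θ' - 1 / 2)) * farC p δ := by gcongr
      _ = _ := by ring
  have hsmall : m⁻¹ * ((fluxC p γ * (324 * E₀)) ^ θ * nearC p γ δ) ≤ 1 / 2 := by
    refine le_trans ?_ hδ2
    rw [mul_assoc]
    gcongr
  set w : ℝ × E3 → ℝ := fun q =>
    (1 + q.1 + ‖q.2‖) ^ (-decayExp p γ) * (1 + |‖q.2‖ - q.1|) ^ (-(γ / (p + 1))) with hw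
  have hw0 : ∀ q : ℝ × E3, 0 ≤ q.1 → 0 < w q := fun q hq => by
    have : 0 < 1 + q.1 + ‖q.2‖ := by positivity
    positivity
  have hwc : ContinuousOn w {q | 0 ≤ q.1} := by
    refine ContinuousOn.mul ?_ ?_
    · refine ContinuousOn.rpow_const (by fun_prop) fun q hq => Or.inl ?_
      have : 0 ≤ q.1 := hq
      positivity
    · refine ContinuousOn.rpow_const (by fun_prop) fun q hq => Or.inl ?_
      positivity
  have hmain := bootstrap_cone (h := fun q => |Φ q|) (w := w) (A := m⁻¹ * (c₁ + c₂) * √E₁)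
    hΦ.continuous.abs (fun q => abs_nonneg _) hwc hw0 ?_ (t, x) ht
  · refine hmain.trans (mul_le_mul_of_nonneg_right ?_ (hw0 (t, x) ht).le)
    nlinarith [sqrt_nonneg E₁]
  intro M q hM hq hb
  obtain ⟨T, y⟩ := q
  obtain ⟨e, he, hey⟩ := exists_unit_eq_norm_smul y
  dsimp only at hq hb ⊢
  have h2 := decay_improvement hp hp3 hγ hγp hpp hΦ hpde hE₀ hE₁ h0 h1 hM hδ hδ1 hq
    (norm_nonneg y) e he hb
  rw [hey, abs_sub_comm T ‖y‖] at h2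
  have h3 : |Φ (T, y)| ≤ m⁻¹ * ((√(405 * E₁) * √(4 * capC (γ / 2)) +
      ((fluxC p γ * (324 * E₀)) ^ θ * nearC p γ δ * M +
        (fluxC p γ * (324 * E₀)) ^ θ' * farC p δ)) * w (T, y)) := by
    rw [inv_mul_eq_div, le_div_iff₀ hm0, mul_comm]
    exact h2
  refine h3.trans ?_
  rw [← mul_assoc]
  refine mul_le_mul_of_nonneg_right ?_ (hw0 (T, y) hq).le
  have h4 : √(405 * E₁) * √(4 * capC (γ / 2)) = c₁ * √E₁ := by
    rw [hc₁, sqrt_mul (by norm_num)]; ring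
  have h5 := mul_le_mul_of_nonneg_right hsmall hM
  have h6 := mul_le_mul_of_nonneg_left hpow (inv_pos.2 hm0).le
  rw [h4]
  linarith

end

lemma wEnergy_zero_eq {p γ : ℝ} {φ : ℝ → E3 → ℝ}
    (hφ : Differentiable ℝ fun q : ℝ × E3 => φ q.1 q.2) :
    wEnergy p 0 γ φ = dataE p γ (fun x => φ 0 x)
      (fun x => pT (fun q : ℝ × E3 => φ q.1 q.2) (0, x)) := by
  have hd : ∀ x, dt1 φ 0 x = pT (fun q : ℝ × E3 => φ q.1 q.2) (0, x) := fun x =>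
    pT_eq_deriv_slice hφ 0 x
  rw [wEnergy, dataE]
  simp [norm_iteratedFDeriv_one, norm_iteratedFDeriv_zero, hd]

lemma wEnergy_one_eq {p γ : ℝ} {φ : ℝ → E3 → ℝ}
    (hφ : Differentiable ℝ fun q : ℝ × E3 => φ q.1 q.2) :
    wEnergy p 1 γ φ = dataE p γ (fun x => φ 0 x)
      (fun x => pT (fun q : ℝ × E3 => φ q.1 q.2) (0, x)) +
      dataE2 γ (fun x => φ 0 x) (fun x => pT (fun q : ℝ × E3 => φ q.1 q.2) (0, x)) := by
  have hd : dt1 φ 0 = fun x => pT (fun q : ℝ × E3 => φ q.1 q.2) (0, x) :=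
    funext fun x => pT_eq_deriv_slice hφ 0 x
  rw [← wEnergy_zero_eq hφ, wEnergy, wEnergy, dataE2, hd]
  simp only [zero_add, Finset.sum_range_succ, Finset.sum_range_zero]
  simp only [norm_iteratedFDeriv_one, norm_iteratedFDeriv_zero, Nat.cast_one, Nat.cast_zero,
    mul_zero, mul_one, add_zero]
  rw [add_right_comm]

lemma IsNLWSolution.pde {p : ℝ} {φ : ℝ → E3 → ℝ} (h : IsNLWSolution p φ) (q : ℝ × E3)
    (hq : 0 ≤ q.1) :
    pT (pT fun q : ℝ × E3 => φ q.1 q.2) q -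
      ∑ i, pX i (pX i fun q : ℝ × E3 => φ q.1 q.2) q + |φ q.1 q.2| ^ (p - 1) * φ q.1 q.2 = 0 := by
  obtain ⟨hs, heq⟩ := h
  set Φ : ℝ × E3 → ℝ := fun q => φ q.1 q.2 with hΦ
  have d0 : Differentiable ℝ Φ := hs.differentiable (by simp)
  have e1 : ∀ t x, dt1 φ t x = pT Φ (t, x) := fun t x => pT_eq_deriv_slice d0 t x
  have e2 : ∀ t x, dtt φ t x = pT (pT Φ) (t, x) := fun t x => by
    rw [dtt]; simp only [e1]
    exact pT_eq_deriv_slice ((contDiff_pT hs).differentiable (by simp)) t x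
  have e3 : ∀ t x, lap3 (φ t) x = ∑ i, pX i (pX i Φ) (t, x) := fun t x => by
    rw [lap3]
    refine Finset.sum_congr rfl fun i _ => ?_
    have : ∀ y, fderiv ℝ (φ t) y (EuclideanSpace.single i 1) = pX i Φ (t, y) := fun y =>
      pX_eq_fderiv_slice d0 t y _
    rw [der2]; simp only [this]
    exact pX_eq_fderiv_slice ((contDiff_pX i hs).differentiable (by simp)) t x _
  have := heq q.1 hq q.2
  rwa [e2, e3] at this

/-- Pointwise decay for the small-power range
`2 < p ≤ (1+√17)/2`, `1 < γ₀ < p−1`, with `α_p = (3+(p−2)²)/((p+1)(5−p))`. -/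
theorem nlw_pointwise_decay_small_p (p γ₀ B : ℝ)
    (hp2 : 2 < p) (hp' : p ≤ (1 + Real.sqrt 17) / 2)
    (hγ₁ : 1 < γ₀) (hγ₂ : γ₀ < p - 1) (hB : 0 < B) :
    ∃ C : ℝ, 0 < C ∧ ∀ φ : ℝ → E3 → ℝ, IsNLWSolution p φ →
      wEnergy p 0 γ₀ φ ≤ ENNReal.ofReal B → wEnergy p 1 γ₀ φ < ⊤ →
      ∀ t : ℝ, 0 ≤ t → ∀ x : E3,
        |φ t x| ≤ C * Real.sqrt (wEnergy p 1 γ₀ φ).toReal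
          * (1 + t + ‖x‖) ^ (-((3 + (p - 2) ^ 2) / ((p + 1) * (5 - p)) * γ₀))
          * (1 + |‖x‖ - t|) ^ (-(γ₀ / (p + 1))) := by
  have h17 : √17 ^ 2 = 17 := sq_sqrt (by norm_num)
  have h17' : √17 < 5 := by rw [sqrt_lt' (by norm_num)]; norm_num
  have hp3 : p < 3 := by linarith
  have hpp : (p - 1) ^ 2 ≤ 5 - p := by nlinarith [sqrt_nonneg 17]
  have hexp : (3 + (p - 2) ^ 2) / ((p + 1) * (5 - p)) * γ₀ = decayExp p γ₀ := by
    have h1 : p + 1 ≠ 0 := by linarith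
    have h2 : 5 - p ≠ 0 := by linarith
    rw [decayExp]; field_simp; ring
  obtain ⟨C, hC, hmain⟩ := decay_of_data hp2 hp3 hγ₁ hγ₂ hpp hB
  refine ⟨C, hC, fun φ hφ h0 h1 t ht x => ?_⟩
  have hd : Differentiable ℝ fun q : ℝ × E3 => φ q.1 q.2 := hφ.1.differentiable (by simp)
  have hle : wEnergy p 0 γ₀ φ ≤ wEnergy p 1 γ₀ φ := by
    rw [wEnergy_zero_eq hd, wEnergy_one_eq hd]; exact le_self_add
  have h0' : wEnergy p 0 γ₀ φ ≠ ⊤ := (hle.trans_lt h1).ne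
  rw [hexp, mul_assoc]
  refine hmain (fun q => φ q.1 q.2) hφ.1 hφ.pde (wEnergy p 0 γ₀ φ).toReal
    (wEnergy p 1 γ₀ φ).toReal ENNReal.toReal_nonneg (ENNReal.toReal_le_of_le_ofReal hB.le h0)
    (ENNReal.toReal_mono h1.ne hle) ?_ ?_ t ht x
  · rw [ENNReal.ofReal_toReal h0', wEnergy_zero_eq hd]
  · rw [ENNReal.ofReal_toReal h1.ne, wEnergy_one_eq hd]

end
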